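/- For any R > 0 and α ∈ (0, π/2), let u be the unique entire solution of u_t = Δu + f(u) in ℝ × Ω̄ with Neumann boundary conditions emanating from the planar front in Ω = Ω_{R,α}, and assume u propagates completely, i.e. u(t,x) → 1 as t → +∞ locally uniformly in x ∈ Ω̄. Then for every λ ∈ (0,1) there exists r₀ > 0 such that for all t large enough, S_{r(t)−r₀} ⊂ {x ∈ Ω̄ : u(t,x) > λ} ⊂ S_{r(t)+r₀}, where r(t) = ct − ((N−1)/c) ln t and S_r = {x ∈ Ω̄ : x₁ ≤ 0} ∪ {x ∈ Ω̄ : |x| ≤ r}. -/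

import Mathlib

open Set Filter Topology MeasureTheory

noncomputable section

/-- `ℝ^N` with `N = d+1`, Euclidean structure. -/
abbrev Euc (d : ℕ) := EuclideanSpace ℝ (Fin (d + 1))

/-- The Euclidean norm of `x' = (x₂,…,x_N)` for `x = (x₁,x') ∈ ℝ^N`. -/
def primeNorm {d : ℕ} (x : Euc d) : ℝ :=
  Real.sqrt (∑ i, if i = 0 then 0 else (x i) ^ 2)

/-- The funnel-shaped domain `Ω = {x : |x'| < h(x₁)}`. -/
def funnel (d : ℕ) (h : ℝ → ℝ) : Set (Euc d) := {x | primeNorm x < h (x 0)}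

/-- The Laplacian of `g` at `x`, computed with derivatives taken within the set `s`. -/
def lapW {d : ℕ} (s : Set (Euc d)) (g : Euc d → ℝ) (x : Euc d) : ℝ :=
  ∑ i, fderivWithin ℝ (fun y => fderivWithin ℝ g s y (EuclideanSpace.single i 1)) s x
      (EuclideanSpace.single i 1)

/-- The quantity `ν·∇g` at a boundary point `x` of the funnel domain `Ω_{R,α}`, where
`ν(x) = (1+h'(x₁)²)^{-1/2}·(-h'(x₁), x'/|x'|)` is the outward unit normal. -/
def neumannLHS {d : ℕ} (h : ℝ → ℝ) (g : Euc d → ℝ) (x : Euc d) : ℝ :=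
  (Real.sqrt (1 + deriv h (x 0) ^ 2))⁻¹ *
    (-(deriv h (x 0)) * fderivWithin ℝ g (closure (funnel d h)) x (EuclideanSpace.single 0 1)
      + ∑ i, if i = 0 then 0 else
          (x i / primeNorm x) *
            fderivWithin ℝ g (closure (funnel d h)) x (EuclideanSpace.single i 1))

/-- The bistable nonlinearity `f`, of class `C^{1,1}`, with positive mass, extended affinely
outside `[0,1]`. -/
structure Bistable (f : ℝ → ℝ) (θ : ℝ) : Prop where
  smooth : ContDiff ℝ 1 f
  lip_deriv : ∃ C : NNReal, LipschitzWith C (deriv f)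
  f0 : f 0 = 0
  f1 : f 1 = 0
  df0 : deriv f 0 < 0
  df1 : deriv f 1 < 0
  θmem : θ ∈ Ioo (0 : ℝ) 1
  neg : ∀ s ∈ Ioo (0 : ℝ) θ, f s < 0
  pos : ∀ s ∈ Ioo θ (1 : ℝ), 0 < f s
  dθ : 0 < deriv f θ
  mass : 0 < ∫ s in (0 : ℝ)..1, f s
  ext_neg : ∀ s < (0 : ℝ), f s = deriv f 0 * s
  ext_pos : ∀ s > (1 : ℝ), f s = deriv f 1 * (s - 1)

/-- The planar traveling front `φ(x₁ - ct)`: `φ'' + cφ' + f(φ) = 0`, `φ(-∞) = 1`,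
`φ(+∞) = 0`, `0 < φ < 1`, `φ` decreasing, normalized by `φ(0) = θ`, with speed `c > 0`. -/
structure PlanarFront (f : ℝ → ℝ) (θ c : ℝ) (φ : ℝ → ℝ) : Prop where
  cpos : 0 < c
  mem : ∀ z : ℝ, φ z ∈ Ioo (0 : ℝ) 1
  smooth : ContDiff ℝ 2 φ
  anti : StrictAnti φ
  ode : ∀ z : ℝ, deriv (deriv φ) z + c * deriv φ z + f (φ z) = 0
  lim_bot : Tendsto φ atBot (nhds 1)
  lim_top : Tendsto φ atTop (nhds 0)
  pin : φ 0 = θ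

/-- `h : ℝ → ℝ` defines a funnel-shaped domain `Ω_{R,α}` (of dimension `N = d+1 ≥ 2`) with
cylinder radius `R`, opening angle `α` and transition parameter `L`. -/
structure IsFunnel (d : ℕ) (R α L : ℝ) (h : ℝ → ℝ) : Prop where
  dpos : 1 ≤ d
  Rpos : 0 < R
  αmem : α ∈ Ico (0 : ℝ) (Real.pi / 2)
  RL : R < L
  smooth : ContDiff ℝ 2 h
  holder : ∃ β : NNReal, 0 < β ∧ (β : ℝ) < 1 ∧ ∃ C : NNReal, HolderWith C β (deriv (deriv h))
  deriv_nonneg : ∀ x : ℝ, 0 ≤ deriv h x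
  deriv_le : ∀ x : ℝ, deriv h x ≤ Real.tan α
  left : ∀ x ≤ (0 : ℝ), h x = R
  right : ∀ x : ℝ, L * Real.cos α ≤ x → h x = x * Real.tan α

/-- An entire solution of `u_t = Δu + f(u)` in `ℝ × Ω̄` (with values in `[0,1]`),
Neumann boundary condition `ν·∇u = 0` on `ℝ × ∂Ω`, emanating from the planar front
`φ(x₁ - ct)` as `t → -∞`. -/
structure IsEntireSolution (d : ℕ) (h f : ℝ → ℝ) (c : ℝ) (φ : ℝ → ℝ)
    (u : ℝ → Euc d → ℝ) : Prop where
  range01 : ∀ t : ℝ, ∀ x ∈ closure (funnel d h), u t x ∈ Icc (0 : ℝ) 1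
  time_diff : ∀ x ∈ closure (funnel d h), Differentiable ℝ fun t => u t x
  space_reg : ∀ t : ℝ, ContDiffOn ℝ 2 (u t) (closure (funnel d h))
  pde : ∀ t : ℝ, ∀ x ∈ closure (funnel d h),
      deriv (fun s => u s x) t = lapW (closure (funnel d h)) (u t) x + f (u t x)
  neumann : ∀ t : ℝ, ∀ x ∈ frontier (funnel d h), neumannLHS h (u t) x = 0
  past : ∀ ε > (0 : ℝ), ∃ T : ℝ, ∀ t ≤ T, ∀ x ∈ closure (funnel d h),
      |u t x - φ (x 0 - c * t)| ≤ ε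

/-- Complete propagation: `u(t,x) → 1` as `t → +∞` locally uniformly in `x ∈ Ω̄`. -/
def CompletePropagation (d : ℕ) (h : ℝ → ℝ) (u : ℝ → Euc d → ℝ) : Prop :=
  TendstoLocallyUniformlyOn u (fun _ => (1 : ℝ)) atTop (closure (funnel d h))

/-- Blocking: `u(t,·)` converges uniformly on `Ω̄`, as `t → +∞`, to a stationary solution
`u_∞` with `u_∞(x) → 0` as `x₁ → +∞`. -/
def Blocked (d : ℕ) (h f : ℝ → ℝ) (u : ℝ → Euc d → ℝ) : Prop :=
  ∃ uinf : Euc d → ℝ,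
    TendstoUniformlyOn u uinf atTop (closure (funnel d h)) ∧
    ContDiffOn ℝ 2 uinf (closure (funnel d h)) ∧
    (∀ x ∈ closure (funnel d h), lapW (closure (funnel d h)) uinf x + f (uinf x) = 0) ∧
    (∀ x ∈ frontier (funnel d h), neumannLHS h uinf x = 0) ∧
    (∀ ε > (0 : ℝ), ∃ A : ℝ, ∀ x ∈ closure (funnel d h), A ≤ x 0 → |uinf x| ≤ ε)

/-- Stability of a solution `U` of `ΔU + f(U) = 0` on `s̄`:
`∫_s (|∇ψ|² - f'(U)ψ²) ≥ 0` for all compactly supported `C¹` functions `ψ`. -/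
def StableOn {d : ℕ} (s : Set (Euc d)) (f : ℝ → ℝ) (U : Euc d → ℝ) : Prop :=
  ∀ ψ : Euc d → ℝ, ContDiff ℝ 1 ψ → HasCompactSupport ψ →
    0 ≤ ∫ x in s, (‖gradient ψ x‖ ^ 2 - deriv f (U x) * ψ x ^ 2)

namespace FunnelFront

section
variable {d : ℕ}

/-- The `i`-th vector of the canonical basis. -/
abbrev bv (i : Fin (d + 1)) : Euc d := EuclideanSpace.single i 1

/-- The linear form with coefficients `p`. -/
def gradL (p : Fin (d + 1) → ℝ) : Euc d →L[ℝ] ℝ :=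
  ∑ i, p i • EuclideanSpace.proj (𝕜 := ℝ) i

theorem gradL_apply (p : Fin (d + 1) → ℝ) (v : Euc d) : gradL p v = ∑ i, p i * v i := by
  simp [gradL]

theorem gradL_bv (p : Fin (d + 1) → ℝ) (i : Fin (d + 1)) : gradL p (bv i) = p i := by
  simp [gradL_apply]

theorem gradL_add (p q : Fin (d + 1) → ℝ) :
    gradL (fun i => p i + q i) = gradL p + gradL q := by
  ext v; simp [gradL_apply, add_mul, Finset.sum_add_distrib]

theorem gradL_smul (a : ℝ) (p : Fin (d + 1) → ℝ) :
    gradL (fun i => a * p i) = a • gradL p := by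
  ext v; simp [gradL_apply, mul_assoc, Finset.mul_sum]

/-- `Jet ψ x G l`: near `x` the function `ψ` is differentiable, its gradient at `x` is `G`, and the
sum of its unmixed second partial derivatives at `x` is `l`. -/
def Jet (ψ : Euc d → ℝ) (x : Euc d) (G : Fin (d + 1) → ℝ) (l : ℝ) : Prop :=
  ∃ (P : Euc d → Fin (d + 1) → ℝ) (H : Fin (d + 1) → ℝ),
    (∀ᶠ y in 𝓝 x, HasFDerivAt ψ (gradL (P y)) y) ∧ P x = G ∧
    (∀ i, HasDerivAt (fun s : ℝ => P (x + s • bv i) i) (H i) 0) ∧ ∑ i, H i = l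

theorem Jet.hasFDerivAt {ψ : Euc d → ℝ} {x : Euc d} {G : Fin (d + 1) → ℝ} {l : ℝ}
    (h : Jet ψ x G l) : HasFDerivAt ψ (gradL G) x := by
  obtain ⟨P, H, h1, rfl, -, -⟩ := h
  exact h1.self_of_nhds

theorem Jet.continuousAt {ψ : Euc d → ℝ} {x : Euc d} {G : Fin (d + 1) → ℝ} {l : ℝ}
    (h : Jet ψ x G l) : ContinuousAt ψ x := h.hasFDerivAt.continuousAt

theorem hasDerivAt_line {ψ : Euc d → ℝ} {x : Euc d} {G : Fin (d + 1) → ℝ} (v : Euc d) (s : ℝ)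
    (h : HasFDerivAt ψ (gradL G) (x + s • v)) :
    HasDerivAt (fun s : ℝ => ψ (x + s • v)) (gradL G v) s := by
  have h2 : HasDerivAt (fun s : ℝ => x + s • v) v s := by
    simpa using ((hasDerivAt_id s).smul_const v).const_add x
  exact h.comp_hasDerivAt s h2

theorem Jet.hasDerivAt_bv {ψ : Euc d → ℝ} {x : Euc d} {G : Fin (d + 1) → ℝ} {l : ℝ}
    (h : Jet ψ x G l) (i : Fin (d + 1)) :
    HasDerivAt (fun s : ℝ => ψ (x + s • bv i)) (G i) 0 := by
  have := hasDerivAt_line (x := x) (bv i) 0 (by simpa using h.hasFDerivAt)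
  rwa [gradL_bv] at this

theorem Jet.congr_data {ψ : Euc d → ℝ} {x : Euc d} {G G' : Fin (d + 1) → ℝ} {l l' : ℝ}
    (h : Jet ψ x G l) (hG : ∀ i, G i = G' i) (hl : l = l') : Jet ψ x G' l' := by
  have : G = G' := funext hG
  subst this; subst hl; exact h

theorem Jet.congr {ψ ψ' : Euc d → ℝ} {x : Euc d} {G : Fin (d + 1) → ℝ} {l : ℝ}
    (h : Jet ψ x G l) (he : ψ' =ᶠ[𝓝 x] ψ) : Jet ψ' x G l := by
  obtain ⟨P, H, h1, h2, h3, h4⟩ := h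
  refine ⟨P, H, ?_, h2, h3, h4⟩
  filter_upwards [h1, he.eventuallyEq_nhds] with y hy hy'
  exact hy.congr_of_eventuallyEq hy'

theorem jet_const (a : ℝ) (x : Euc d) : Jet (fun _ => a) x (fun _ => 0) 0 := by
  refine ⟨fun _ _ => 0, fun _ => 0, ?_, rfl, fun i => hasDerivAt_const _ _, by simp⟩
  refine Eventually.of_forall fun y => ?_
  have : gradL (fun _ : Fin (d + 1) => (0 : ℝ)) = 0 := by ext; simp [gradL_apply]
  rw [this]; exact hasFDerivAt_const _ _

theorem jet_coord (j : Fin (d + 1)) (x : Euc d) :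
    Jet (fun y => y j) x (fun i => if i = j then 1 else 0) 0 := by
  refine ⟨fun _ i => if i = j then 1 else 0, fun _ => 0, ?_, rfl,
    fun i => hasDerivAt_const _ _, by simp⟩
  refine Eventually.of_forall fun y => ?_
  have : gradL (fun i : Fin (d + 1) => if i = j then (1 : ℝ) else 0)
      = EuclideanSpace.proj (𝕜 := ℝ) j := by
    ext v; simp [gradL_apply]
  rw [this]; exact (EuclideanSpace.proj (𝕜 := ℝ) j).hasFDerivAt

theorem Jet.add {ψ χ : Euc d → ℝ} {x : Euc d} {G K : Fin (d + 1) → ℝ} {l m : ℝ}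
    (h : Jet ψ x G l) (k : Jet χ x K m) :
    Jet (fun y => ψ y + χ y) x (fun i => G i + K i) (l + m) := by
  obtain ⟨P, H, h1, rfl, h3, rfl⟩ := h
  obtain ⟨Q, I, k1, rfl, k3, rfl⟩ := k
  refine ⟨fun y i => P y i + Q y i, fun i => H i + I i, ?_, rfl,
    fun i => (h3 i).add (k3 i), Finset.sum_add_distrib⟩
  filter_upwards [h1, k1] with y hy ky
  rw [gradL_add]; exact hy.add ky

theorem Jet.mul {ψ χ : Euc d → ℝ} {x : Euc d} {G K : Fin (d + 1) → ℝ} {l m : ℝ}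
    (h : Jet ψ x G l) (k : Jet χ x K m) :
    Jet (fun y => ψ y * χ y) x (fun i => ψ x * K i + χ x * G i)
      (ψ x * m + χ x * l + 2 * ∑ i, G i * K i) := by
  have hb := h.hasDerivAt_bv
  have kb := k.hasDerivAt_bv
  obtain ⟨P, H, h1, rfl, h3, rfl⟩ := h
  obtain ⟨Q, I, k1, rfl, k3, rfl⟩ := k
  refine ⟨fun y i => ψ y * Q y i + χ y * P y i,
    fun i => ψ x * I i + χ x * H i + 2 * (P x i * Q x i), ?_, rfl, fun i => ?_, ?_⟩
  · filter_upwards [h1, k1] with y hy ky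
    rw [gradL_add, gradL_smul, gradL_smul]; exact hy.mul ky
  · have := ((hb i).mul (k3 i)).add ((kb i).mul (h3 i))
    simp only [zero_smul, add_zero] at this
    refine this.congr_deriv ?_
    ring
  · simp only [Finset.sum_add_distrib, Finset.mul_sum]

theorem Jet.const_mul {ψ : Euc d → ℝ} {x : Euc d} {G : Fin (d + 1) → ℝ} {l : ℝ}
    (a : ℝ) (h : Jet ψ x G l) : Jet (fun y => a * ψ y) x (fun i => a * G i) (a * l) :=
  ((jet_const a x).mul h).congr_data (by simp) (by simp)

theorem Jet.neg {ψ : Euc d → ℝ} {x : Euc d} {G : Fin (d + 1) → ℝ} {l : ℝ}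
    (h : Jet ψ x G l) : Jet (fun y => -ψ y) x (fun i => -G i) (-l) := by
  simpa using h.const_mul (-1)

theorem Jet.sub {ψ χ : Euc d → ℝ} {x : Euc d} {G K : Fin (d + 1) → ℝ} {l m : ℝ}
    (h : Jet ψ x G l) (k : Jet χ x K m) :
    Jet (fun y => ψ y - χ y) x (fun i => G i - K i) (l - m) := by
  simpa [sub_eq_add_neg] using h.add k.neg

theorem jet_sum {ι : Type*} (s : Finset ι) {ψ : ι → Euc d → ℝ} {x : Euc d}
    {G : ι → Fin (d + 1) → ℝ} {l : ι → ℝ} (h : ∀ j ∈ s, Jet (ψ j) x (G j) (l j)) :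
    Jet (fun y => ∑ j ∈ s, ψ j y) x (fun i => ∑ j ∈ s, G j i) (∑ j ∈ s, l j) := by
  classical
  induction s using Finset.induction_on with
  | empty => simpa using jet_const 0 x
  | insert a s ha ih =>
    simp only [Finset.sum_insert ha]
    exact (h a (by simp)).add (ih fun j hj => h j (by simp [hj]))

/-- Chain rule for the composition with a function of one real variable. -/
theorem Jet.comp {ψ : Euc d → ℝ} {x : Euc d} {G : Fin (d + 1) → ℝ} {l : ℝ}
    (h : Jet ψ x G l) {F F1 : ℝ → ℝ} {F2 : ℝ} (hF : ∀ᶠ s in 𝓝 (ψ x), HasDerivAt F (F1 s) s)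
    (hF1 : HasDerivAt F1 F2 (ψ x)) :
    Jet (fun y => F (ψ y)) x (fun i => F1 (ψ x) * G i)
      (F1 (ψ x) * l + F2 * ∑ i, G i ^ 2) := by
  have hb := h.hasDerivAt_bv
  have hc := h.continuousAt
  obtain ⟨P, H, h1, rfl, h3, rfl⟩ := h
  refine ⟨fun y i => F1 (ψ y) * P y i, fun i => F1 (ψ x) * H i + F2 * P x i ^ 2, ?_, rfl,
    fun i => ?_, ?_⟩
  · filter_upwards [h1, hc.eventually hF] with y hy ky
    rw [gradL_smul]; exact ky.comp_hasFDerivAt y hy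
  · have h4 : HasDerivAt (fun s : ℝ => F1 (ψ (x + s • bv i))) (F2 * P x i) 0 := by
      refine HasDerivAt.comp (h₂ := F1) (h := fun s : ℝ => ψ (x + s • bv i)) 0 ?_ (hb i)
      simpa using hF1
    have := h4.mul (h3 i)
    simp only [zero_smul, add_zero] at this
    refine this.congr_deriv ?_
    ring
  · simp only [Finset.sum_add_distrib, Finset.mul_sum]

theorem jet_coord_comp (j : Fin (d + 1)) (x : Euc d) {F F1 : ℝ → ℝ} {F2 : ℝ}
    (hF : ∀ᶠ s in 𝓝 (x j), HasDerivAt F (F1 s) s) (hF1 : HasDerivAt F1 F2 (x j)) :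
    Jet (fun y => F (y j)) x (fun i => if i = j then F1 (x j) else 0) F2 :=
  ((jet_coord j x).comp hF hF1).congr_data (by intro i; simp) (by simp)

theorem jet_dist_sq (y x : Euc d) :
    Jet (fun z => ‖z - y‖ ^ 2) x (fun i => 2 * (x i - y i)) (2 * (d + 1)) := by
  have h : ∀ j ∈ (Finset.univ : Finset (Fin (d + 1))),
      Jet (fun z => (z j - y j) ^ 2) x (fun i => if i = j then 2 * (x j - y j) else 0) 2 := by
    intro j _
    refine jet_coord_comp (F := fun s => (s - y j) ^ 2) (F1 := fun s => 2 * (s - y j)) j x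
      (Eventually.of_forall fun s => ?_) ?_
    · exact (((hasDerivAt_id s).sub_const (y j)).fun_pow 2).congr_deriv (by simp)
    · simpa using ((hasDerivAt_id (x j)).sub_const (y j)).const_mul 2
  refine ((jet_sum Finset.univ h).congr (Eventually.of_forall fun z => ?_)).congr_data
    (by intro i; simp) ?_
  · simp [EuclideanSpace.norm_sq_eq]
  · simp; ring

/-- The squared norm of `x' = (x₂,…,x_N)`. -/
def primeSq (x : Euc d) : ℝ := ∑ i, if i = 0 then 0 else (x i) ^ 2

theorem primeSq_nonneg (x : Euc d) : 0 ≤ primeSq x :=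
  Finset.sum_nonneg fun i _ => by split_ifs <;> positivity

theorem primeNorm_sq (x : Euc d) : primeNorm x ^ 2 = primeSq x :=
  Real.sq_sqrt (primeSq_nonneg x)

theorem primeNorm_nonneg (x : Euc d) : 0 ≤ primeNorm x := Real.sqrt_nonneg _

theorem sum_eq_zero_add {F : Fin (d + 1) → ℝ} :
    ∑ i, F i = F 0 + ∑ i, if i = 0 then 0 else F i := by
  rw [Fin.sum_univ_succ, Fin.sum_univ_succ (f := fun i => if i = 0 then 0 else F i)]
  simp

theorem norm_sq_eq (x : Euc d) : ‖x‖ ^ 2 = x 0 ^ 2 + primeSq x := by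
  rw [EuclideanSpace.norm_sq_eq, sum_eq_zero_add]; simp [primeSq]

theorem jet_primeSq (x : Euc d) :
    Jet primeSq x (fun i => if i = 0 then 0 else 2 * x i) (2 * d) := by
  have h := (jet_dist_sq 0 x).sub (jet_coord_comp (F := fun s => s ^ 2) (F1 := fun s => 2 * s)
    (F2 := 2) 0 x
    (Eventually.of_forall fun s => by simpa using hasDerivAt_pow 2 s)
    (by simpa using (hasDerivAt_id (x 0)).const_mul 2))
  refine (h.congr (Eventually.of_forall fun z => ?_)).congr_data ?_ (by ring)
  · simp [norm_sq_eq]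
  · intro i
    by_cases hi : i = 0 <;> simp [hi]

/-- The normal derivative, up to a positive factor, expressed with a gradient `G`. -/
def NL (h : ℝ → ℝ) (x : Euc d) (G : Fin (d + 1) → ℝ) : ℝ :=
  -(deriv h (x 0)) * G 0 + ∑ i, if i = 0 then 0 else (x i / primeNorm x) * G i

theorem NL_add (h : ℝ → ℝ) (x : Euc d) (G K : Fin (d + 1) → ℝ) :
    NL h x (fun i => G i + K i) = NL h x G + NL h x K := by
  have : ∀ i, (if i = 0 then 0 else (x i / primeNorm x) * (G i + K i))
    = (if i = 0 then 0 else (x i / primeNorm x) * G i)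
      + (if i = 0 then 0 else (x i / primeNorm x) * K i) := by
    intro i; split_ifs <;> ring
  simp only [NL, this, Finset.sum_add_distrib]; ring

theorem NL_mul (h : ℝ → ℝ) (x : Euc d) (a : ℝ) (G : Fin (d + 1) → ℝ) :
    NL h x (fun i => a * G i) = a * NL h x G := by
  have : ∀ i, (if i = 0 then 0 else (x i / primeNorm x) * (a * G i))
    = a * (if i = 0 then 0 else (x i / primeNorm x) * G i) := by
    intro i; split_ifs <;> ring
  simp only [NL, this, ← Finset.mul_sum]; ring

theorem NL_zero (h : ℝ → ℝ) (x : Euc d) : NL h x (fun _ => 0) = 0 := by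
  simp [NL]

theorem NL_coord_zero (h : ℝ → ℝ) (x : Euc d) (a : ℝ) :
    NL h x (fun i => if i = 0 then a else 0) = -(deriv h (x 0)) * a := by
  have : ∀ i : Fin (d + 1), (if i = 0 then 0 else (x i / primeNorm x) * (if i = 0 then a else 0))
      = 0 := by
    intro i; split_ifs <;> simp
  simp only [NL, this]; simp

theorem sum_prime_div (x : Euc d) (hx : 0 < primeNorm x) (a : ℝ) :
    (∑ i, if i = 0 then 0 else (x i / primeNorm x) * (a * x i)) = a * primeNorm x := by
  have : ∀ i, (if i = 0 then 0 else (x i / primeNorm x) * (a * x i))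
    = (a / primeNorm x) * (if i = 0 then 0 else (x i) ^ 2) := by
    intro i; split_ifs <;> ring
  simp only [this, ← Finset.mul_sum]
  change a / primeNorm x * primeSq x = _
  rw [← primeNorm_sq]; field_simp

theorem NL_primeSq (h : ℝ → ℝ) (x : Euc d) (hx : 0 < primeNorm x) :
    NL h x (fun i => if i = 0 then 0 else 2 * x i) = 2 * primeNorm x := by
  rw [← sum_prime_div x hx 2]
  simp only [NL, if_true, mul_zero, zero_add]
  refine Finset.sum_congr rfl fun i _ => ?_
  split_ifs <;> rfl

theorem NL_norm_sq (h : ℝ → ℝ) (x : Euc d) (hx : 0 < primeNorm x) :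
    NL h x (fun i => 2 * x i) = 2 * (primeNorm x - x 0 * deriv h (x 0)) := by
  unfold NL
  rw [sum_prime_div x hx 2]; ring
end

section
variable {d : ℕ} {h : ℝ → ℝ} {R α L : ℝ}

theorem hasDerivAt_of_contDiff_two {F : ℝ → ℝ} (hF : ContDiff ℝ 2 F) (s : ℝ) :
    HasDerivAt F (deriv F s) s :=
  (hF.differentiable (by norm_num) s).hasDerivAt

theorem hasDerivAt_deriv_of_contDiff_two {F : ℝ → ℝ} (hF : ContDiff ℝ 2 F) (s : ℝ) :
    HasDerivAt (deriv F) (deriv (deriv F) s) s := by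
  have h1 : ContDiff ℝ 1 (deriv F) := by
    have := (contDiff_succ_iff_deriv (n := 1) (f := F) (𝕜 := ℝ)).1 (by rw [one_add_one_eq_two]; exact hF)
    exact this.2.2
  exact (h1.differentiable (by norm_num) s).hasDerivAt

theorem continuous_deriv_of_contDiff_two {F : ℝ → ℝ} (hF : ContDiff ℝ 2 F) :
    Continuous (deriv F) :=
  continuous_iff_continuousAt.2 fun s => (hasDerivAt_deriv_of_contDiff_two hF s).continuousAt

theorem continuous_deriv_deriv_of_contDiff_two {F : ℝ → ℝ} (hF : ContDiff ℝ 2 F) :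
    Continuous (deriv (deriv F)) := by
  have h1 : ContDiff ℝ 1 (deriv F) := by
    have := (contDiff_succ_iff_deriv (n := 1) (f := F) (𝕜 := ℝ)).1 (by rw [one_add_one_eq_two]; exact hF)
    exact this.2.2
  exact h1.continuous_deriv (by norm_num)

theorem continuous_primeSq : Continuous (primeSq (d := d)) := by
  unfold primeSq
  refine continuous_finsetSum _ fun i _ => ?_
  split_ifs
  · exact continuous_const
  · exact (EuclideanSpace.proj (𝕜 := ℝ) i).continuous.pow 2

theorem continuous_primeNorm : Continuous (primeNorm (d := d)) :=
  continuous_primeSq.sqrt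

theorem continuous_coord (i : Fin (d + 1)) : Continuous fun x : Euc d => x i :=
  (EuclideanSpace.proj (𝕜 := ℝ) i).continuous

theorem _root_.IsFunnel.continuous (hΩ : IsFunnel d R α L h) : Continuous h := hΩ.smooth.continuous

theorem isOpen_funnel (hΩ : IsFunnel d R α L h) : IsOpen (funnel d h) :=
  isOpen_lt continuous_primeNorm (hΩ.smooth.continuous.comp (continuous_coord 0))

theorem primeNorm_le_of_mem_closure (hΩ : IsFunnel d R α L h) {x : Euc d}
    (hx : x ∈ closure (funnel d h)) : primeNorm x ≤ h (x 0) := by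
  have hc : IsClosed {x : Euc d | primeNorm x ≤ h (x 0)} :=
    isClosed_le continuous_primeNorm (hΩ.smooth.continuous.comp (continuous_coord 0))
  have hs : funnel d h ⊆ {x : Euc d | primeNorm x ≤ h (x 0)} := fun y (hy : primeNorm y < h (y 0)) => hy.le
  exact closure_minimal hs hc hx

theorem monotone_profile (hΩ : IsFunnel d R α L h) : Monotone h :=
  monotone_of_deriv_nonneg (hΩ.smooth.differentiable (by norm_num)) hΩ.deriv_nonneg

theorem le_profile (hΩ : IsFunnel d R α L h) (s : ℝ) : R ≤ h s := by
  rcases le_total s 0 with hs | hs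
  · exact (hΩ.left s hs).ge
  · rw [← hΩ.left 0 le_rfl]; exact monotone_profile hΩ hs

theorem profile_pos (hΩ : IsFunnel d R α L h) (s : ℝ) : 0 < h s :=
  hΩ.Rpos.trans_le (le_profile hΩ s)

theorem primeNorm_eq_of_notMem (hΩ : IsFunnel d R α L h) {x : Euc d}
    (hx : x ∈ closure (funnel d h)) (hx' : x ∉ funnel d h) : primeNorm x = h (x 0) :=
  le_antisymm (primeNorm_le_of_mem_closure hΩ hx) (not_lt.1 hx')

theorem mem_frontier_of_notMem (hΩ : IsFunnel d R α L h) {x : Euc d}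
    (hx : x ∈ closure (funnel d h)) (hx' : x ∉ funnel d h) : x ∈ frontier (funnel d h) := by
  rw [(isOpen_funnel hΩ).frontier_eq]; exact ⟨hx, hx'⟩

theorem primeNorm_pos_of_notMem (hΩ : IsFunnel d R α L h) {x : Euc d}
    (hx : x ∈ closure (funnel d h)) (hx' : x ∉ funnel d h) : 0 < primeNorm x := by
  rw [primeNorm_eq_of_notMem hΩ hx hx']; exact profile_pos hΩ _

/-- An inward direction at `x`. -/
def inward (h : ℝ → ℝ) (x : Euc d) : Euc d :=
  WithLp.toLp 2 fun i => if i = 0 then deriv h (x 0) else -(x i / primeNorm x)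

theorem gradL_inward (x : Euc d) (G : Fin (d + 1) → ℝ) :
    gradL G (inward h x) = -NL h x G := by
  rw [gradL_apply, sum_eq_zero_add, NL, neg_add, ← Finset.sum_neg_distrib]
  congr 1
  · simp [inward]; ring
  · refine Finset.sum_congr rfl fun i _ => ?_
    by_cases hi : i = 0 <;> simp [inward, hi]; ring

theorem add_inward_mem (hΩ : IsFunnel d R α L h) {x : Euc d}
    (hx : x ∈ closure (funnel d h)) {s : ℝ} (hs : 0 < s)
    (hs' : s < primeNorm x) : x + s • inward h x ∈ funnel d h := by
  have hp := hs.trans hs'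
  have h1 : primeSq (x + s • inward h x) = (primeNorm x - s) ^ 2 := by
    have : ∀ i, (if i = 0 then 0 else ((x + s • inward h x) i) ^ 2)
        = (1 - s / primeNorm x) ^ 2 * (if i = 0 then 0 else (x i) ^ 2) := by
      intro i
      by_cases hi : i = 0
      · simp [hi]
      · simp [hi, inward]; ring
    rw [primeSq]; simp only [this, ← Finset.mul_sum]
    change _ * primeSq x = _
    rw [← primeNorm_sq, ← mul_pow, sub_mul, one_mul, div_mul_cancel₀ _ hp.ne']
  have h2 : primeNorm (x + s • inward h x) = primeNorm x - s := by
    change Real.sqrt (primeSq _) = _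
    rw [h1, Real.sqrt_sq (by linarith)]
  change primeNorm _ < h _
  rw [h2]
  have h3 : h (x 0) ≤ h ((x + s • inward h x) 0) := by
    apply monotone_profile hΩ
    have := hΩ.deriv_nonneg (x 0)
    simp [inward]; positivity
  linarith [primeNorm_le_of_mem_closure hΩ hx]

/-- `h(x₁)² - |x'|²`, a function positive in the funnel domain and vanishing on its boundary. -/
def defect (h : ℝ → ℝ) (x : Euc d) : ℝ := h (x 0) ^ 2 - primeSq x

/-- The gradient of `defect`. -/
def defectGrad (h : ℝ → ℝ) (x : Euc d) (i : Fin (d + 1)) : ℝ :=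
  if i = 0 then 2 * h (x 0) * deriv h (x 0) else -(2 * x i)

/-- The Laplacian of `defect`. -/
def defectLap (h : ℝ → ℝ) (x : Euc d) : ℝ :=
  2 * (deriv h (x 0) ^ 2 + h (x 0) * deriv (deriv h) (x 0)) - 2 * d

theorem jet_defect (hΩ : IsFunnel d R α L h) (x : Euc d) :
    Jet (defect h) x (defectGrad h x) (defectLap h x) := by
  have h1 := jet_coord_comp (F := fun s => h s ^ 2) (F1 := fun s => 2 * h s * deriv h s)
    (F2 := 2 * (deriv h (x 0) ^ 2 + h (x 0) * deriv (deriv h) (x 0))) 0 x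
    (Eventually.of_forall fun s =>
      ((hasDerivAt_of_contDiff_two hΩ.smooth s).fun_pow 2).congr_deriv (by simp))
    ((((hasDerivAt_of_contDiff_two hΩ.smooth (x 0)).const_mul 2).fun_mul
      (hasDerivAt_deriv_of_contDiff_two hΩ.smooth (x 0))).congr_deriv (by ring))
  refine (h1.sub (jet_primeSq x)).congr_data ?_ rfl
  intro i
  by_cases hi : i = 0 <;> simp [hi, defectGrad]

theorem NL_defect (hΩ : IsFunnel d R α L h) {x : Euc d}
    (hx : x ∈ closure (funnel d h)) (hx' : x ∉ funnel d h) :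
    NL h x (defectGrad h x) = -2 * h (x 0) * (1 + deriv h (x 0) ^ 2) := by
  have e : defectGrad h x = fun i => (if i = 0 then 2 * h (x 0) * deriv h (x 0) else 0)
      + (-1) * (if i = 0 then 0 else 2 * x i) := by
    funext i; by_cases hi : i = 0 <;> simp [hi, defectGrad]
  rw [e, NL_add, NL_mul, NL_coord_zero, NL_primeSq h x (primeNorm_pos_of_notMem hΩ hx hx'),
    primeNorm_eq_of_notMem hΩ hx hx']
  ring

theorem defect_nonneg (hΩ : IsFunnel d R α L h) {x : Euc d} (hx : x ∈ closure (funnel d h)) :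
    0 ≤ defect h x := by
  have h1 := primeNorm_le_of_mem_closure hΩ hx
  have h2 := primeNorm_nonneg x
  rw [defect, ← primeNorm_sq]; nlinarith

theorem defect_eq_zero (hΩ : IsFunnel d R α L h) {x : Euc d}
    (hx : x ∈ closure (funnel d h)) (hx' : x ∉ funnel d h) : defect h x = 0 := by
  rw [defect, ← primeNorm_sq, primeNorm_eq_of_notMem hΩ hx hx']; ring

theorem continuous_defect (hΩ : IsFunnel d R α L h) : Continuous (defect (d := d) h) :=
  ((hΩ.continuous.comp (continuous_coord 0)).pow 2).sub continuous_primeSq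

theorem continuous_defectLap (hΩ : IsFunnel d R α L h) : Continuous (defectLap (d := d) h) := by
  have h0 := hΩ.continuous.comp (continuous_coord (d := d) 0)
  have h1 := (continuous_deriv_of_contDiff_two hΩ.smooth).comp (continuous_coord (d := d) 0)
  have h2 := (continuous_deriv_deriv_of_contDiff_two hΩ.smooth).comp (continuous_coord (d := d) 0)
  exact (((h1.pow 2).add (h0.mul h2)).const_mul 2).sub continuous_const

theorem continuous_defectGrad (hΩ : IsFunnel d R α L h) (i : Fin (d + 1)) :
    Continuous fun x : Euc d => defectGrad h x i := by
  have h0 := hΩ.continuous.comp (continuous_coord (d := d) 0)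
  have h1 := (continuous_deriv_of_contDiff_two hΩ.smooth).comp (continuous_coord (d := d) 0)
  unfold defectGrad
  split_ifs
  · exact (h0.const_mul 2).mul h1
  · exact ((continuous_coord i).const_mul 2).neg

/-- A solution with values in `[0,1]` of the Neumann problem `v_t = Δv + f(v)`. -/
structure Sol (d : ℕ) (h f : ℝ → ℝ) (v : ℝ → Euc d → ℝ) : Prop where
  range01 : ∀ t : ℝ, ∀ x ∈ closure (funnel d h), v t x ∈ Icc (0 : ℝ) 1
  time_diff : ∀ x ∈ closure (funnel d h), Differentiable ℝ fun t => v t x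
  space_reg : ∀ t : ℝ, ContDiffOn ℝ 2 (v t) (closure (funnel d h))
  pde : ∀ t : ℝ, ∀ x ∈ funnel d h,
      deriv (fun s => v s x) t = lapW (closure (funnel d h)) (v t) x + f (v t x)
  neumann : ∀ t : ℝ, ∀ x ∈ frontier (funnel d h), ∃ D : Euc d →L[ℝ] ℝ,
      HasFDerivWithinAt (v t) D (closure (funnel d h)) x ∧ NL h x (fun i => D (bv i)) = 0

theorem _root_.IsEntireSolution.sol {f φ : ℝ → ℝ} {c : ℝ} {u : ℝ → Euc d → ℝ}
    (hu : IsEntireSolution d h f c φ u) : Sol d h f u := by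
  refine ⟨hu.range01, hu.time_diff, hu.space_reg,
    fun t x hx => hu.pde t x (subset_closure hx), fun t x hx => ⟨_,
      ((hu.space_reg t).differentiableOn (by norm_num) x
        (frontier_subset_closure hx)).hasFDerivWithinAt, ?_⟩⟩
  have hneu := hu.neumann t x hx
  unfold neumannLHS at hneu
  have hs : (Real.sqrt (1 + deriv h (x 0) ^ 2))⁻¹ ≠ 0 := by positivity
  exact (mul_eq_zero.1 hneu).resolve_left hs

theorem eventually_closure_mem_nhds (hΩ : IsFunnel d R α L h) {x : Euc d} (hx : x ∈ funnel d h) :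
    ∀ᶠ y in 𝓝 x, closure (funnel d h) ∈ 𝓝 y := by
  filter_upwards [(isOpen_funnel hΩ).mem_nhds hx] with y hy
  exact mem_of_superset ((isOpen_funnel hΩ).mem_nhds hy) subset_closure

theorem lapW_eq_of_mem (hΩ : IsFunnel d R α L h) (g : Euc d → ℝ) {x : Euc d}
    (hx : x ∈ funnel d h) :
    lapW (closure (funnel d h)) g x = ∑ i, fderiv ℝ (fun y => fderiv ℝ g y (bv i)) x (bv i) := by
  have hnhds := eventually_closure_mem_nhds hΩ hx
  refine Finset.sum_congr rfl fun i _ => ?_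
  have heq : (fun y => fderivWithin ℝ g (closure (funnel d h)) y (bv i))
      =ᶠ[𝓝 x] fun y => fderiv ℝ g y (bv i) := by
    filter_upwards [hnhds] with y hy
    rw [fderivWithin_of_mem_nhds hy]
  rw [fderivWithin_of_mem_nhds hnhds.self_of_nhds, heq.fderiv_eq]

theorem Sol.one_sub (hΩ : IsFunnel d R α L h) {f : ℝ → ℝ} {v : ℝ → Euc d → ℝ}
    (hv : Sol d h f v) : Sol d h (fun s => -f (1 - s)) (fun t x => 1 - v t x) := by
  refine ⟨fun t x hx => ?_, fun x hx => ?_, fun t => ?_, fun t x hx => ?_, fun t x hx => ?_⟩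
  · obtain ⟨h1, h2⟩ := hv.range01 t x hx
    exact ⟨by linarith, by linarith⟩
  · exact (hv.time_diff x hx).const_sub 1
  · exact contDiffOn_const.sub (hv.space_reg t)
  · have e : lapW (closure (funnel d h)) (fun x => 1 - v t x) x
        = -lapW (closure (funnel d h)) (v t) x := by
      rw [lapW_eq_of_mem hΩ _ hx, lapW_eq_of_mem hΩ _ hx, ← Finset.sum_neg_distrib]
      refine Finset.sum_congr rfl fun i _ => ?_
      have e1 : (fun y => fderiv ℝ (fun x => 1 - v t x) y (bv i))
          = fun y => -fderiv ℝ (v t) y (bv i) := by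
        funext y; rw [fderiv_const_sub]; rfl
      rw [e1, fderiv_fun_neg]; rfl
    rw [e, deriv_const_sub, hv.pde t x hx, sub_sub_cancel]; ring
  · obtain ⟨D, h1, h2⟩ := hv.neumann t x hx
    refine ⟨-D, h1.const_sub 1, ?_⟩
    have := NL_mul h x (-1) (fun i => D (bv i))
    rw [h2] at this
    simpa using this

/-- Comparison of second derivatives at a local maximum of a difference. -/
theorem second_deriv_le_of_isLocalMax {k k1 m m1 : ℝ → ℝ} {k2 m2 : ℝ}
    (hmax : IsLocalMax (fun s => k s - m s) 0)
    (hk : ∀ᶠ s in 𝓝 (0 : ℝ), HasDerivAt k (k1 s) s) (hk1 : HasDerivAt k1 k2 0)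
    (hm : ∀ᶠ s in 𝓝 (0 : ℝ), HasDerivAt m (m1 s) s) (hm1 : HasDerivAt m1 m2 0) : k2 ≤ m2 := by
  by_contra! hlt
  have hd : deriv (fun s => k s - m s) =ᶠ[𝓝 0] fun s => k1 s - m1 s := by
    filter_upwards [hk, hm] with s h1 h2 using (h1.sub h2).deriv
  have hdd : deriv (deriv (fun s => k s - m s)) 0 = k2 - m2 := by
    rw [hd.deriv_eq]; exact (hk1.sub hm1).deriv
  have hc : ContinuousAt (fun s => k s - m s) 0 :=
    (hk.self_of_nhds.sub hm.self_of_nhds).continuousAt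
  have hmin := isLocalMin_of_deriv_deriv_pos (f := fun s => k s - m s) (x₀ := 0)
    (by rw [hdd]; linarith) hmax.deriv_eq_zero hc
  have hconst : (fun s => k s - m s) =ᶠ[𝓝 0] fun _ => k 0 - m 0 := by
    filter_upwards [hmin, hmax] with s h1 h2 using le_antisymm h2 h1
  have h0 : deriv (deriv (fun s => k s - m s)) 0 = 0 := by
    have : deriv (fun s => k s - m s) =ᶠ[𝓝 0] fun _ => 0 := by
      filter_upwards [hconst.eventuallyEq_nhds] with s hs
      rw [hs.deriv_eq]; simp
    rw [this.deriv_eq]; simp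
  rw [hdd] at h0; linarith

theorem lapW_le_of_isLocalMax (hΩ : IsFunnel d R α L h) {g ψ : Euc d → ℝ}
    (hg : ContDiffOn ℝ 2 g (closure (funnel d h))) {x : Euc d} (hx : x ∈ funnel d h)
    {G : Fin (d + 1) → ℝ} {l : ℝ} (hψ : Jet ψ x G l)
    (hmax : IsLocalMax (fun y => g y - ψ y) x) :
    lapW (closure (funnel d h)) g x ≤ l := by
  obtain ⟨P, H, h1, rfl, h3, rfl⟩ := hψ
  rw [lapW_eq_of_mem hΩ g hx]
  refine Finset.sum_le_sum fun i _ => ?_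
  have hga : ContDiffAt ℝ 2 g x := hg.contDiffAt (eventually_closure_mem_nhds hΩ hx).self_of_nhds
  have hline : Tendsto (fun s : ℝ => x + s • bv i) (𝓝 0) (𝓝 x) := by
    have : Continuous fun s : ℝ => x + s • bv i := by fun_prop
    simpa using this.tendsto 0
  have hgd : ∀ᶠ y in 𝓝 x, DifferentiableAt ℝ g y := by
    filter_upwards [hga.eventually (by simp)] with y hy
    exact hy.differentiableAt (by norm_num)
  have hl : ∀ s : ℝ, HasDerivAt (fun s : ℝ => x + s • bv i) (bv i) s := fun s => by
    simpa using ((hasDerivAt_id s).smul_const (bv i)).const_add x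
  refine second_deriv_le_of_isLocalMax (k := fun s => g (x + s • bv i))
    (k1 := fun s => fderiv ℝ g (x + s • bv i) (bv i)) (m := fun s => ψ (x + s • bv i))
    (m1 := fun s => P (x + s • bv i) i) ?_ ?_ ?_ ?_ (h3 i)
  · have := hline.eventually hmax
    simpa [IsLocalMax, IsMaxFilter] using this
  · filter_upwards [hline.eventually hgd] with s hs
    exact hs.hasFDerivAt.comp_hasDerivAt s (hl s)
  · have h2 : ContDiffAt ℝ 1 (fderiv ℝ g) x := hga.fderiv_right (by norm_num)
    have h2' : DifferentiableAt ℝ (fun y => fderiv ℝ g y (bv i)) x :=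
      (h2.differentiableAt (by norm_num)).clm_apply (differentiableAt_const _)
    refine HasFDerivAt.comp_hasDerivAt (f := fun s : ℝ => x + s • bv i)
      (l := fun y => fderiv ℝ g y (bv i)) 0 ?_ (hl 0)
    simpa using h2'.hasFDerivAt
  · filter_upwards [hline.eventually h1] with s hs
    have := hasDerivAt_line (bv i) s hs
    rwa [gradL_bv] at this

theorem not_isMaxOn_of_NL_pos (hΩ : IsFunnel d R α L h) {g ψ : Euc d → ℝ} {x : Euc d}
    (hx : x ∈ closure (funnel d h)) (hx' : x ∉ funnel d h)
    {D : Euc d →L[ℝ] ℝ} (hg : HasFDerivWithinAt g D (closure (funnel d h)) x)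
    (hNL : NL h x (fun i => D (bv i)) = 0)
    {G : Fin (d + 1) → ℝ} (hψ : HasFDerivAt ψ (gradL G) x) (hG : 0 < NL h x G)
    (hmax : ∀ᶠ y in 𝓝[closure (funnel d h)] x, g y - ψ y ≤ g x - ψ x) : False := by
  set e := inward h x with he
  have hp := primeNorm_pos_of_notMem hΩ hx hx'
  have hDe : D = gradL (fun i => D (bv i)) := by
    ext v
    have hv : v = ∑ i, v i • bv i := by
      ext j; simp [Pi.single_apply]
    conv_lhs => rw [hv]
    rw [map_sum, gradL_apply]
    refine Finset.sum_congr rfl fun i _ => ?_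
    rw [map_smul, smul_eq_mul, mul_comm]
  have hDe0 : D e = 0 := by rw [hDe, gradL_inward, hNL, neg_zero]
  have hmaps : MapsTo (fun s : ℝ => x + s • e) (Ico 0 (primeNorm x)) (closure (funnel d h)) := by
    intro s hs
    rcases hs.1.eq_or_lt with h0 | h0
    · simpa [← h0] using hx
    · exact subset_closure (add_inward_mem hΩ hx h0 hs.2)
  have hl : HasDerivAt (fun s : ℝ => x + s • e) e 0 := by
    simpa using ((hasDerivAt_id (0 : ℝ)).smul_const e).const_add x
  have hk : HasDerivWithinAt (fun s : ℝ => g (x + s • e)) (D e) (Ico 0 (primeNorm x)) 0 := by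
    refine HasFDerivWithinAt.comp_hasDerivWithinAt (l := g) (t := closure (funnel d h))
      (f := fun s : ℝ => x + s • e) 0 ?_ hl.hasDerivWithinAt hmaps
    simpa using hg
  have hm : HasDerivAt (fun s : ℝ => ψ (x + s • e)) (gradL G e) 0 :=
    hasDerivAt_line e 0 (by simpa using hψ)
  have hkm := hk.sub hm.hasDerivWithinAt
  rw [hDe0, gradL_inward, zero_sub, neg_neg] at hkm
  have hkm' := (hasDerivWithinAt_iff_tendsto_slope' (by simp)).1
    (hkm.mono (Ioo_subset_Ico_self (a := (0 : ℝ)) (b := primeNorm x)))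
  rw [nhdsWithin_Ioo_eq_nhdsGT hp] at hkm'
  have hpos := hkm'.eventually (lt_mem_nhds hG)
  have ht : Tendsto (fun s : ℝ => x + s • e) (𝓝[>] 0) (𝓝[closure (funnel d h)] x) := by
    refine tendsto_nhdsWithin_iff.2 ⟨?_, ?_⟩
    · have := hl.continuousAt.tendsto
      simp only [zero_smul, add_zero] at this
      exact this.mono_left nhdsWithin_le_nhds
    · filter_upwards [Ioo_mem_nhdsGT hp] with s hs using hmaps ⟨hs.1.le, hs.2⟩
  have hmax' := ht.eventually hmax
  obtain ⟨s, ⟨h1, h2⟩, h3⟩ := ((hpos.and hmax').and self_mem_nhdsWithin).exists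
  have h3' : 0 < s := h3
  simp only [slope_def_field, Pi.sub_apply, zero_smul, add_zero, sub_zero] at h1
  have : (g (x + s • e) - ψ (x + s • e) - (g x - ψ x)) / s ≤ 0 :=
    div_nonpos_of_nonpos_of_nonneg (by linarith) h3'.le
  linarith
end

section
variable {d : ℕ} {h : ℝ → ℝ} {R α L : ℝ}

/-- First touching time, for functions that are merely right-continuous in time, jointly with the
space variable. -/
theorem exists_first_touch {X : Type*} [MetricSpace X] {C : Set X} (hC : IsCompact C)
    {w : ℝ → X → ℝ} {a b : ℝ} (h0 : ∀ x ∈ C, w a x < 0)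
    (hc : ∀ x ∈ C, Continuous fun t => w t x)
    (hr : ∀ t ∈ Icc a b, ∀ x ∈ C,
      ContinuousWithinAt (fun q : ℝ × X => w q.1 q.2) (Ici t ×ˢ C) (t, x)) :
    (∀ t ∈ Icc a b, ∀ x ∈ C, w t x < 0) ∨
      ∃ t ∈ Ioc a b, ∃ x ∈ C, w t x = 0 ∧ (∀ y ∈ C, w t y ≤ 0) ∧
        ∀ s ∈ Ico a t, ∀ y ∈ C, w s y < 0 := by
  by_contra! hcon
  obtain ⟨⟨t0, ht0, x0, hx0, hw0⟩, hcon⟩ := hcon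
  set B : Set ℝ := {t | t ∈ Icc a b ∧ ∃ x ∈ C, 0 ≤ w t x} with hB
  have hBne : B.Nonempty := ⟨t0, ht0, x0, hx0, hw0⟩
  have hBbdd : BddBelow B := ⟨a, fun t ht => ht.1.1⟩
  obtain ⟨τ, -, hτ, hτB⟩ := exists_seq_tendsto_sInf hBne hBbdd
  choose hτI ξ hξC hξ using hτB
  obtain ⟨x, hx, g, hg, hgx⟩ := hC.tendsto_subseq hξC
  set t := sInf B with ht
  have hat : a ≤ t := le_csInf hBne fun s hs => hs.1.1
  have htb : t ≤ b := (csInf_le hBbdd ⟨ht0, x0, hx0, hw0⟩).trans ht0.2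
  have hlim : Tendsto (fun n => ((τ (g n), ξ (g n)) : ℝ × X)) atTop (𝓝[Ici t ×ˢ C] (t, x)) := by
    refine tendsto_nhdsWithin_iff.2 ⟨(hτ.comp hg.tendsto_atTop).prodMk_nhds hgx, ?_⟩
    exact Eventually.of_forall fun n => ⟨csInf_le hBbdd ⟨hτI _, ξ _, hξC _, hξ _⟩, hξC _⟩
  have hge : 0 ≤ w t x :=
    ge_of_tendsto' ((hr t ⟨hat, htb⟩ x hx).tendsto.comp hlim) fun n => hξ (g n)
  have hat' : a < t := lt_of_le_of_ne hat fun he => by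
    have := h0 x hx; rw [he] at this; linarith
  have hbefore : ∀ s ∈ Ico a t, ∀ y ∈ C, w s y < 0 := by
    intro s hs y hy
    by_contra! hle
    have : t ≤ s := csInf_le hBbdd ⟨⟨hs.1, hs.2.le.trans htb⟩, y, hy, hle⟩
    linarith [hs.2]
  have hle : ∀ y ∈ C, w t y ≤ 0 := by
    intro y hy
    have h1 : Tendsto (fun s => w s y) (𝓝[<] t) (𝓝 (w t y)) :=
      ((hc y hy).tendsto t).mono_left nhdsWithin_le_nhds
    refine le_of_tendsto h1 ?_
    filter_upwards [Ioo_mem_nhdsLT hat'] with s hs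
    exact (hbefore s ⟨hs.1.le, hs.2⟩ y hy).le
  obtain ⟨s, hs, y, hy, hle'⟩ := hcon t ⟨hat', htb⟩ x hx (le_antisymm (hle x hx) hge) hle
  linarith [hbefore s hs y hy]

/-- Continuity of `v` from the right in time, jointly with the space variable, at `(t,x)`. -/
def RC (h : ℝ → ℝ) (v : ℝ → Euc d → ℝ) (t : ℝ) (x : Euc d) : Prop :=
  ContinuousWithinAt (fun q : ℝ × Euc d => v q.1 q.2) (Ici t ×ˢ closure (funnel d h)) (t, x)

/-- Comparison with a strict supersolution on a compact set. -/
theorem strict_comparison (hΩ : IsFunnel d R α L h) {f : ℝ → ℝ} {v W : ℝ → Euc d → ℝ}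
    (hv : Sol d h f v) {C : Set (Euc d)} (hC : IsCompact C) (hCΩ : C ⊆ closure (funnel d h))
    {a b : ℝ} (hRC : ∀ t ∈ Icc a b, ∀ x ∈ C, RC h v t x)
    (hW : Continuous fun q : ℝ × Euc d => W q.1 q.2)
    (h0 : ∀ x ∈ C, v a x < W a x)
    (hsup : ∀ t ∈ Ioc a b, ∀ x ∈ C, v t x = W t x → C ∈ 𝓝[closure (funnel d h)] x ∧
      ∃ G l wt, Jet (W t) x G l ∧ HasDerivAt (fun s => W s x) wt t ∧
        (x ∈ funnel d h → l + f (v t x) < wt) ∧ (x ∉ funnel d h → 0 < NL h x G)) :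
    ∀ t ∈ Icc a b, ∀ x ∈ C, v t x < W t x := by
  have hWt : ∀ x, Continuous fun t => W t x := fun x =>
    hW.comp (continuous_id.prodMk continuous_const)
  have key := exists_first_touch hC (w := fun t x => v t x - W t x) (a := a) (b := b)
    (fun x hx => by linarith [h0 x hx])
    (fun x hx => (hv.time_diff x (hCΩ hx)).continuous.sub (hWt x))
    (fun t ht x hx => ((hRC t ht x hx).mono (prod_mono_right hCΩ)).sub
      hW.continuousAt.continuousWithinAt)
  rcases key with key | ⟨t, ht, x, hx, he, hle, hlt⟩
  · intro t ht x hx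
    linarith [key t ht x hx]
  exfalso
  have he' : v t x = W t x := by linarith
  obtain ⟨hCn, G, l, wt, hJ, hwt, hin, hbd⟩ := hsup t ht x hx he'
  have hmax : ∀ᶠ y in 𝓝[closure (funnel d h)] x, v t y - W t y ≤ v t x - W t x := by
    filter_upwards [hCn] with y hy
    rw [he]; exact hle y hy
  by_cases hxΩ : x ∈ funnel d h
  · have hn := (eventually_closure_mem_nhds hΩ hxΩ).self_of_nhds
    rw [nhdsWithin_eq_nhds.2 hn] at hmax
    have h1 := lapW_le_of_isLocalMax hΩ (hv.space_reg t) hxΩ hJ hmax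
    have h2 := ((hv.time_diff x (hCΩ hx) t).hasDerivAt.sub hwt)
    have h3 : 0 ≤ deriv (fun s => v s x) t - wt := by
      have h4 := (hasDerivWithinAt_iff_tendsto_slope' (s := Iio t) (by simp)).1
        h2.hasDerivWithinAt
      refine ge_of_tendsto h4 ?_
      filter_upwards [Ioo_mem_nhdsLT ht.1] with s hs
      rw [slope_def_field]
      refine div_nonneg_of_nonpos ?_ (by linarith [hs.2])
      have := hlt s ⟨hs.1.le, hs.2⟩ x hx
      simp only [Pi.sub_apply]
      linarith
    have h5 := hin hxΩ
    have h6 := hv.pde t x hxΩ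
    linarith
  · obtain ⟨D, hD, hND⟩ := hv.neumann t x (mem_frontier_of_notMem hΩ (hCΩ hx) hxΩ)
    exact not_isMaxOn_of_NL_pos hΩ (hCΩ hx) hxΩ hD hND hJ.hasFDerivAt (hbd hxΩ) hmax
end

section
variable {d : ℕ} {h : ℝ → ℝ} {R α L : ℝ}

/-- A Gaussian-like kernel. -/
def ker (p M : ℝ) (D : Euc d → ℝ) (τ : ℝ) (x : Euc d) : ℝ :=
  Real.exp (-p * Real.log τ - D x / (M * τ))

theorem jet_ker {p M τ : ℝ} {D : Euc d → ℝ} {x : Euc d} {G : Fin (d + 1) → ℝ} {l : ℝ}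
    (hD : Jet D x G l) :
    Jet (ker p M D τ) x (fun i => ker p M D τ x * (-(1 / (M * τ)) * G i))
      (ker p M D τ x * (-(1 / (M * τ)) * l + (1 / (M * τ)) ^ 2 * ∑ i, G i ^ 2)) := by
  have h1 := (jet_const (-p * Real.log τ) x).add (hD.const_mul (-(1 / (M * τ))))
  have h2 := h1.comp (F := Real.exp) (F1 := Real.exp)
    (Eventually.of_forall fun s => Real.hasDerivAt_exp s) (Real.hasDerivAt_exp _)
  have e : ∀ y, Real.exp (-p * Real.log τ + -(1 / (M * τ)) * D y) = ker p M D τ y := by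
    intro y; unfold ker; congr 1; ring
  simp only [e] at h2
  refine h2.congr_data (fun i => by ring) ?_
  simp only [zero_add, mul_pow, ← Finset.mul_sum]; ring

theorem hasDerivAt_ker {p M τ : ℝ} {D : Euc d → ℝ} {x : Euc d} (hM : M ≠ 0) (hτ : 0 < τ) :
    HasDerivAt (fun s => ker p M D s x) (ker p M D τ x * (-p / τ + D x / (M * τ ^ 2))) τ := by
  have h1 : HasDerivAt (fun s => -p * Real.log s - D x / (M * s))
      (-p / τ + D x / (M * τ ^ 2)) τ := by
    have h2 := ((hasDerivAt_id τ).const_mul M).fun_inv (mul_ne_zero hM hτ.ne')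
    have h3 := ((Real.hasDerivAt_log hτ.ne').const_mul (-p)).sub (h2.const_mul (D x))
    refine (h3.congr_of_eventuallyEq (Eventually.of_forall fun s => ?_)).congr_deriv ?_
    · simp [div_eq_mul_inv]
    · simp only [id]; field_simp; ring
  exact h1.exp

theorem ker_subcaloric {p M τ : ℝ} {D : Euc d → ℝ} {x : Euc d} {G : Fin (d + 1) → ℝ} {l : ℝ}
    (hM : 0 < M) (hτ : 0 < τ) (hl : p * M ≤ l) (hG : ∑ i, G i ^ 2 ≤ M * D x) :
    ker p M D τ x * (-(1 / (M * τ)) * l + (1 / (M * τ)) ^ 2 * ∑ i, G i ^ 2)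
      ≤ ker p M D τ x * (-p / τ + D x / (M * τ ^ 2)) := by
  refine mul_le_mul_of_nonneg_left ?_ (Real.exp_pos _).le
  refine add_le_add ?_ ?_
  · rw [neg_mul, neg_div, neg_le_neg_iff, one_div, ← div_eq_inv_mul]
    rw [div_le_div_iff₀ hτ (by positivity)]
    nlinarith
  · calc (1 / (M * τ)) ^ 2 * ∑ i, G i ^ 2 ≤ (1 / (M * τ)) ^ 2 * (M * D x) := by gcongr
      _ = D x / (M * τ ^ 2) := by field_simp

/-- The regular part of the barrier used near a point `x₁`. -/
def bump (h : ℝ → ℝ) (ρ lam K : ℝ) (x1 x : Euc d) : ℝ :=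
  2 / ρ ^ 2 * ‖x - x1‖ ^ 2 + lam * Real.exp (-K * defect h x)

/-- The gradient of `bump`. -/
def bumpGrad (h : ℝ → ℝ) (ρ lam K : ℝ) (x1 x : Euc d) (i : Fin (d + 1)) : ℝ :=
  2 / ρ ^ 2 * (2 * (x i - x1 i))
    + lam * (Real.exp (-K * defect h x) * (-K * defectGrad h x i))

/-- The Laplacian of `bump`. -/
def bumpLap (h : ℝ → ℝ) (ρ lam K : ℝ) (x : Euc d) : ℝ :=
  2 / ρ ^ 2 * (2 * (d + 1)) + lam * (Real.exp (-K * defect h x) * (-K * defectLap h x)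
      + Real.exp (-K * defect h x) * ∑ i, (-K * defectGrad h x i) ^ 2)

theorem jet_bump (hΩ : IsFunnel d R α L h) (ρ lam K : ℝ) (x1 x : Euc d) :
    Jet (bump h ρ lam K x1) x (bumpGrad h ρ lam K x1 x) (bumpLap h ρ lam K x) := by
  have h1 := (jet_dist_sq x1 x).const_mul (2 / ρ ^ 2)
  have h2 := (((jet_defect hΩ x).const_mul (-K)).comp (F := Real.exp) (F1 := Real.exp)
    (Eventually.of_forall fun s => Real.hasDerivAt_exp s) (Real.hasDerivAt_exp _)).const_mul lam
  exact h1.add h2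

theorem continuous_bumpLap (hΩ : IsFunnel d R α L h) (ρ lam K : ℝ) :
    Continuous (bumpLap (d := d) h ρ lam K) := by
  have h1 := continuous_defect (d := d) hΩ
  have h2 := continuous_defectLap (d := d) hΩ
  have h3 := continuous_defectGrad (d := d) hΩ
  unfold bumpLap
  have h4 : Continuous fun x : Euc d => ∑ i, (-K * defectGrad h x i) ^ 2 :=
    continuous_finsetSum _ fun i _ => ((h3 i).const_mul (-K)).pow 2
  have h5 : Continuous fun x : Euc d => Real.exp (-K * defect h x) :=
    Real.continuous_exp.comp (h1.const_mul (-K))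
  exact continuous_const.add (((h5.mul (h2.const_mul (-K))).add (h5.mul h4)).const_mul lam)

theorem continuous_bump (hΩ : IsFunnel d R α L h) (ρ lam K : ℝ) (x1 : Euc d) :
    Continuous (bump h ρ lam K x1) := by
  have h1 := continuous_defect (d := d) hΩ
  unfold bump
  have h5 : Continuous fun x : Euc d => Real.exp (-K * defect h x) :=
    Real.continuous_exp.comp (h1.const_mul (-K))
  exact (((continuous_id.sub continuous_const).norm.pow 2).const_mul _).add (h5.const_mul lam)

theorem abs_coord_le (x : Euc d) (i : Fin (d + 1)) : |x i| ≤ ‖x‖ := by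
  rw [EuclideanSpace.norm_eq]
  refine Real.abs_le_sqrt ?_
  have h1 : ∀ j ∈ (Finset.univ : Finset (Fin (d + 1))), 0 ≤ ‖x j‖ ^ 2 := fun j _ => sq_nonneg _
  have := Finset.single_le_sum h1 (Finset.mem_univ i)
  simpa using this

theorem abs_coord_le_primeNorm (x : Euc d) {i : Fin (d + 1)} (hi : i ≠ 0) :
    |x i| ≤ primeNorm x := by
  refine Real.abs_le_sqrt ?_
  have := Finset.single_le_sum (f := fun i => if i = 0 then 0 else (x i) ^ 2)
    (fun i _ => by split_ifs <;> positivity) (Finset.mem_univ i)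
  simpa [hi] using this

theorem abs_NL_le (hΩ : IsFunnel d R α L h) (x : Euc d) {G : Fin (d + 1) → ℝ} {B : ℝ}
    (hG : ∀ i, |G i| ≤ B) : |NL h x G| ≤ (Real.tan α + (d + 1)) * B := by
  have hB : 0 ≤ B := (abs_nonneg _).trans (hG 0)
  have hd0 := hΩ.deriv_nonneg (x 0)
  have hd1 := hΩ.deriv_le (x 0)
  have h1 : |-(deriv h (x 0)) * G 0| ≤ Real.tan α * B := by
    rw [abs_mul, abs_neg, abs_of_nonneg hd0]
    exact mul_le_mul hd1 (hG 0) (abs_nonneg _) (hd0.trans hd1)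
  have h2 : |∑ i, if i = 0 then 0 else (x i / primeNorm x) * G i| ≤ (d + 1) * B := by
    refine (Finset.abs_sum_le_sum_abs _ _).trans ?_
    have : ∀ i ∈ (Finset.univ : Finset (Fin (d + 1))),
        |if i = 0 then 0 else (x i / primeNorm x) * G i| ≤ B := by
      intro i _
      by_cases hi : i = 0
      · simpa [hi] using hB
      · rw [if_neg hi, abs_mul, abs_div, abs_of_nonneg (primeNorm_nonneg x)]
        have : |x i| / primeNorm x ≤ 1 :=
          div_le_one_of_le₀ (abs_coord_le_primeNorm x hi) (primeNorm_nonneg x)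
        calc _ ≤ 1 * B := mul_le_mul this (hG i) (abs_nonneg _) zero_le_one
          _ = B := one_mul B
    simpa using Finset.sum_le_card_nsmul _ _ _ this
  calc |NL h x G| ≤ _ := abs_add_le _ _
    _ ≤ Real.tan α * B + (d + 1) * B := add_le_add h1 h2
    _ = _ := by ring

/-- For a suitable choice of the parameters, `bump` is a strict barrier near the boundary. -/
theorem exists_bump_params (hΩ : IsFunnel d R α L h) (x1 : Euc d) {ρ lam : ℝ} (hρ : 0 < ρ)
    (hlam : 0 < lam) (B : ℝ) :
    ∃ K C : ℝ, 0 < K ∧ 0 < C ∧ (∀ x ∈ Metric.closedBall x1 ρ, bumpLap h ρ lam K x + B < C) ∧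
      ∀ x ∈ Metric.closedBall x1 ρ, x ∈ closure (funnel d h) → x ∉ funnel d h →
        0 < NL h x (bumpGrad h ρ lam K x1 x) := by
  have ht : 0 ≤ Real.tan α := (hΩ.deriv_nonneg 0).trans (hΩ.deriv_le 0)
  have hR := hΩ.Rpos
  set A := (Real.tan α + (d + 1)) * (4 / ρ) with hA
  have hA0 : 0 < A := by positivity
  set K := A / (lam * R) with hK
  have hK0 : 0 < K := by positivity
  obtain ⟨C, hC⟩ := ((isCompact_closedBall x1 ρ).image (continuous_bumpLap hΩ ρ lam K)).bddAbove
  refine ⟨K, |C| + |B| + 1, hK0, by positivity, fun x hx => ?_, fun x hx hx1 hx2 => ?_⟩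
  · have := hC (mem_image_of_mem _ hx)
    linarith [le_abs_self C, le_abs_self B]
  · have e : NL h x (bumpGrad h ρ lam K x1 x)
        = NL h x (fun i => 2 / ρ ^ 2 * (2 * (x i - x1 i)))
          + lam * (Real.exp (-K * defect h x) * (-K * NL h x (defectGrad h x))) := by
      rw [← NL_mul, ← NL_mul, ← NL_mul, ← NL_add]; rfl
    rw [e, defect_eq_zero hΩ hx1 hx2, NL_defect hΩ hx1 hx2]
    have h1 : |NL h x (fun i => 2 / ρ ^ 2 * (2 * (x i - x1 i)))| ≤ A := by
      refine abs_NL_le hΩ x fun i => ?_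
      have h2 : |x i - x1 i| ≤ ρ := by
        have := abs_coord_le (x - x1) i
        rw [mem_closedBall_iff_norm] at hx
        exact this.trans hx
      rw [abs_mul, abs_of_nonneg (by positivity), abs_mul, abs_two]
      calc 2 / ρ ^ 2 * (2 * |x i - x1 i|) ≤ 2 / ρ ^ 2 * (2 * ρ) := by gcongr
        _ = 4 / ρ := by field_simp; norm_num
    have h3 := le_profile hΩ (x 0)
    have h4 : A * 2 ≤ lam * (K * 2 * h (x 0) * (1 + deriv h (x 0) ^ 2)) := by
      have : lam * (K * 2 * R * 1) = A * 2 := by rw [hK]; field_simp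
      rw [← this]
      have : 1 ≤ 1 + deriv h (x 0) ^ 2 := by nlinarith [sq_nonneg (deriv h (x 0))]
      have h5 : 0 < h (x 0) := profile_pos hΩ _
      gcongr
    simp only [mul_zero, Real.exp_zero, one_mul]
    have := (abs_le.1 h1).1
    nlinarith

theorem inter_mem_nhdsWithin_of_ball {S : Set (Euc d)} {x1 y : Euc d} {ρ : ℝ}
    (hy : ‖y - x1‖ < ρ) : Metric.closedBall x1 ρ ∩ S ∈ 𝓝[S] y := by
  refine inter_mem (mem_nhdsWithin_of_mem_nhds ?_) self_mem_nhdsWithin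
  exact Metric.closedBall_mem_nhds_of_mem (by rwa [mem_ball_iff_norm])

/-- Propagation of an upper bound from time `a` to time `t` in a small ball where `v` is
right-continuous after time `a`, given a small singular barrier. -/
theorem gap_bound (hΩ : IsFunnel d R α L h) {f : ℝ → ℝ} {v : ℝ → Euc d → ℝ}
    (hv : Sol d h f v) {B : ℝ} (hB : ∀ s ∈ Icc (0 : ℝ) 1, |f s| ≤ B) {x1 : Euc d} {ρ : ℝ}
    (hρ : 0 < ρ) {lam K C : ℝ} (hlam : 0 < lam) (hC : 0 < C)
    (hlap : ∀ x ∈ Metric.closedBall x1 ρ, bumpLap h ρ lam K x + B < C)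
    (hNL : ∀ x ∈ Metric.closedBall x1 ρ, x ∈ closure (funnel d h) → x ∉ funnel d h →
        0 < NL h x (bumpGrad h ρ lam K x1 x))
    {a t η : ℝ} (hη : 0 ≤ η)
    (hRC : ∀ s ∈ Ioc a t, ∀ y ∈ Metric.closedBall x1 ρ, y ∈ closure (funnel d h) → RC h v s y)
    (hZ : ∀ ε > 0, ∃ s ∈ Ioo a t, ∃ Z : ℝ → Euc d → ℝ, (Continuous fun q : ℝ × Euc d => Z q.1 q.2)
      ∧ (∀ τ x, 0 ≤ Z τ x) ∧
      (∀ x ∈ Metric.closedBall x1 ρ, x ∈ closure (funnel d h) → v s x ≤ η + ε + Z s x) ∧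
      (∀ x ∈ Metric.closedBall x1 ρ, x ∈ closure (funnel d h) → Z t x ≤ ε) ∧
      ∀ τ ∈ Ioc s t, ∀ x ∈ Metric.closedBall x1 ρ, x ∈ closure (funnel d h) →
        ∃ G l wt, Jet (Z τ) x G l ∧ HasDerivAt (fun s => Z s x) wt τ ∧ l ≤ wt ∧
          (x ∉ funnel d h → 0 ≤ NL h x G))
    {x : Euc d} (hx : x ∈ Metric.closedBall x1 ρ) (hxΩ : x ∈ closure (funnel d h)) :
    v t x ≤ η + bump h ρ lam K x1 x + C * (t - a) := by
  refine le_of_forall_pos_le_add fun ε hε => ?_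
  obtain ⟨s, hs, Z, hZc, hZ0, hZs, hZt, hZj⟩ := hZ (ε / 3) (by linarith)
  have hlt : ∀ τ ∈ Icc s t, ∀ y ∈ Metric.closedBall x1 ρ ∩ closure (funnel d h),
      v τ y < (η + 2 * (ε / 3) + C * (τ - s)) + bump h ρ lam K x1 y + Z τ y := by
    refine strict_comparison hΩ hv (W := fun τ y =>
      (η + 2 * (ε / 3) + C * (τ - s)) + bump h ρ lam K x1 y + Z τ y)
      ((isCompact_closedBall x1 ρ).inter_right isClosed_closure) inter_subset_right
      (fun τ hτ y hy => hRC τ ⟨hs.1.trans_le hτ.1, hτ.2⟩ y hy.1 hy.2) ?_ ?_ ?_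
    · have h1 := (continuous_bump hΩ ρ lam K x1).comp (continuous_snd (X := ℝ))
      have h2 : Continuous fun q : ℝ × Euc d => η + 2 * (ε / 3) + C * (q.1 - s) := by fun_prop
      exact (h2.add h1).add hZc
    · intro y hy
      have h1 := hZs y hy.1 hy.2
      have h2 : 0 ≤ bump h ρ lam K x1 y := by unfold bump; positivity
      have h3 : C * (s - s) = 0 := by ring
      linarith
    · intro τ hτ y hy he
      have h1 : 0 ≤ C * (τ - s) := mul_nonneg hC.le (by linarith [hτ.1])
      have hlt : ‖y - x1‖ < ρ := by
        refine lt_of_le_of_ne (mem_closedBall_iff_norm.1 hy.1) fun heq => ?_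
        have h2 : 2 ≤ bump h ρ lam K x1 y := by
          unfold bump; rw [heq, div_mul_cancel₀ _ (by positivity)]
          have : 0 ≤ lam * Real.exp (-K * defect h y) := by positivity
          linarith
        have h3 := (hv.range01 τ y hy.2).2
        have h4 := hZ0 τ y
        linarith
      refine ⟨inter_mem_nhdsWithin_of_ball hlt, ?_⟩
      obtain ⟨G, l, wt, hJ, hwt, hle, hN⟩ := hZj τ hτ y hy.1 hy.2
      refine ⟨_, _, C + wt, ((jet_const _ y).add (jet_bump hΩ ρ lam K x1 y)).add hJ, ?_, ?_, ?_⟩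
      · have h5 : HasDerivAt (fun τ => (η + 2 * (ε / 3) + C * (τ - s)) + bump h ρ lam K x1 y)
            C τ := by
          have := (((hasDerivAt_id τ).sub_const s).const_mul C).const_add (η + 2 * (ε / 3))
          simpa using this.add_const (bump h ρ lam K x1 y)
        exact h5.add hwt
      · intro _
        have h6 := hlap y hy.1
        have h7 := (abs_le.1 (hB _ (hv.range01 τ y hy.2))).2
        linarith
      · intro hyΩ
        have h6 := hNL y hy.1 hy.2 hyΩ
        have h7 := hN hyΩ
        rw [NL_add, NL_add, NL_zero]; linarith
  have h1 := hlt t ⟨hs.2.le, le_rfl⟩ x ⟨hx, hxΩ⟩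
  have h2 := hZt x hx hxΩ
  have h3 : C * (t - s) ≤ C * (t - a) := mul_le_mul_of_nonneg_left (by linarith [hs.1]) hC.le
  linarith
end

section
variable {d : ℕ} {h : ℝ → ℝ} {R α L : ℝ}

theorem continuous_shifted_ker {p M q s : ℝ} {D : Euc d → ℝ} (hD : Continuous D) (hM : 0 < M)
    (hq : 0 < q) :
    Continuous fun z : ℝ × Euc d => ker p M D (max (z.1 - s) 0 + q) z.2 := by
  have h1 : Continuous fun z : ℝ × Euc d => max (z.1 - s) 0 + q := by fun_prop
  have h2 : ∀ z : ℝ × Euc d, 0 < max (z.1 - s) 0 + q := fun z => by positivity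
  unfold ker
  refine Real.continuous_exp.comp ((continuous_const.mul (h1.log fun z => (h2 z).ne')).sub
    ((hD.comp continuous_snd).div (continuous_const.mul h1) fun z => ?_))
  exact (mul_pos hM (h2 z)).ne'

theorem hasDerivAt_shifted_ker {p M q s τ : ℝ} {D : Euc d → ℝ} {x : Euc d} (hM : 0 < M)
    (hq : 0 < q) (hτ : s < τ) :
    HasDerivAt (fun r => ker p M D (max (r - s) 0 + q) x)
      (ker p M D (max (τ - s) 0 + q) x *
        (-p / (max (τ - s) 0 + q) + D x / (M * (max (τ - s) 0 + q) ^ 2))) τ := by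
  have h1 : HasDerivAt (fun r => max (r - s) 0 + q) 1 τ := by
    refine (((hasDerivAt_id τ).sub_const s).add_const q).congr_of_eventuallyEq ?_
    filter_upwards [Ioi_mem_nhds hτ] with r hr
    have : 0 ≤ r - s := by have : s < r := hr; linarith
    simp [max_eq_left this]
  have h2 := (hasDerivAt_ker (p := p) (M := M) (τ := max (τ - s) 0 + q) (D := D) (x := x) hM.ne'
    (by positivity)).comp τ h1
  exact h2.congr_deriv (mul_one _)

theorem exists_isolated_cover {A U : Set (Euc d)} (hA : IsCompact A) (hU : IsOpen U)
    (hAU : A ⊆ U) : ∃ r > 0, ∃ F : Finset (Euc d),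
      (∀ x ∈ A, ∃ y ∈ F, ‖x - y‖ ^ 2 ≤ 25 * r ^ 2) ∧
      ((F.card : ENNReal) * volume (Metric.ball (0 : Euc d) 1)) * ENNReal.ofReal (r ^ (d + 1))
        ≤ volume U := by
  obtain ⟨δ, hδ, hδU⟩ := hA.exists_cthickening_subset_open hU hAU
  refine ⟨δ, hδ, ?_⟩
  obtain ⟨t, htA, htf, htc⟩ := hA.finite_cover_balls hδ
  obtain ⟨u, hut, hdis, hcov⟩ := Vitali.exists_disjoint_subfamily_covering_enlargement_closedBall
    t (fun y : Euc d => y) (fun _ => δ) δ (fun _ _ => le_rfl) 5 (by norm_num)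
  have huf : u.Finite := htf.subset hut
  refine ⟨huf.toFinset, fun x hx => ?_, ?_⟩
  · obtain ⟨y, hy, hxy⟩ := mem_iUnion₂.1 (htc hx)
    obtain ⟨b, hb, hyb⟩ := hcov y hy
    refine ⟨b, by simpa using hb, ?_⟩
    have h1 : x ∈ Metric.closedBall b (5 * δ) := hyb (Metric.ball_subset_closedBall hxy)
    rw [mem_closedBall_iff_norm] at h1
    nlinarith [norm_nonneg (x - b)]
  · have h1 : ∀ y ∈ huf.toFinset, volume (Metric.ball y δ)
        = volume (Metric.ball (0 : Euc d) 1) * ENNReal.ofReal (δ ^ (d + 1)) := by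
      intro y _
      rw [Measure.addHaar_ball_of_pos volume y hδ, mul_comm]; simp
    have h2 : volume (⋃ y ∈ huf.toFinset, Metric.ball y δ)
        = ∑ y ∈ huf.toFinset, volume (Metric.ball y δ) := by
      refine measure_biUnion_finset ?_ fun y _ => Metric.isOpen_ball.measurableSet
      intro y hy z hz hyz
      exact (hdis (by simpa using hy) (by simpa using hz) hyz).mono
        Metric.ball_subset_closedBall Metric.ball_subset_closedBall
    rw [mul_assoc, ← nsmul_eq_mul, ← Finset.sum_const, ← Finset.sum_congr rfl h1, ← h2]
    refine measure_mono (iUnion₂_subset fun y hy => ?_)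
    have hyA : y ∈ A := htA (hut (by simpa using hy))
    exact (Metric.ball_subset_closedBall.trans (Metric.closedBall_subset_cthickening hyA δ)).trans
      hδU

/-- A small singular barrier in a ball contained in the domain. -/
theorem exists_barrier_interior {f : ℝ → ℝ} {v : ℝ → Euc d → ℝ}
    (hv : Sol d h f v) {x1 : Euc d} {ρ : ℝ} (hρ : 0 < ρ)
    (hball : Metric.closedBall x1 (2 * ρ) ⊆ funnel d h) {a t η : ℝ} (hat : a < t) (hη : 0 ≤ η)
    (hva : ∀ y ∈ Metric.closedBall x1 (2 * ρ), v a y ≤ η) {ε : ℝ} (hε : 0 < ε) :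
    ∃ s ∈ Ioo a t, ∃ Z : ℝ → Euc d → ℝ, (Continuous fun q : ℝ × Euc d => Z q.1 q.2)
      ∧ (∀ τ x, 0 ≤ Z τ x) ∧
      (∀ x ∈ Metric.closedBall x1 ρ, x ∈ closure (funnel d h) → v s x ≤ η + ε + Z s x) ∧
      (∀ x ∈ Metric.closedBall x1 ρ, x ∈ closure (funnel d h) → Z t x ≤ ε) ∧
      ∀ τ ∈ Ioc s t, ∀ x ∈ Metric.closedBall x1 ρ, x ∈ closure (funnel d h) →
        ∃ G l wt, Jet (Z τ) x G l ∧ HasDerivAt (fun s => Z s x) wt τ ∧ l ≤ wt ∧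
          (x ∉ funnel d h → 0 ≤ NL h x G) := by
  set N : ℝ := (d + 1 : ℝ) / 2 with hN
  set ω : ℝ := (volume (Metric.ball (0 : Euc d) 1)).toReal with hω
  have hωfin : volume (Metric.ball (0 : Euc d) 1) ≠ ⊤ := measure_ball_lt_top.ne
  have hω0 : 0 < ω := ENNReal.toReal_pos (Metric.measure_ball_pos volume _ one_pos).ne' hωfin
  set κ : ℝ := ε * ω / (Real.exp (25 / 4) * Real.exp (-N * Real.log ((t - a) / 2))) with hκ
  have hκ0 : 0 < κ := by positivity
  set b2 := Metric.ball x1 (2 * ρ) with hb2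
  have hb2s : b2 ⊆ funnel d h := Metric.ball_subset_closedBall.trans hball
  have hcont : ∀ s, ContinuousOn (v s) b2 := fun s =>
    (hv.space_reg s).continuousOn.mono (hb2s.trans subset_closure)
  -- a time slightly after `a` at which the exceptional set has small measure
  obtain ⟨s, hs, hsmall⟩ : ∃ s ∈ Ioo a ((a + t) / 2),
      volume {x | x ∈ b2 ∧ η + ε / 2 < v s x} ≤ ENNReal.ofReal κ := by
    have : IsFiniteMeasure (volume.restrict b2) := ⟨by
      rw [Measure.restrict_apply_univ]; exact measure_ball_lt_top⟩
    set σ : ℕ → ℝ := fun n => a + (t - a) / 2 / (n + 2) with hσ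
    have hσlim : Tendsto σ atTop (𝓝 a) := by
      have h1 : Tendsto (fun n : ℕ => (t - a) / 2 / ((n : ℝ) + 2)) atTop (𝓝 0) :=
        tendsto_const_nhds.div_atTop
          (tendsto_atTop_add_const_right _ _ tendsto_natCast_atTop_atTop)
      simpa [hσ] using h1.const_add a
    have hmeas : ∀ n, AEStronglyMeasurable (v (σ n)) (volume.restrict b2) := fun n =>
      (hcont _).aestronglyMeasurable Metric.isOpen_ball.measurableSet
    have hlim := tendstoInMeasure_of_tendsto_ae (μ := volume.restrict b2) (g := v a) hmeas (by
      refine (ae_restrict_iff' Metric.isOpen_ball.measurableSet).2 (Eventually.of_forall ?_)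
      intro x hx
      exact ((hv.time_diff x (subset_closure (hb2s hx))).continuous.tendsto a).comp hσlim)
    have h2 := tendstoInMeasure_iff_dist.1 hlim (ε / 2) (by linarith)
    have h3 := h2.eventually (gt_mem_nhds (ENNReal.ofReal_pos.2 hκ0))
    obtain ⟨n, hn⟩ := h3.exists
    refine ⟨σ n, ⟨?_, ?_⟩, le_trans ?_ hn.le⟩
    · have : 0 < (t - a) / 2 / ((n : ℝ) + 2) := by
        have : 0 < t - a := by linarith
        positivity
      simp only [hσ]; linarith
    · have : (t - a) / 2 / ((n : ℝ) + 2) < (t - a) / 2 :=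
        div_lt_self (by linarith) (by have : (0 : ℝ) ≤ n := n.cast_nonneg; linarith)
      simp only [hσ]; linarith
    · rw [Measure.restrict_apply']
      · refine measure_mono fun x hx => ⟨?_, hx.1⟩
        have h4 := hva x (Metric.ball_subset_closedBall hx.1)
        have h5 := hx.2
        change ε / 2 ≤ dist (v (σ n) x) (v a x)
        rw [Real.dist_eq]
        exact le_trans (by linarith) (le_abs_self _)
      · exact Metric.isOpen_ball.measurableSet
  set U : Set (Euc d) := {x | x ∈ b2 ∧ η + ε / 2 < v s x} with hU
  have hUo : IsOpen U := (hcont s).isOpen_inter_preimage Metric.isOpen_ball isOpen_Ioi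
  have hB1 : Metric.closedBall x1 ρ ⊆ b2 := Metric.closedBall_subset_ball (by linarith)
  set A : Set (Euc d) := Metric.closedBall x1 ρ ∩ v s ⁻¹' Ici (η + ε) with hA
  have hAc : IsCompact A := by
    refine (isCompact_closedBall x1 ρ).of_isClosed_subset ?_ inter_subset_left
    exact ((hcont s).mono hB1).preimage_isClosed_of_isClosed Metric.isClosed_closedBall isClosed_Ici
  obtain ⟨r, hr, F, hcov, hcard⟩ := exists_isolated_cover hAc hUo (fun x hx => ⟨hB1 hx.1, by
    have : η + ε ≤ v s x := hx.2
    linarith⟩)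
  have hcard' : (F.card : ℝ) * ω * r ^ (d + 1) ≤ κ := by
    have h1 := ENNReal.toReal_mono ENNReal.ofReal_ne_top (hcard.trans hsmall)
    rw [ENNReal.toReal_mul, ENNReal.toReal_mul, ENNReal.toReal_ofReal hκ0.le,
      ENNReal.toReal_ofReal (by positivity)] at h1
    simpa using h1
  have hrp : Real.exp (N * Real.log (r ^ 2)) = r ^ (d + 1) := by
    rw [Real.log_pow, hN]
    rw [show ((d : ℝ) + 1) / 2 * ((2 : ℕ) * Real.log r) = ((d + 1 : ℕ) : ℝ) * Real.log r by
      push_cast; ring, Real.exp_nat_mul, Real.exp_log hr]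
  set D : Euc d → Euc d → ℝ := fun y x => ‖x - y‖ ^ 2 with hD
  have hDc : ∀ y, Continuous (D y) := fun y => (continuous_id.sub continuous_const).norm.pow 2
  set Q : ℝ := Real.exp (25 / 4) * r ^ (d + 1) with hQ
  have hQ0 : 0 < Q := by positivity
  have hr2 : 0 < r ^ 2 := by positivity
  refine ⟨s, ⟨hs.1, by linarith [hs.2]⟩,
    fun τ x => Q * ∑ y ∈ F, ker N 4 (D y) (max (τ - s) 0 + r ^ 2) x, ?_, ?_, ?_, ?_, ?_⟩
  · refine continuous_const.mul (continuous_finsetSum _ fun y _ => ?_)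
    exact continuous_shifted_ker (hDc y) (by norm_num) hr2
  · intro τ x
    exact mul_nonneg hQ0.le (Finset.sum_nonneg fun y _ => (Real.exp_pos _).le)
  · intro x hx hxΩ
    by_cases hxA : x ∈ A
    · obtain ⟨y, hy, hxy⟩ := hcov x hxA
      have h1 : ker N 4 (D y) (max (s - s) 0 + r ^ 2) x
          ≤ ∑ y ∈ F, ker N 4 (D y) (max (s - s) 0 + r ^ 2) x :=
        Finset.single_le_sum (f := fun y => ker N 4 (D y) (max (s - s) 0 + r ^ 2) x)
          (fun y _ => (Real.exp_pos _).le) hy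
      have h2 : 1 ≤ Q * ker N 4 (D y) (max (s - s) 0 + r ^ 2) x := by
        rw [hQ, ← hrp, ker, ← Real.exp_add, ← Real.exp_add]
        refine Real.one_le_exp ?_
        simp only [sub_self, max_self, zero_add]
        have : D y x / (4 * r ^ 2) ≤ 25 / 4 := by
          rw [div_le_iff₀ (by positivity)]
          calc D y x ≤ 25 * r ^ 2 := hxy
            _ = 25 / 4 * (4 * r ^ 2) := by ring
        linarith
      have h3 := (hv.range01 s x hxΩ).2
      have h4 := mul_le_mul_of_nonneg_left h1 hQ0.le
      linarith
    · have h1 : v s x < η + ε := by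
        by_contra! hle
        exact hxA ⟨hx, hle⟩
      have h2 : 0 ≤ Q * ∑ y ∈ F, ker N 4 (D y) (max (s - s) 0 + r ^ 2) x :=
        mul_nonneg hQ0.le (Finset.sum_nonneg fun y _ => (Real.exp_pos _).le)
      linarith
  · intro x hx hxΩ
    have hN0 : 0 ≤ N := by positivity
    have h1 : ∀ y ∈ F, ker N 4 (D y) (max (t - s) 0 + r ^ 2) x
        ≤ Real.exp (-N * Real.log ((t - a) / 2)) := by
      intro y _
      refine Real.exp_le_exp.2 ?_
      have h2 : (t - a) / 2 ≤ max (t - s) 0 + r ^ 2 :=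
        le_trans (by linarith [hs.2]) (le_trans (le_max_left (t - s) 0) (by linarith))
      have h3 := Real.log_le_log (by linarith) h2
      have h4 : 0 ≤ D y x / (4 * (max (t - s) 0 + r ^ 2)) := by positivity
      have := mul_le_mul_of_nonneg_left h3 hN0
      linarith
    have h2 := Finset.sum_le_card_nsmul _ _ _ h1
    rw [nsmul_eq_mul] at h2
    calc Q * ∑ y ∈ F, ker N 4 (D y) (max (t - s) 0 + r ^ 2) x
        ≤ Q * (F.card * Real.exp (-N * Real.log ((t - a) / 2))) := by gcongr
      _ = (F.card * ω * r ^ (d + 1)) *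
          (Real.exp (25 / 4) * Real.exp (-N * Real.log ((t - a) / 2)) / ω) := by
        rw [hQ]; field_simp
      _ ≤ κ * (Real.exp (25 / 4) * Real.exp (-N * Real.log ((t - a) / 2)) / ω) := by gcongr
      _ = ε := by rw [hκ]; field_simp
  · intro τ hτ x hx hxΩ
    have hJ := (jet_sum F fun y _ => jet_ker (p := N) (M := 4) (τ := max (τ - s) 0 + r ^ 2)
      (jet_dist_sq y x)).const_mul Q
    refine ⟨_, _, _, hJ, (HasDerivAt.fun_sum fun y _ => hasDerivAt_shifted_ker (p := N) (M := 4)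
      (D := D y) (x := x) (by norm_num) hr2 hτ.1).const_mul Q, ?_,
      fun hx' => absurd (hball (Metric.closedBall_subset_closedBall (by linarith) hx)) hx'⟩
    refine mul_le_mul_of_nonneg_left (Finset.sum_le_sum fun y _ => ?_) hQ0.le
    refine ker_subcaloric (by norm_num) (by positivity) (by rw [hN]; linarith) ?_
    rw [EuclideanSpace.norm_sq_eq, Finset.mul_sum]
    refine Finset.sum_le_sum fun i _ => ?_
    simp; ring_nf; rfl

/-- A small singular barrier in a ball centred at a boundary point. -/
theorem exists_barrier_boundary (hΩ : IsFunnel d R α L h) {f : ℝ → ℝ} {v : ℝ → Euc d → ℝ}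
    (hv : Sol d h f v) {x1 : Euc d} {ρ M p : ℝ} (hM : 0 < M) (hp : 0 < p)
    (hlap : ∀ x ∈ Metric.closedBall x1 ρ,
      p * M ≤ 2 * defect h x * defectLap h x + 2 * ∑ i, defectGrad h x i ^ 2)
    (hgrad : ∀ x ∈ Metric.closedBall x1 ρ, 4 * ∑ i, defectGrad h x i ^ 2 ≤ M)
    {a t η : ℝ} (hat : a < t) (hη : 0 ≤ η)
    (hva : ∀ y ∈ Metric.closedBall x1 ρ, y ∈ closure (funnel d h) → v a y ≤ η)
    (hRC : ∀ y ∈ Metric.closedBall x1 ρ, y ∈ funnel d h → RC h v a y) {ε : ℝ} (hε : 0 < ε) :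
    ∃ s ∈ Ioo a t, ∃ Z : ℝ → Euc d → ℝ, (Continuous fun q : ℝ × Euc d => Z q.1 q.2)
      ∧ (∀ τ x, 0 ≤ Z τ x) ∧
      (∀ x ∈ Metric.closedBall x1 ρ, x ∈ closure (funnel d h) → v s x ≤ η + ε + Z s x) ∧
      (∀ x ∈ Metric.closedBall x1 ρ, x ∈ closure (funnel d h) → Z t x ≤ ε) ∧
      ∀ τ ∈ Ioc s t, ∀ x ∈ Metric.closedBall x1 ρ, x ∈ closure (funnel d h) →
        ∃ G l wt, Jet (Z τ) x G l ∧ HasDerivAt (fun s => Z s x) wt τ ∧ l ≤ wt ∧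
          (x ∉ funnel d h → 0 ≤ NL h x G) := by
  set T := Real.log ((t - a) / 2) with hT
  -- the squared width `q` of the exceptional layer
  obtain ⟨q, hq, hqε⟩ : ∃ q > 0, Real.exp (1 / M) * Real.exp (p * Real.log q - p * T) ≤ ε := by
    refine ⟨Real.exp ((Real.log ε - 1 / M) / p + T), Real.exp_pos _, ?_⟩
    rw [Real.log_exp, ← Real.exp_add]
    have : 1 / M + (p * ((Real.log ε - 1 / M) / p + T) - p * T) = Real.log ε := by
      field_simp; ring
    rw [this, Real.exp_log hε]
  set D : Euc d → ℝ := fun x => defect h x * defect h x with hD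
  have hDc : Continuous D := (continuous_defect hΩ).mul (continuous_defect hΩ)
  set K : Set (Euc d) := (Metric.closedBall x1 ρ ∩ closure (funnel d h)) ∩ {x | q ≤ D x} with hK
  have hKc : IsCompact K :=
    ((isCompact_closedBall x1 ρ).inter_right isClosed_closure).inter_right
      (isClosed_le continuous_const hDc)
  have hev : ∀ᶠ s in 𝓝 a, ∀ y ∈ K, a ≤ s → v s y ≤ η + ε := by
    have h1 : ∀ᶠ s in 𝓝 a, ∀ y ∈ K, a ≤ s → y ∈ closure (funnel d h) → v s y ≤ η + ε := by
      refine hKc.eventually_forall_of_forall_eventually fun y hy => ?_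
      have hyΩ : y ∈ funnel d h := by
        by_contra hn
        have h2 : q ≤ D y := hy.2
        rw [hD] at h2
        simp only [defect_eq_zero hΩ hy.1.2 hn, mul_zero] at h2
        linarith
      have h3 : v a y < η + ε := by linarith [hva y hy.1.1 hy.1.2]
      have h4 := (hRC y hy.1.1 hyΩ).tendsto.eventually (gt_mem_nhds h3)
      rw [eventually_nhdsWithin_iff] at h4
      filter_upwards [h4] with z hz h5 h6
      exact (hz ⟨h5, h6⟩).le
    filter_upwards [h1] with s hs y hy h2 using hs y hy h2 hy.1.2
  obtain ⟨s, hs1, hs⟩ := (((hev.filter_mono nhdsWithin_le_nhds).and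
    (Ioo_mem_nhdsGT (show a < (a + t) / 2 by linarith))).exists)
  set Q : ℝ := Real.exp (1 / M) * Real.exp (p * Real.log q) with hQ
  have hQ0 : 0 < Q := by positivity
  refine ⟨s, ⟨hs.1, by linarith [hs.2]⟩,
    fun τ x => Q * ker p M D (max (τ - s) 0 + q) x, ?_, ?_, ?_, ?_, ?_⟩
  · exact continuous_const.mul (continuous_shifted_ker hDc hM hq)
  · intro τ x
    exact mul_nonneg hQ0.le (Real.exp_pos _).le
  · intro x hx hxΩ
    by_cases hxK : x ∈ K
    · have h1 := hs1 x hxK hs.1.le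
      have h2 : 0 ≤ Q * ker p M D (max (s - s) 0 + q) x := mul_nonneg hQ0.le (Real.exp_pos _).le
      linarith
    · have h0 : D x < q := by
        by_contra! hle
        exact hxK ⟨⟨hx, hxΩ⟩, hle⟩
      have h2 : 1 ≤ Q * ker p M D (max (s - s) 0 + q) x := by
        rw [hQ, ker, ← Real.exp_add, ← Real.exp_add]
        refine Real.one_le_exp ?_
        simp only [sub_self, max_self, zero_add]
        have : D x / (M * q) ≤ 1 / M := by
          rw [div_le_div_iff₀ (by positivity) hM]; nlinarith
        linarith
      have h3 := (hv.range01 s x hxΩ).2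
      linarith
  · intro x hx hxΩ
    refine le_trans ?_ hqε
    change Q * ker p M D (max (t - s) 0 + q) x ≤ _
    rw [hQ, mul_assoc]
    refine mul_le_mul_of_nonneg_left ?_ (Real.exp_pos _).le
    rw [ker, ← Real.exp_add]
    refine Real.exp_le_exp.2 ?_
    have h2 : (t - a) / 2 ≤ max (t - s) 0 + q :=
      le_trans (by linarith [hs.2]) (le_trans (le_max_left (t - s) 0) (by linarith))
    have h3 := Real.log_le_log (by linarith) h2
    have h4 : 0 ≤ D x / (M * (max (t - s) 0 + q)) :=
      div_nonneg (mul_self_nonneg _) (by positivity)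
    have := mul_le_mul_of_nonneg_left h3 hp.le
    linarith
  · intro τ hτ x hx hxΩ
    have hJD := (jet_defect hΩ x).mul (jet_defect hΩ x)
    refine ⟨_, _, _, (jet_ker (p := p) (M := M) (τ := max (τ - s) 0 + q) hJD).const_mul Q,
      (hasDerivAt_shifted_ker (p := p) (M := M) (D := D) (x := x) hM hq hτ.1).const_mul Q,
      ?_, ?_⟩
    · refine mul_le_mul_of_nonneg_left ?_ hQ0.le
      refine ker_subcaloric hM (by positivity) ?_ ?_
      · refine (hlap x hx).trans (le_of_eq ?_)
        simp only [← sq]; ring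
      · have h1 : ∀ i, (defect h x * defectGrad h x i + defect h x * defectGrad h x i) ^ 2
            = 4 * D x * defectGrad h x i ^ 2 := by intro i; rw [hD]; ring
        simp only [h1, ← Finset.mul_sum]
        have h2 : 0 ≤ D x := mul_self_nonneg _
        nlinarith [hgrad x hx]
    · intro hx'
      rw [NL_mul, NL_mul, NL_mul]
      have h0 := defect_eq_zero hΩ hxΩ hx'
      have : NL h x (fun i => defect h x * defectGrad h x i + defect h x * defectGrad h x i)
          = 0 := by
        rw [NL_add, NL_mul, h0]; ring
      rw [this]; simp
end

section
variable {d : ℕ} {h : ℝ → ℝ} {R α L : ℝ}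

/-- A global Lipschitz estimate centred at the point `q`, separately in time and in space. -/
def LipAt (h : ℝ → ℝ) (v : ℝ → Euc d → ℝ) (n : ℝ) (q : ℝ × Euc d) : Prop :=
  (∀ s, |v s q.2 - v q.1 q.2| ≤ n * |s - q.1|) ∧
    ∀ y ∈ closure (funnel d h), |v q.1 y - v q.1 q.2| ≤ n * ‖y - q.2‖

theorem exists_lip_of_hasFDerivWithinAt {E : Type*} [NormedAddCommGroup E] [NormedSpace ℝ E]
    {g : E → ℝ} {S : Set E} {x : E} {D : E →L[ℝ] ℝ} (hD : HasFDerivWithinAt g D S x)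
    (hb : ∀ y ∈ S, |g y - g x| ≤ 1) : ∃ n : ℝ, ∀ y ∈ S, |g y - g x| ≤ n * ‖y - x‖ := by
  obtain ⟨C, hC⟩ := hD.isBigO_sub.bound
  rw [eventually_nhdsWithin_iff, Metric.eventually_nhds_iff] at hC
  obtain ⟨δ, hδ, hC⟩ := hC
  refine ⟨max C (1 / δ), fun y hy => ?_⟩
  have hn := norm_nonneg (y - x)
  by_cases hyx : dist y x < δ
  · exact (hC hyx hy).trans (mul_le_mul_of_nonneg_right (le_max_left _ _) hn)
  · refine (hb y hy).trans (le_trans ?_ (mul_le_mul_of_nonneg_right (le_max_right _ _) hn))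
    rw [dist_eq_norm, not_lt] at hyx
    rw [div_mul_eq_mul_div, one_mul, le_div_iff₀ hδ]; linarith

theorem Sol.exists_lipAt {f : ℝ → ℝ} {v : ℝ → Euc d → ℝ} (hv : Sol d h f v) (q : ℝ × Euc d)
    (hq : q.2 ∈ closure (funnel d h)) : ∃ n : ℕ, LipAt h v n q := by
  have hb : ∀ t s, ∀ x ∈ closure (funnel d h), ∀ y ∈ closure (funnel d h),
      |v t x - v s y| ≤ 1 := by
    intro t s x hx y hy
    obtain ⟨h1, h2⟩ := hv.range01 t x hx
    obtain ⟨h3, h4⟩ := hv.range01 s y hy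
    rw [abs_le]; constructor <;> linarith
  obtain ⟨n1, hn1⟩ := exists_lip_of_hasFDerivWithinAt (S := univ)
    (hv.time_diff q.2 hq q.1).hasFDerivAt.hasFDerivWithinAt (fun s _ => hb s q.1 _ hq _ hq)
  obtain ⟨n2, hn2⟩ := exists_lip_of_hasFDerivWithinAt
    ((hv.space_reg q.1).differentiableOn (by norm_num) q.2 hq).hasFDerivWithinAt
    (fun y hy => hb q.1 q.1 _ hy _ hq)
  obtain ⟨n, hn⟩ := exists_nat_ge (max n1 n2)
  refine ⟨n, fun s => (hn1 s trivial).trans ?_, fun y hy => (hn2 y hy).trans ?_⟩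
  · rw [Real.norm_eq_abs]
    exact mul_le_mul_of_nonneg_right ((le_max_left _ _).trans hn) (abs_nonneg _)
  · exact mul_le_mul_of_nonneg_right ((le_max_right _ _).trans hn) (norm_nonneg _)

theorem Sol.isClosed_lipAt {f : ℝ → ℝ} {v : ℝ → Euc d → ℝ} (hv : Sol d h f v) (n : ℝ) :
    IsClosed {q : ℝ × Euc d | q.2 ∈ closure (funnel d h) ∧ LipAt h v n q} := by
  set A := {q : ℝ × Euc d | q.2 ∈ closure (funnel d h) ∧ LipAt h v n q} with hA
  refine isClosed_of_closure_subset fun q hq => ?_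
  have hne : (𝓝[A] q).NeBot := mem_closure_iff_nhdsWithin_neBot.1 hq
  have hmem : ∀ᶠ p in 𝓝[A] q, p.2 ∈ closure (funnel d h) ∧ LipAt h v n p := self_mem_nhdsWithin
  have hl1 : Tendsto (fun p : ℝ × Euc d => p.1) (𝓝[A] q) (𝓝 q.1) :=
    continuousAt_fst.tendsto.mono_left nhdsWithin_le_nhds
  have hl2 : Tendsto (fun p : ℝ × Euc d => p.2) (𝓝[A] q) (𝓝 q.2) :=
    continuousAt_snd.tendsto.mono_left nhdsWithin_le_nhds
  have hq2 : q.2 ∈ closure (funnel d h) :=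
    isClosed_closure.mem_of_tendsto hl2 (hmem.mono fun p hp => hp.1)
  have hl2' : Tendsto (fun p : ℝ × Euc d => p.2) (𝓝[A] q) (𝓝[closure (funnel d h)] q.2) :=
    tendsto_nhdsWithin_iff.2 ⟨hl2, hmem.mono fun p hp => hp.1⟩
  have hs : ∀ s, Tendsto (fun p : ℝ × Euc d => v s p.2) (𝓝[A] q) (𝓝 (v s q.2)) := fun s =>
    ((hv.space_reg s).continuousOn q.2 hq2).tendsto.comp hl2'
  have hy : ∀ y ∈ closure (funnel d h),
      Tendsto (fun p : ℝ × Euc d => v p.1 y) (𝓝[A] q) (𝓝 (v q.1 y)) := fun y hy =>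
    ((hv.time_diff y hy).continuous.tendsto q.1).comp hl1
  have h0 : Tendsto (fun p : ℝ × Euc d => v q.1 p.2 - v p.1 p.2) (𝓝[A] q) (𝓝 0) := by
    refine squeeze_zero_norm' (a := fun p => n * |q.1 - p.1|)
      (hmem.mono fun p hp => hp.2.1 q.1) ?_
    have := ((tendsto_const_nhds (x := q.1)).sub hl1).abs.const_mul n
    simpa using this
  have hpp : Tendsto (fun p : ℝ × Euc d => v p.1 p.2) (𝓝[A] q) (𝓝 (v q.1 q.2)) := by
    have := (hs q.1).sub h0
    simpa using this
  refine ⟨hq2, fun s => ?_, fun y hyΩ => ?_⟩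
  · exact le_of_tendsto_of_tendsto ((hs s).sub hpp).abs
      (((tendsto_const_nhds (x := s)).sub hl1).abs.const_mul n) (hmem.mono fun p hp => hp.2.1 s)
  · exact le_of_tendsto_of_tendsto ((hy y hyΩ).sub hpp).abs
      (((tendsto_const_nhds (x := y)).sub hl2).norm.const_mul n)
      (hmem.mono fun p hp => hp.2.2 y hyΩ)

theorem sum_defectGrad_sq_ge (hΩ : IsFunnel d R α L h) {x : Euc d}
    (hx : x ∈ closure (funnel d h)) (hx' : x ∉ funnel d h) :
    4 * R ^ 2 ≤ ∑ i, defectGrad h x i ^ 2 := by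
  have h1 : 4 * primeSq x ≤ ∑ i, defectGrad h x i ^ 2 := by
    rw [primeSq, Finset.mul_sum]
    refine Finset.sum_le_sum fun i _ => ?_
    by_cases hi : i = 0
    · simp [hi]; positivity
    · simp [hi, defectGrad]; nlinarith
  rw [← primeNorm_sq, primeNorm_eq_of_notMem hΩ hx hx'] at h1
  have h2 := le_profile hΩ (x 0)
  have h3 := hΩ.Rpos
  nlinarith

/-- Near a boundary point, the squared defect is uniformly strictly subharmonic. -/
theorem exists_boundary_params (hΩ : IsFunnel d R α L h) {x1 : Euc d}
    (hx : x1 ∈ closure (funnel d h)) (hx' : x1 ∉ funnel d h) :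
    ∃ M p : ℝ, 0 < M ∧ 0 < p ∧ ∀ᶠ x in 𝓝 x1,
      p * M ≤ 2 * defect h x * defectLap h x + 2 * ∑ i, defectGrad h x i ^ 2 ∧
      4 * ∑ i, defectGrad h x i ^ 2 ≤ M := by
  have hR := hΩ.Rpos
  have hsum : Continuous fun x : Euc d => ∑ i, defectGrad h x i ^ 2 :=
    continuous_finsetSum _ fun i _ => (continuous_defectGrad hΩ i).pow 2
  have hlap : Continuous fun x : Euc d =>
      2 * defect h x * defectLap h x + 2 * ∑ i, defectGrad h x i ^ 2 :=
    (((continuous_defect hΩ).const_mul 2).mul (continuous_defectLap hΩ)).add (hsum.const_mul 2)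
  have h1 := sum_defectGrad_sq_ge hΩ hx hx'
  have h2 := defect_eq_zero hΩ hx hx'
  set M := 4 * ∑ i, defectGrad h x1 i ^ 2 + 1 with hM
  have hM0 : 0 < M := by nlinarith
  refine ⟨M, R ^ 2 / M, hM0, by positivity, ?_⟩
  rw [div_mul_cancel₀ _ hM0.ne']
  have e1 := hlap.continuousAt.eventually (lt_mem_nhds
    (show R ^ 2 < 2 * defect h x1 * defectLap h x1 + 2 * ∑ i, defectGrad h x1 i ^ 2 by
      rw [h2]; nlinarith))
  have e2 := (hsum.const_mul 4).continuousAt.eventually (gt_mem_nhds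
    (show 4 * ∑ i, defectGrad h x1 i ^ 2 < M by rw [hM]; linarith))
  filter_upwards [e1, e2] with x h3 h4 using ⟨h3.le, h4.le⟩

/-- Upper semicontinuity from the right at a point of a closed set off which the solution is
right-continuous, and on which it is uniformly Lipschitz. -/
theorem Sol.eventually_le (hΩ : IsFunnel d R α L h) {f : ℝ → ℝ} {v : ℝ → Euc d → ℝ}
    (hv : Sol d h f v) {B : ℝ} (hB : ∀ s ∈ Icc (0 : ℝ) 1, |f s| ≤ B) {E O : Set (ℝ × Euc d)}
    (hE : IsClosed E) (hEΩ : ∀ q ∈ E, q.2 ∈ closure (funnel d h))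
    (hRC : ∀ q, q ∉ E → q.2 ∈ closure (funnel d h) → RC h v q.1 q.2)
    (hO : IsOpen O) {n : ℝ} (hn : 0 ≤ n) (hLip : ∀ q ∈ E ∩ O, LipAt h v n q)
    (halt : (∀ q ∈ E ∩ O, q.2 ∉ funnel d h) ∨ ∀ q ∈ O, q.2 ∈ funnel d h)
    {p : ℝ × Euc d} (hp : p ∈ E ∩ O) {η : ℝ} (hη : 0 < η) :
    ∀ᶠ q in 𝓝[Ici p.1 ×ˢ closure (funnel d h)] p, v q.1 q.2 ≤ v p.1 p.2 + η := by
  obtain ⟨t1, x1⟩ := p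
  have hx1 := hEΩ _ hp.1
  simp only at hx1
  obtain ⟨δ, hδ, hδO⟩ := Metric.isOpen_iff.1 hO _ hp.2
  obtain ⟨ρ, hρ, hρδ, hρη, hbar⟩ : ∃ ρ > 0, 2 * ρ < δ ∧ 5 * n * ρ ≤ η / 4 ∧
      ((∀ q ∈ O, q.2 ∈ funnel d h) ∨ (∀ q ∈ E ∩ O, q.2 ∉ funnel d h) ∧
        ∃ M p : ℝ, 0 < M ∧ 0 < p ∧ ∀ x ∈ Metric.closedBall x1 ρ,
          p * M ≤ 2 * defect h x * defectLap h x + 2 * ∑ i, defectGrad h x i ^ 2 ∧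
          4 * ∑ i, defectGrad h x i ^ 2 ≤ M) := by
    have hsmall : ∀ δ' > 0, ∃ ρ > 0, ρ < δ' ∧ 2 * ρ < δ ∧ 5 * n * ρ ≤ η / 4 := by
      intro δ' hδ'
      refine ⟨min (δ' / 2) (min (δ / 4) (η / (20 * (n + 1)))), by positivity, ?_, ?_, ?_⟩
      · linarith [min_le_left (δ' / 2) (min (δ / 4) (η / (20 * (n + 1))))]
      · linarith [(min_le_right (δ' / 2) _).trans (min_le_left (δ / 4) (η / (20 * (n + 1))))]
      · have h1 := (min_le_right (δ' / 2) _).trans (min_le_right (δ / 4) (η / (20 * (n + 1))))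
        calc 5 * n * min (δ' / 2) (min (δ / 4) (η / (20 * (n + 1))))
            ≤ 5 * n * (η / (20 * (n + 1))) := by gcongr
          _ = η / 4 * (n / (n + 1)) := by field_simp; ring
          _ ≤ η / 4 * 1 := by gcongr; rw [div_le_one (by positivity)]; linarith
          _ = η / 4 := mul_one _
    rcases halt with halt | halt
    · obtain ⟨M, p, hM, hp', hev⟩ := exists_boundary_params hΩ hx1 (halt _ hp)
      obtain ⟨δ', hδ', hball⟩ := Metric.eventually_nhds_iff_ball.1 hev
      obtain ⟨ρ, hρ, h1, h2, h3⟩ := hsmall δ' hδ'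
      exact ⟨ρ, hρ, h2, h3, Or.inr ⟨halt, M, p, hM, hp', fun x hx =>
        hball x (Metric.closedBall_subset_ball h1 hx)⟩⟩
    · obtain ⟨ρ, hρ, -, h2, h3⟩ := hsmall 1 one_pos
      exact ⟨ρ, hρ, h2, h3, Or.inl halt⟩
  have hsub : ∀ t y, |t - t1| ≤ ρ → y ∈ Metric.closedBall x1 (2 * ρ) → (t, y) ∈ O := by
    intro t y ht hy
    refine hδO ?_
    rw [Metric.mem_ball, Prod.dist_eq, max_lt_iff, Real.dist_eq]
    exact ⟨by simpa using ht.trans_lt (by linarith), (Metric.mem_closedBall.1 hy).trans_lt hρδ⟩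
  obtain ⟨K, C, hK, hC, hlap, hNL⟩ := exists_bump_params hΩ x1 hρ (lam := η / 4) (by linarith) B
  set η0 := v t1 x1 + 5 * n * ρ with hη0
  have hη00 : 0 ≤ η0 := by
    have := (hv.range01 t1 x1 hx1).1
    positivity
  have hclaim : ∀ t x, t1 ≤ t → t - t1 ≤ ρ → x ∈ Metric.closedBall x1 ρ →
      x ∈ closure (funnel d h) →
      v t x ≤ η0 + (2 / ρ ^ 2 * ‖x - x1‖ ^ 2 + η / 4) + C * (t - t1) := by
    intro t x ht htρ hx hxΩ
    set P : Set ℝ := Prod.fst '' (E ∩ Icc t1 t ×ˢ Metric.closedBall x1 ρ) with hP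
    have hPc : IsCompact P :=
      ((isCompact_Icc.prod (isCompact_closedBall x1 ρ)).inter_left hE).image continuous_fst
    have hPne : P.Nonempty :=
      ⟨t1, (t1, x1), ⟨hp.1, ⟨le_rfl, ht⟩, Metric.mem_closedBall_self hρ.le⟩, rfl⟩
    obtain ⟨a, haP, hamax⟩ := hPc.exists_isGreatest hPne
    obtain ⟨⟨a', x'⟩, ⟨haE, hat, hx'⟩, rfl⟩ := haP
    simp only at hat hx' hamax
    have hta : |a' - t1| ≤ ρ := by
      rw [abs_of_nonneg (by linarith [hat.1])]; linarith [hat.2]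
    have hx'2 : x' ∈ Metric.closedBall x1 (2 * ρ) :=
      Metric.closedBall_subset_closedBall (by linarith) hx'
    have hva : ∀ y ∈ Metric.closedBall x1 (2 * ρ), y ∈ closure (funnel d h) → v a' y ≤ η0 := by
      intro y hy hyΩ
      have l1 := (hLip _ ⟨haE, hsub a' x' hta hx'2⟩).2
      have l2 := (le_abs_self _).trans (l1 y hyΩ)
      have l3 := (neg_abs_le _).trans' (neg_le_neg (l1 x1 hx1))
      have l4 := (le_abs_self _).trans ((hLip _ hp).1 a')
      simp only at l2 l3 l4
      have n1 : ‖y - x'‖ ≤ 3 * ρ := by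
        rw [← dist_eq_norm]
        have := dist_triangle_right y x' x1
        linarith [Metric.mem_closedBall.1 hy, Metric.mem_closedBall.1 hx']
      have n2 : ‖x1 - x'‖ ≤ ρ := by
        rw [← dist_eq_norm, dist_comm]; exact Metric.mem_closedBall.1 hx'
      have m1 := mul_le_mul_of_nonneg_left n1 hn
      have m2 := mul_le_mul_of_nonneg_left n2 hn
      have m3 := mul_le_mul_of_nonneg_left hta hn
      rw [hη0]; linarith
    rcases hat.2.eq_or_lt with he | hlt
    · have h1 := hva x (Metric.closedBall_subset_closedBall (by linarith) hx) hxΩ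
      rw [he] at h1
      have h2 : 0 ≤ C * (t - t1) := mul_nonneg hC.le (by linarith)
      have h3 : 0 ≤ 2 / ρ ^ 2 * ‖x - x1‖ ^ 2 := by positivity
      linarith
    · have hgap := gap_bound hΩ hv hB hρ (lam := η / 4) (by linarith) hC hlap hNL (a := a')
        (t := t) hη00 ?_ ?_ hx hxΩ
      · have h1 : bump h ρ (η / 4) K x1 x ≤ 2 / ρ ^ 2 * ‖x - x1‖ ^ 2 + η / 4 := by
          have := defect_nonneg hΩ hxΩ
          have h2 : Real.exp (-K * defect h x) ≤ 1 := Real.exp_le_one_iff.2 (by nlinarith)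
          rw [bump]; nlinarith
        have h2 : C * (t - a') ≤ C * (t - t1) := mul_le_mul_of_nonneg_left (by linarith [hat.1]) hC.le
        linarith
      · intro s hs y hy hyΩ
        refine hRC (s, y) (fun hsE => ?_) hyΩ
        have := hamax ⟨(s, y), ⟨hsE, ⟨hat.1.trans hs.1.le, hs.2⟩, hy⟩, rfl⟩
        simp only at this
        linarith [hs.1]
      · intro ε hε
        rcases hbar with hinn | ⟨hbd, M, p, hM, hp', hMp⟩
        · exact exists_barrier_interior hv hρ (fun y hy => hinn _ (hsub a' y hta hy)) hlt hη00
            (fun y hy => hva y hy (subset_closure (hinn _ (hsub a' y hta hy)))) hε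
        · have hmono := Metric.closedBall_subset_closedBall (x := x1) (by linarith : ρ ≤ 2 * ρ)
          exact exists_barrier_boundary hΩ hv hM hp' (fun y hy => (hMp y hy).1)
            (fun y hy => (hMp y hy).2) hlt hη00 (fun y hy => hva y (hmono hy))
            (fun y hy hyΩ => hRC (a', y)
              (fun hE' => hbd _ ⟨hE', hsub a' y hta (hmono hy)⟩ hyΩ) (subset_closure hyΩ)) hε
  have hcont : Continuous fun q : ℝ × Euc d => 2 / ρ ^ 2 * ‖q.2 - x1‖ ^ 2 + C * (q.1 - t1) := by
    fun_prop
  have hev := (hcont.tendsto (t1, x1)).eventually (gt_mem_nhds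
    (show 2 / ρ ^ 2 * ‖x1 - x1‖ ^ 2 + C * (t1 - t1) < η / 4 by
      rw [sub_self, sub_self, norm_zero]; linarith))
  have hball := Metric.ball_mem_nhds (t1, x1) hρ
  filter_upwards [self_mem_nhdsWithin, mem_nhdsWithin_of_mem_nhds hev,
    mem_nhdsWithin_of_mem_nhds hball] with q hq h1 h2
  rw [Metric.mem_ball, Prod.dist_eq, max_lt_iff, Real.dist_eq] at h2
  have h3 := hclaim q.1 q.2 hq.1 ((le_abs_self _).trans h2.1.le) h2.2.le hq.2

  linarith

/-- Classical solutions are jointly right-continuous. -/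
theorem Sol.rc (hΩ : IsFunnel d R α L h) {f : ℝ → ℝ} {v : ℝ → Euc d → ℝ}
    (hv : Sol d h f v) {B : ℝ} (hB : ∀ s ∈ Icc (0 : ℝ) 1, |f s| ≤ B) (t : ℝ) {x : Euc d}
    (hx : x ∈ closure (funnel d h)) : RC h v t x := by
  set G : Set (ℝ × Euc d) :=
    {q | ∀ᶠ p in 𝓝 q, p.2 ∈ closure (funnel d h) → RC h v p.1 p.2} with hG
  have hGo : IsOpen G := isOpen_setOfPred_eventually_nhds
  set E : Set (ℝ × Euc d) := {q | q.2 ∈ closure (funnel d h)} \ G with hE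
  have hEc : IsClosed E := (isClosed_closure.preimage continuous_snd).sdiff hGo
  suffices hemp : E = ∅ by
    have : (t, x) ∈ G := by
      by_contra hcon
      have : (t, x) ∈ E := ⟨hx, hcon⟩
      rw [hemp] at this; exact this
    exact (this.self_of_nhds : _) hx
  by_contra hne
  obtain ⟨q0, hq0⟩ := nonempty_iff_ne_empty.2 hne
  have : Nonempty E := ⟨⟨q0, hq0⟩⟩
  have : CompleteSpace E := hEc.isComplete.completeSpace_coe
  obtain ⟨n, hn⟩ := nonempty_interior_of_iUnion_of_closed
    (f := fun n : ℕ => {q : E | LipAt h v n q.1}) (fun n => by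
      have : {q : E | LipAt h v n q.1} = Subtype.val ⁻¹'
          {q : ℝ × Euc d | q.2 ∈ closure (funnel d h) ∧ LipAt h v n q} := by
        ext q; exact ⟨fun h1 => ⟨q.2.1, h1⟩, fun h1 => h1.2⟩
      rw [this]
      exact (hv.isClosed_lipAt n).preimage continuous_subtype_val) (by
      ext q; simpa using hv.exists_lipAt q.1 q.2.1)
  obtain ⟨⟨q1, hq1E⟩, hq1⟩ := hn
  obtain ⟨U, hU, hUo, hq1U⟩ := mem_interior.1 hq1
  obtain ⟨O, hO, rfl⟩ := isOpen_induced_iff.1 hUo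
  have hLip : ∀ q ∈ E ∩ O, LipAt h v n q := fun q hq => hU (a := ⟨q, hq.1⟩) hq.2
  obtain ⟨O', hO', hO'O, hO'ne, halt⟩ : ∃ O', IsOpen O' ∧ O' ⊆ O ∧ (E ∩ O').Nonempty ∧
      ((∀ q ∈ E ∩ O', q.2 ∉ funnel d h) ∨ ∀ q ∈ O', q.2 ∈ funnel d h) := by
    by_cases hc : ∃ q ∈ E ∩ O, q.2 ∈ funnel d h
    · obtain ⟨q, hq, hqΩ⟩ := hc
      exact ⟨O ∩ Prod.snd ⁻¹' funnel d h, hO.inter ((isOpen_funnel hΩ).preimage continuous_snd),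
        inter_subset_left, ⟨q, hq.1, hq.2, hqΩ⟩, Or.inr fun q hq => hq.2⟩
    · push Not at hc
      exact ⟨O, hO, le_rfl, ⟨q1, hq1E, hq1U⟩, Or.inl hc⟩
  have hRCoff : ∀ q, q ∉ E → q.2 ∈ closure (funnel d h) → RC h v q.1 q.2 := by
    intro q hq hqΩ
    have : q ∈ G := by by_contra hcon; exact hq ⟨hqΩ, hcon⟩
    exact this.self_of_nhds hqΩ
  have hLip' : ∀ q ∈ E ∩ O', LipAt h v n q := fun q hq => hLip q ⟨hq.1, hO'O hq.2⟩
  have hRCon : ∀ q ∈ E ∩ O', RC h v q.1 q.2 := by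
    intro q hq
    have hup := fun η hη => hv.eventually_le hΩ hB hEc (fun q hq => hq.1) hRCoff hO'
      (Nat.cast_nonneg n) hLip' halt hq (η := η) hη
    have hlo := fun η hη => (hv.one_sub hΩ).eventually_le hΩ (B := B)
      (fun s hs => by rw [abs_neg]; exact hB _ ⟨by linarith [hs.2], by linarith [hs.1]⟩) hEc
      (fun q hq => hq.1) (fun q hq hqΩ => continuousWithinAt_const.sub (hRCoff q hq hqΩ)) hO'
      (Nat.cast_nonneg n) (fun q hq => by
        have h1 := hLip' q hq
        refine ⟨fun s => ?_, fun y hy => ?_⟩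
        · rw [sub_sub_sub_cancel_left, abs_sub_comm]; exact h1.1 s
        · rw [sub_sub_sub_cancel_left, abs_sub_comm]; exact h1.2 y hy) halt hq (η := η) hη
    refine Metric.continuousWithinAt_iff'.2 fun ε hε => ?_
    filter_upwards [hup (ε / 2) (by linarith), hlo (ε / 2) (by linarith)] with p h1 h2
    rw [Real.dist_eq, abs_lt]
    constructor <;> linarith
  obtain ⟨q, hqE, hqO⟩ := hO'ne
  refine hqE.2 ?_
  filter_upwards [hO'.mem_nhds hqO] with p hp hpΩ
  by_cases hpE : p ∈ E
  · exact hRCon p ⟨hpE, hp⟩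
  · exact hRCoff p hpE hpΩ
end

section
variable {d : ℕ} {h : ℝ → ℝ} {R α L : ℝ}

theorem hasDerivAt_max_zero_pow (n : ℕ) (s : ℝ) :
    HasDerivAt (fun s : ℝ => max s 0 ^ (n + 2)) ((n + 2 : ℕ) * max s 0 ^ (n + 1)) s := by
  rcases lt_trichotomy s 0 with hs | rfl | hs
  · rw [max_eq_right hs.le]
    refine ((hasDerivAt_const s (0 : ℝ)).congr_of_eventuallyEq ?_).congr_deriv (by simp)
    filter_upwards [gt_mem_nhds hs] with y hy
    rw [max_eq_right (le_of_lt hy)]; simp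
  · rw [← hasDerivWithinAt_univ, ← Iic_union_Ici (a := (0 : ℝ))]
    refine HasDerivWithinAt.union ?_ ?_
    · refine ((hasDerivWithinAt_const (0 : ℝ) _ (0 : ℝ)).congr (fun y hy => ?_) ?_).congr_deriv ?_
      · rw [max_eq_right hy]; simp
      · simp
      · simp
    · refine ((hasDerivAt_pow (n + 2) (0 : ℝ)).hasDerivWithinAt.congr
        (fun y hy => ?_) ?_).congr_deriv ?_
      · rw [max_eq_left hy]
      · simp
      · simp
  · rw [max_eq_left hs.le]
    refine (hasDerivAt_pow (n + 2) s).congr_of_eventuallyEq ?_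
    filter_upwards [lt_mem_nhds hs] with y hy
    rw [max_eq_left (le_of_lt hy)]

theorem _root_.IsFunnel.cos_pos (hΩ : IsFunnel d R α L h) : 0 < Real.cos α :=
  Real.cos_pos_of_mem_Ioo ⟨by linarith [hΩ.αmem.1, Real.pi_pos], hΩ.αmem.2⟩

theorem _root_.IsFunnel.L_pos (hΩ : IsFunnel d R α L h) : 0 < L := hΩ.Rpos.trans hΩ.RL

theorem _root_.IsFunnel.tan_nonneg (hΩ : IsFunnel d R α L h) : 0 ≤ Real.tan α :=
  (hΩ.deriv_nonneg 0).trans (hΩ.deriv_le 0)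

theorem _root_.IsFunnel.deriv_deriv_left (hΩ : IsFunnel d R α L h) {s : ℝ} (hs : s < 0) :
    deriv (deriv h) s = 0 := by
  have h1 : deriv h =ᶠ[𝓝 s] fun _ => 0 := by
    filter_upwards [gt_mem_nhds hs] with y hy
    have : h =ᶠ[𝓝 y] fun _ => R := by
      filter_upwards [gt_mem_nhds hy] with z hz using hΩ.left z (le_of_lt hz)
    rw [this.deriv_eq, deriv_const]
  rw [h1.deriv_eq, deriv_const]

theorem _root_.IsFunnel.deriv_right (hΩ : IsFunnel d R α L h) {s : ℝ} (hs : L * Real.cos α < s) :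
    deriv h s = Real.tan α := by
  have : h =ᶠ[𝓝 s] fun s => s * Real.tan α := by
    filter_upwards [lt_mem_nhds hs] with z hz using hΩ.right z (le_of_lt hz)
  rw [this.deriv_eq]; simp

theorem _root_.IsFunnel.deriv_deriv_right (hΩ : IsFunnel d R α L h) {s : ℝ} (hs : L * Real.cos α < s) :
    deriv (deriv h) s = 0 := by
  have h1 : deriv h =ᶠ[𝓝 s] fun _ => Real.tan α := by
    filter_upwards [lt_mem_nhds hs] with y hy using hΩ.deriv_right hy
  rw [h1.deriv_eq, deriv_const]

theorem _root_.IsFunnel.exists_curv_bound (hΩ : IsFunnel d R α L h) :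
    ∃ C, 0 ≤ C ∧ ∀ s, |h s * deriv (deriv h) s| ≤ C := by
  have hc : Continuous fun s => h s * deriv (deriv h) s :=
    hΩ.smooth.continuous.mul (continuous_deriv_deriv_of_contDiff_two hΩ.smooth)
  obtain ⟨C, hC⟩ := (isCompact_Icc (a := (0 : ℝ)) (b := L * Real.cos α)).exists_bound_of_continuousOn
    hc.continuousOn
  refine ⟨max C 0, le_max_right _ _, fun s => ?_⟩
  rcases lt_or_ge s 0 with hs | hs
  · rw [hΩ.deriv_deriv_left hs]; simp
  rcases le_or_gt s (L * Real.cos α) with hs' | hs'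
  · exact (hC s ⟨hs, hs'⟩).trans (le_max_left _ _)
  · rw [hΩ.deriv_deriv_right hs']; simp

theorem _root_.IsFunnel.profile_le (hΩ : IsFunnel d R α L h) (s : ℝ) :
    h s ≤ R + Real.tan α * |s| := by
  have ht := hΩ.tan_nonneg
  rcases le_total s 0 with hs | hs
  · rw [hΩ.left s hs]; nlinarith [abs_nonneg s]
  · have := image_sub_le_mul_sub_of_deriv_le (f := h) (hΩ.smooth.differentiable (by norm_num))
      hΩ.deriv_le hs
    rw [hΩ.left 0 le_rfl] at this
    rw [abs_of_nonneg hs]; linarith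

/-- In the transition zone the domain stays in the ball of radius `L`. -/
theorem _root_.IsFunnel.norm_le_of_mid (hΩ : IsFunnel d R α L h) {x : Euc d}
    (hx : x ∈ closure (funnel d h)) (h0 : 0 ≤ x 0) (h1 : x 0 ≤ L * Real.cos α) : ‖x‖ ≤ L := by
  have h2 := (primeNorm_le_of_mem_closure hΩ hx).trans (monotone_profile hΩ h1)
  rw [hΩ.right _ le_rfl, mul_assoc, mul_comm (Real.cos α), Real.tan_mul_cos hΩ.cos_pos.ne'] at h2
  have h3 := norm_sq_eq x
  rw [← primeNorm_sq] at h3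
  have h4 := primeNorm_nonneg x
  have h5 := Real.sin_sq_add_cos_sq α
  have hL := hΩ.L_pos
  refine abs_le_of_sq_le_sq' ?_ hL.le |>.2
  have h6 : x 0 ^ 2 ≤ (L * Real.cos α) ^ 2 := by gcongr
  have h7 : primeNorm x ^ 2 ≤ (L * Real.sin α) ^ 2 := by gcongr
  calc ‖x‖ ^ 2 ≤ (L * Real.cos α) ^ 2 + (L * Real.sin α) ^ 2 := by linarith
    _ = L ^ 2 * (Real.sin α ^ 2 + Real.cos α ^ 2) := by ring
    _ = L ^ 2 := by rw [h5, mul_one]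

theorem _root_.IsFunnel.radial_nonneg (hΩ : IsFunnel d R α L h) {x : Euc d}
    (hx : x ∈ closure (funnel d h)) (hx' : x ∉ funnel d h) (hL : L < ‖x‖) :
    0 ≤ primeNorm x - x 0 * deriv h (x 0) := by
  rw [primeNorm_eq_of_notMem hΩ hx hx']
  rcases le_total (x 0) 0 with h0 | h0
  · nlinarith [profile_pos hΩ (x 0), hΩ.deriv_nonneg (x 0)]
  rcases le_total (x 0) (L * Real.cos α) with h1 | h1
  · linarith [hΩ.norm_le_of_mid hx h0 h1]
  · rw [hΩ.right _ h1]
    nlinarith [hΩ.deriv_le (x 0)]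

/-- An exhaustion function with strictly positive normal derivative. -/
theorem _root_.IsFunnel.exists_exhaustion (hΩ : IsFunnel d R α L h) :
    ∃ (Ψ : Euc d → ℝ) (C : ℝ), Continuous Ψ ∧ (∀ x, 1 + ‖x‖ ^ 2 ≤ Ψ x) ∧ 0 ≤ C ∧
      ∀ x, ∃ G l, Jet Ψ x G l ∧ l ≤ C * Ψ x ∧
        (x ∈ closure (funnel d h) → x ∉ funnel d h → 0 < NL h x G) := by
  set m : Euc d → ℝ := fun x => max (‖x‖ ^ 2 - L ^ 2) 0 with hm
  have hm0 : ∀ x, 0 ≤ m x := fun x => le_max_right _ _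
  have hmle : ∀ x, ‖x‖ ^ 2 ≤ m x + L ^ 2 := fun x => by
    have := le_max_left (‖x‖ ^ 2 - L ^ 2) 0
    simp only [hm]; linarith
  have hR := hΩ.Rpos
  have hL := hΩ.L_pos
  set A := 2 * R ^ 2 + 2 * Real.tan α ^ 2 with hA
  have hA0 : 0 ≤ A := by positivity
  have hdef : ∀ x : Euc d, defect h x ≤ A * (1 + ‖x‖ ^ 2) := by
    intro x
    have h1 := hΩ.profile_le (x 0)
    have h2 := profile_pos hΩ (x 0)
    have h3 := norm_sq_eq x
    have h4 := primeSq_nonneg x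
    have h5 : h (x 0) ^ 2 ≤ (R + Real.tan α * |x 0|) ^ 2 := by gcongr
    have h6 : (R + Real.tan α * |x 0|) ^ 2 ≤ 2 * R ^ 2 + 2 * Real.tan α ^ 2 * x 0 ^ 2 := by
      rw [← sq_abs (x 0)]; nlinarith [sq_nonneg (R - Real.tan α * |x 0|)]
    have h7 : 2 * Real.tan α ^ 2 * x 0 ^ 2 ≤ A * ‖x‖ ^ 2 := by
      apply mul_le_mul _ (by linarith) (by positivity) hA0
      rw [hA]; linarith [sq_nonneg R]
    have h8 : 2 * R ^ 2 ≤ A := by rw [hA]; linarith [sq_nonneg (Real.tan α)]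
    rw [defect]; linarith
  set B := A + 1 + (A + 1) * (L ^ 2 + A + 2) with hB
  set Ψ : Euc d → ℝ := fun x => 2 * m x ^ 3 - defect h x + B with hΨ
  have hΨge : ∀ x, 1 + ‖x‖ ^ 2 + m x ^ 3 ≤ Ψ x := by
    intro x
    have h1 := hdef x
    have h2 := hmle x
    have h3 := hm0 x
    simp only [hΨ]
    have h4 : (A + 1) * ‖x‖ ^ 2 ≤ (A + 1) * (m x + L ^ 2) := by gcongr
    have h5 : (A + 1) * m x ≤ m x ^ 3 + (A + 1) * (A + 2) := by
      rcases le_total (m x) (A + 2) with h6 | h6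
      · have : (A + 1) * m x ≤ (A + 1) * (A + 2) := by gcongr
        have : 0 ≤ m x ^ 3 := by positivity
        linarith
      · have : (A + 1) * m x ≤ m x ^ 2 * m x := by
          gcongr; nlinarith
        have : 0 ≤ (A + 1) * (A + 2) := by positivity
        nlinarith
    rw [hB]; linarith
  obtain ⟨Ch, hCh0, hCh⟩ := hΩ.exists_curv_bound
  have hmc : Continuous m := by fun_prop
  refine ⟨Ψ, 2 * (6 * (d + 1) + 24 + 24 * L ^ 2) + 2 * Ch + 2 * d, ?_, fun x => ?_, by positivity,
    fun x => ?_⟩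
  · exact (((hmc.pow 3).const_mul 2).sub (continuous_defect hΩ)).add continuous_const
  · have := hΨge x
    have : 0 ≤ m x ^ 3 := pow_nonneg (hm0 x) 3
    linarith
  have j1 : Jet (fun z : Euc d => ‖z‖ ^ 2) x (fun i => 2 * x i) (2 * (d + 1)) := by
    simpa using jet_dist_sq 0 x
  have j2 : Jet (fun z : Euc d => m z ^ 3) x (fun i => (3 * m x ^ 2) * (2 * x i))
      ((3 * m x ^ 2) * (2 * (d + 1)) + (6 * m x) * ∑ i, (2 * x i) ^ 2) := by
    refine j1.comp (F := fun s => max (s - L ^ 2) 0 ^ 3) (F1 := fun s => 3 * max (s - L ^ 2) 0 ^ 2)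
      (Eventually.of_forall fun s => ?_) ?_
    · have := (hasDerivAt_max_zero_pow 1 (s - L ^ 2)).comp_sub_const s (L ^ 2)
      exact this.congr_deriv (by norm_num)
    · have := ((hasDerivAt_max_zero_pow 0 (‖x‖ ^ 2 - L ^ 2)).comp_sub_const (‖x‖ ^ 2)
        (L ^ 2)).const_mul 3
      exact this.congr_deriv (by simp only [hm]; push_cast; ring)
  have j3 := ((j2.const_mul 2).sub (jet_defect hΩ x)).add (jet_const B x)
  refine ⟨_, _, j3, ?_, fun hx hx' => ?_⟩
  · have hsum : ∑ i, (2 * x i) ^ 2 = 4 * ‖x‖ ^ 2 := by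
      rw [EuclideanSpace.norm_sq_eq, Finset.mul_sum]
      refine Finset.sum_congr rfl fun i _ => ?_
      rw [Real.norm_eq_abs, sq_abs]; ring
    rw [hsum]
    have h1 := hm0 x
    have h2 := hmle x
    have h3 := hΨge x
    have h4 : -defectLap h x ≤ 2 * Ch + 2 * d := by
      have := (abs_le.1 (hCh (x 0))).1
      rw [defectLap]; nlinarith [sq_nonneg (deriv h (x 0))]
    have hN := sq_nonneg ‖x‖
    have c1 : m x ^ 2 ≤ 1 + m x ^ 3 := by nlinarith [sq_nonneg (m x - 1), mul_nonneg h1 (sq_nonneg (m x - 1)), mul_nonneg h1 h1]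
    have c2 : m x ≤ 1 + m x ^ 3 := by nlinarith [sq_nonneg (m x - 1), mul_nonneg h1 (sq_nonneg (m x - 1)), mul_nonneg h1 h1]
    have c3 : 6 * m x * (4 * ‖x‖ ^ 2) ≤ 24 * m x ^ 2 + 24 * L ^ 2 * m x := by
      have : m x * ‖x‖ ^ 2 ≤ m x * (m x + L ^ 2) := by gcongr
      nlinarith
    have hd : (0 : ℝ) ≤ d := Nat.cast_nonneg d
    set Y := 1 + m x ^ 3 with hY
    have hYΨ : Y ≤ Ψ x := by linarith
    have hY1 : 1 ≤ Y := by rw [hY]; linarith [pow_nonneg h1 3]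
    calc 2 * (3 * m x ^ 2 * (2 * (↑d + 1)) + 6 * m x * (4 * ‖x‖ ^ 2)) - defectLap h x + 0
        ≤ 2 * (6 * (d + 1) * m x ^ 2 + (24 * m x ^ 2 + 24 * L ^ 2 * m x)) + (2 * Ch + 2 * d) := by
          linarith
      _ ≤ 2 * (6 * (d + 1) * Y + (24 * Y + 24 * L ^ 2 * Y)) + (2 * Ch + 2 * d) * Y := by
          have e1 : 6 * ((d : ℝ) + 1) * m x ^ 2 ≤ 6 * (d + 1) * Y := by gcongr
          have e2 : 24 * L ^ 2 * m x ≤ 24 * L ^ 2 * Y := by gcongr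
          have e3 : (2 * Ch + 2 * d) * 1 ≤ (2 * Ch + 2 * d) * Y := by gcongr
          linarith
      _ = (2 * (6 * (d + 1) + 24 + 24 * L ^ 2) + 2 * Ch + 2 * d) * Y := by ring
      _ ≤ _ := by gcongr
  · have e : (fun i => 2 * (3 * m x ^ 2 * (2 * x i)) - defectGrad h x i + 0)
        = fun i => 6 * m x ^ 2 * (2 * x i) + (-1) * defectGrad h x i := by
      funext i; ring
    rw [e, NL_add, NL_mul h x (6 * m x ^ 2), NL_mul h x (-1), NL_defect hΩ hx hx',
      NL_norm_sq h x (primeNorm_pos_of_notMem hΩ hx hx')]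
    have h1 := profile_pos hΩ (x 0)
    have h2 : 0 ≤ 6 * m x ^ 2 * (2 * (primeNorm x - x 0 * deriv h (x 0))) := by
      rcases le_or_gt ‖x‖ L with hxL | hxL
      · have : m x = 0 := by
          simp only [hm]; refine max_eq_right ?_
          nlinarith [norm_nonneg x]
        rw [this]; simp
      · have := hΩ.radial_nonneg hx hx' hxL
        positivity
    nlinarith [mul_pos h1 (show 0 < 1 + deriv h (x 0) ^ 2 by positivity)]

/-- Comparison principle in the funnel, for sets that may be unbounded. -/
theorem Sol.comparison (hΩ : IsFunnel d R α L h) {f : ℝ → ℝ} {v V : ℝ → Euc d → ℝ}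
    (hv : Sol d h f v) {Lf : ℝ} (hLf : ∀ a b, |f a - f b| ≤ Lf * |a - b|) {S : Set (Euc d)}
    (hS : IsClosed S) (hSΩ : S ⊆ closure (funnel d h)) {a : ℝ}
    (hV : ContinuousOn (fun q : ℝ × Euc d => V q.1 q.2) (Ici a ×ˢ univ))
    (hV0 : ∀ t ≥ a, ∀ x ∈ S, 0 ≤ V t x) (h0 : ∀ x ∈ S, v a x ≤ V a x)
    (hsup : ∀ t > a, ∀ x ∈ S, V t x < v t x → S ∈ 𝓝[closure (funnel d h)] x ∧
      ∃ G l wt, Jet (V t) x G l ∧ HasDerivAt (fun s => V s x) wt t ∧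
        (x ∈ funnel d h → l + f (V t x) ≤ wt) ∧ (x ∉ funnel d h → 0 ≤ NL h x G)) :
    ∀ t ≥ a, ∀ x ∈ S, v t x ≤ V t x := by
  intro b hb x0 hx0
  obtain ⟨Ψ, C, hΨc, hΨ1, hC0, hΨj⟩ := hΩ.exists_exhaustion
  have hΨpos : ∀ x, 0 < Ψ x := fun x => by nlinarith [hΨ1 x, sq_nonneg ‖x‖]
  have hLf0 : 0 ≤ Lf := by
    have := (abs_nonneg _).trans (hLf 1 0); simpa using this
  have hB : ∀ s ∈ Icc (0 : ℝ) 1, |f s| ≤ |f 0| + Lf := by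
    intro s hs
    have h1 := hLf s 0
    have h2 := abs_sub_abs_le_abs_sub (f s) (f 0)
    rw [sub_zero, abs_of_nonneg hs.1] at h1
    nlinarith [hs.2]
  set κ := C + Lf + 1 with hκ
  suffices hε : ∀ ε > 0, v b x0 ≤ V b x0 + ε * (Real.exp (κ * (b - a)) * Ψ x0) by
    have hlim : Tendsto (fun ε : ℝ => V b x0 + ε * (Real.exp (κ * (b - a)) * Ψ x0)) (𝓝[>] 0)
        (𝓝 (V b x0 + 0 * (Real.exp (κ * (b - a)) * Ψ x0))) := by
      refine Tendsto.mono_left ?_ nhdsWithin_le_nhds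
      exact Continuous.tendsto (by fun_prop) 0
    rw [zero_mul, add_zero] at hlim
    refine ge_of_tendsto hlim ?_
    filter_upwards [self_mem_nhdsWithin] with ε hε' using hε ε hε'
  intro ε hε
  set E : ℝ → ℝ := fun t => ε * Real.exp (κ * (t - a)) with hE
  have hE1 : ∀ t ≥ a, ε ≤ E t := fun t ht => by
    have : 1 ≤ Real.exp (κ * (t - a)) :=
      Real.one_le_exp (mul_nonneg (by positivity) (by linarith))
    simp only [hE]; nlinarith
  have hE' : ∀ t, HasDerivAt E (κ * E t) t := by
    intro t
    have h1 : HasDerivAt (fun t => κ * (t - a)) (κ * 1) t :=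
      ((hasDerivAt_id t).sub_const a).const_mul κ
    exact (h1.exp.const_mul ε).congr_deriv (by simp only [hE]; ring)
  set W : ℝ → Euc d → ℝ := fun t x => V (max a t) x + E t * Ψ x with hW
  set ρ := 1 / ε + 1 + ‖x0‖ with hρ
  have hρ0 : ‖x0‖ ≤ ρ := by rw [hρ]; have : 0 < 1 / ε := by positivity
                            linarith
  have hfin : v b x0 < W b x0 := by
    refine strict_comparison hΩ hv (C := S ∩ Metric.closedBall 0 ρ) (W := W) (a := a) (b := b)
      ((isCompact_closedBall 0 ρ).inter_left hS) (inter_subset_left.trans hSΩ)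
      (fun t _ x hx => hv.rc hΩ hB t (hSΩ hx.1)) ?_ ?_ ?_ b ⟨hb, le_rfl⟩ x0
      ⟨hx0, by simpa using hρ0⟩
    · refine Continuous.add ?_ ?_
      · refine hV.comp_continuous (f := fun q : ℝ × Euc d => (max a q.1, q.2)) (by fun_prop)
          fun q => ⟨mem_Ici.2 (le_max_left _ _), trivial⟩
      · have : Continuous E := by fun_prop
        exact (this.comp continuous_fst).mul (hΨc.comp continuous_snd)
    · intro x hx
      have := h0 x hx.1
      have h2 : 0 < E a * Ψ x := mul_pos (hε.trans_le (hE1 a le_rfl)) (hΨpos x)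
      simp only [hW, max_self]
      linarith
    · intro t ht x hx he
      have hmax : max a t = t := max_eq_right ht.1.le
      have hEt := hE1 t ht.1.le
      have hEΨ : 0 < E t * Ψ x := mul_pos (hε.trans_le hEt) (hΨpos x)
      simp only [hW, hmax] at he
      obtain ⟨hSn, G, l, wt, hJ, hwt, hin, hbd⟩ := hsup t ht.1 x hx.1 (by linarith)
      obtain ⟨G', l', hJ', hl', hbd'⟩ := hΨj x
      refine ⟨?_, fun i => G i + E t * G' i, l + E t * l', wt + κ * E t * Ψ x, ?_, ?_, ?_, ?_⟩
      rotate_left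
      · simp only [hW, hmax]
        exact hJ.add (hJ'.const_mul (E t))
      · refine HasDerivAt.add ?_ ((hE' t).mul_const (Ψ x))
        refine hwt.congr_of_eventuallyEq ?_
        filter_upwards [lt_mem_nhds ht.1] with s hs
        rw [max_eq_right (le_of_lt hs)]
      · intro hxΩ
        have h1 := hin hxΩ
        have h2 := (le_abs_self _).trans (hLf (v t x) (V t x))
        rw [he, add_sub_cancel_left, abs_of_pos hEΨ, ← he] at h2
        have h3 : E t * l' ≤ E t * (C * Ψ x) :=
          mul_le_mul_of_nonneg_left hl' (hε.trans_le hEt).le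
        have h4 : κ * E t * Ψ x = E t * (C * Ψ x) + Lf * (E t * Ψ x) + E t * Ψ x := by
          rw [hκ]; ring
        linarith
      · intro hxΩ
        rw [NL_add, NL_mul]
        have h1 := hbd hxΩ
        have h2 := mul_pos (hε.trans_le hEt) (hbd' (hSΩ hx.1) hxΩ)
        linarith
      · have h1 := (hv.range01 t x (hSΩ hx.1)).2
        have h2 := hV0 t ht.1.le x hx.1
        have h3 : ε * (1 + ‖x‖ ^ 2) ≤ E t * Ψ x :=
          mul_le_mul hEt (hΨ1 x) (by positivity) (hε.le.trans hEt)
        have h4 : 1 + ‖x‖ ^ 2 ≤ 1 / ε := by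
          rw [le_div_iff₀ hε]; linarith
        have h5 : ‖x‖ < ρ := by
          rw [hρ]; nlinarith [norm_nonneg x0, sq_nonneg (‖x‖ - 1), norm_nonneg x]
        exact inter_mem hSn (mem_nhdsWithin_of_mem_nhds
          (Metric.closedBall_mem_nhds_of_mem (by simpa using h5)))
  have : W b x0 = V b x0 + ε * (Real.exp (κ * (b - a)) * Ψ x0) := by
    simp only [hW, hE, max_eq_right hb]; ring
  linarith
end

section
variable {f φ : ℝ → ℝ} {θ c : ℝ}

theorem _root_.Bistable.hasDerivAt (hf : Bistable f θ) (s : ℝ) : HasDerivAt f (deriv f s) s :=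
  (hf.smooth.differentiable (by norm_num) s).hasDerivAt

theorem _root_.Bistable.continuous_deriv (hf : Bistable f θ) : Continuous (deriv f) :=
  hf.smooth.continuous_deriv le_rfl

theorem _root_.Bistable.deriv_left (hf : Bistable f θ) {s : ℝ} (hs : s < 0) :
    deriv f s = deriv f 0 := by
  have : f =ᶠ[𝓝 s] fun s => deriv f 0 * s := by
    filter_upwards [gt_mem_nhds hs] with y hy using hf.ext_neg y hy
  rw [this.deriv_eq]; simp

theorem _root_.Bistable.deriv_right (hf : Bistable f θ) {s : ℝ} (hs : 1 < s) :
    deriv f s = deriv f 1 := by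
  have : f =ᶠ[𝓝 s] fun s => deriv f 1 * (s - 1) := by
    filter_upwards [lt_mem_nhds hs] with y hy using hf.ext_pos y hy
  rw [this.deriv_eq]; simp

theorem _root_.Bistable.exists_lip (hf : Bistable f θ) :
    ∃ Lf : ℝ, 0 ≤ Lf ∧ ∀ a b, |f a - f b| ≤ Lf * |a - b| := by
  obtain ⟨C, hC⟩ := (isCompact_Icc (a := (0 : ℝ)) (b := 1)).exists_bound_of_continuousOn
    hf.continuous_deriv.continuousOn
  have hall : ∀ s, ‖deriv f s‖ ≤ C := by
    intro s
    rcases lt_or_ge s 0 with hs | hs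
    · rw [hf.deriv_left hs]; exact hC 0 (by simp)
    rcases le_or_gt s 1 with hs' | hs'
    · exact hC s ⟨hs, hs'⟩
    · rw [hf.deriv_right hs']; exact hC 1 (by simp)
  refine ⟨C, (norm_nonneg _).trans (hall 0), fun a b => ?_⟩
  exact convex_univ.norm_image_sub_le_of_norm_deriv_le
    (fun x _ => (hf.hasDerivAt x).differentiableAt) (fun x _ => hall x) (mem_univ b) (mem_univ a)

/-- Strict monotonicity of `f` near its stable zeros. -/
theorem _root_.Bistable.exists_decay (hf : Bistable f θ) :
    ∃ κ δ : ℝ, 0 < κ ∧ 0 < δ ∧ δ ≤ 1 / 8 ∧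
      (∀ a b, a ≤ b → b ≤ 2 * δ → f b - f a ≤ -κ * (b - a)) ∧
      ∀ a b, a ≤ b → 1 - 2 * δ ≤ a → f b - f a ≤ -κ * (b - a) := by
  set κ := min (-deriv f 0) (-deriv f 1) / 2 with hκ
  have h0 := hf.df0
  have h1 := hf.df1
  have hκ0 : 0 < κ := by rw [hκ]; have := lt_min (neg_pos.2 h0) (neg_pos.2 h1); linarith
  have hk0 : deriv f 0 < -κ := by
    have := min_le_left (-deriv f 0) (-deriv f 1); rw [hκ] at hκ0 ⊢; linarith
  have hk1 : deriv f 1 < -κ := by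
    have := min_le_right (-deriv f 0) (-deriv f 1); rw [hκ] at hκ0 ⊢; linarith
  obtain ⟨ε0, hε0, e0⟩ := Metric.eventually_nhds_iff.1
    (hf.continuous_deriv.continuousAt.eventually (gt_mem_nhds hk0))
  obtain ⟨ε1, hε1, e1⟩ := Metric.eventually_nhds_iff.1
    (hf.continuous_deriv.continuousAt.eventually (gt_mem_nhds hk1))
  set δ := min (1 / 8) (min (ε0 / 4) (ε1 / 4)) with hδ
  have d1 : δ ≤ 1 / 8 := min_le_left _ _
  have d2 : δ ≤ ε0 / 4 := (min_le_right _ _).trans (min_le_left _ _)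
  have d3 : δ ≤ ε1 / 4 := (min_le_right _ _).trans (min_le_right _ _)
  have hδ0 : 0 < δ := by positivity
  have hl : ∀ s ≤ 2 * δ, deriv f s ≤ -κ := by
    intro s hs
    rcases lt_or_ge s 0 with hs' | hs'
    · rw [hf.deriv_left hs']; exact hk0.le
    · refine (e0 ?_).le
      rw [Real.dist_eq, sub_zero, abs_of_nonneg hs']; linarith
  have hr : ∀ s, 1 - 2 * δ ≤ s → deriv f s ≤ -κ := by
    intro s hs
    rcases le_or_gt s 1 with hs' | hs'
    · refine (e1 ?_).le
      rw [Real.dist_eq, abs_sub_comm, abs_of_nonneg (by linarith)]; linarith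
    · rw [hf.deriv_right hs']; exact hk1.le
  have hd : Differentiable ℝ f := hf.smooth.differentiable (by norm_num)
  refine ⟨κ, δ, hκ0, hδ0, d1, fun a b hab hb => ?_, fun a b hab ha => ?_⟩
  · exact (convex_Iic (2 * δ)).image_sub_le_mul_sub_of_deriv_le hd.continuous.continuousOn
      hd.differentiableOn (fun x hx => hl x (mem_Iic.1 (interior_subset hx))) a (hab.trans hb) b hb hab
  · exact (convex_Ici (1 - 2 * δ)).image_sub_le_mul_sub_of_deriv_le hd.continuous.continuousOn
      hd.differentiableOn (fun x hx => hr x (interior_subset hx)) a ha b (le_trans ha hab) hab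

theorem _root_.PlanarFront.hasDerivAt (hφ : PlanarFront f θ c φ) (z : ℝ) :
    HasDerivAt φ (deriv φ z) z := hasDerivAt_of_contDiff_two hφ.smooth z

theorem _root_.PlanarFront.hasDerivAt_deriv (hφ : PlanarFront f θ c φ) (z : ℝ) :
    HasDerivAt (deriv φ) (deriv (deriv φ) z) z := hasDerivAt_deriv_of_contDiff_two hφ.smooth z

theorem _root_.PlanarFront.deriv_nonpos (hφ : PlanarFront f θ c φ) (z : ℝ) : deriv φ z ≤ 0 :=
  hφ.anti.antitone.deriv_nonpos

theorem _root_.PlanarFront.hasDerivAt_weighted (hφ : PlanarFront f θ c φ) (z : ℝ) :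
    HasDerivAt (fun z => Real.exp (c * z) * -deriv φ z) (Real.exp (c * z) * f (φ z)) z := by
  have h1 : HasDerivAt (fun z => Real.exp (c * z)) (Real.exp (c * z) * (c * 1)) z :=
    ((hasDerivAt_id z).const_mul c).exp
  refine (h1.mul (hφ.hasDerivAt_deriv z).neg).congr_deriv ?_
  simp only [Pi.neg_apply]
  have := hφ.ode z
  rw [show f (φ z) = -(deriv (deriv φ) z + c * deriv φ z) by linarith]; ring

theorem _root_.PlanarFront.antitoneOn_weighted (hf : Bistable f θ) (hφ : PlanarFront f θ c φ) :
    AntitoneOn (fun z => Real.exp (c * z) * -deriv φ z) (Ici 0) := by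
  have hd := hφ.hasDerivAt_weighted
  refine antitoneOn_of_deriv_nonpos (convex_Ici 0)
    (fun z _ => (hd z).continuousAt.continuousWithinAt)
    (fun z _ => (hd z).differentiableAt.differentiableWithinAt) fun z hz => ?_
  rw [(hd z).deriv]
  rw [interior_Ici] at hz
  refine mul_nonpos_of_nonneg_of_nonpos (Real.exp_pos _).le (hf.neg _ ⟨(hφ.mem z).1, ?_⟩).le
  rw [← hφ.pin]; exact hφ.anti hz

theorem _root_.PlanarFront.monotoneOn_weighted (hf : Bistable f θ) (hφ : PlanarFront f θ c φ) :
    MonotoneOn (fun z => Real.exp (c * z) * -deriv φ z) (Iic 0) := by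
  have hd := hφ.hasDerivAt_weighted
  refine monotoneOn_of_deriv_nonneg (convex_Iic 0)
    (fun z _ => (hd z).continuousAt.continuousWithinAt)
    (fun z _ => (hd z).differentiableAt.differentiableWithinAt) fun z hz => ?_
  rw [(hd z).deriv]
  rw [interior_Iic] at hz
  refine mul_nonneg (Real.exp_pos _).le (hf.pos _ ⟨?_, (hφ.mem z).2⟩).le
  rw [← hφ.pin]; exact hφ.anti hz

theorem _root_.PlanarFront.deriv_neg (hf : Bistable f θ) (hφ : PlanarFront f θ c φ) (z : ℝ) :
    deriv φ z < 0 := by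
  refine lt_of_le_of_ne (hφ.deriv_nonpos z) fun h0 => ?_
  have hzero : ∀ y, Real.exp (c * y) * -deriv φ y ≤ Real.exp (c * z) * -deriv φ z →
      deriv φ y = 0 := by
    intro y hy
    rw [h0, neg_zero, mul_zero] at hy
    have h1 := hφ.deriv_nonpos y
    have h2 := Real.exp_pos (c * y)
    nlinarith
  have key : ∀ a b, a < b → (∀ y ∈ Ioo a b, deriv φ y = 0) → False := by
    intro a b hab hy
    obtain ⟨y, hy', he⟩ := exists_deriv_eq_slope φ hab hφ.smooth.continuous.continuousOn
      (fun y _ => (hφ.hasDerivAt y).differentiableAt.differentiableWithinAt)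
    rw [hy y hy', eq_comm, div_eq_zero_iff] at he
    have := hφ.anti hab
    rcases he with he | he <;> linarith
  rcases le_total 0 z with hz | hz
  · exact key z (z + 1) (by linarith) fun y hy =>
      hzero y (hφ.antitoneOn_weighted hf hz (hz.trans hy.1.le) hy.1.le)
  · exact key (z - 1) z (by linarith) fun y hy =>
      hzero y (hφ.monotoneOn_weighted hf (mem_Iic.2 (hy.2.le.trans hz)) hz hy.2.le)

theorem one_add_sq_mul_exp_le {a z : ℝ} (ha : 0 < a) :
    (1 + z ^ 2) * Real.exp (-(a * |z|)) ≤ 1 + 2 / a ^ 2 := by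
  have h1 := Real.quadratic_le_exp_of_nonneg (mul_nonneg ha.le (abs_nonneg z))
  have h2 := Real.exp_pos (a * |z|)
  have h0 := mul_nonneg ha.le (abs_nonneg z)
  rw [Real.exp_neg, ← div_eq_mul_inv, div_le_iff₀ h2]
  have h3 : 1 + z ^ 2 ≤ (1 + 2 / a ^ 2) * (1 + a * |z| + (a * |z|) ^ 2 / 2) := by
    have e : (2 / a ^ 2) * ((a * |z|) ^ 2 / 2) = z ^ 2 := by
      rw [mul_pow, sq_abs]; field_simp
    have : 0 ≤ 2 / a ^ 2 := by positivity
    nlinarith [mul_nonneg this h0]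
  exact h3.trans (mul_le_mul_of_nonneg_left h1 (by positivity))

theorem exists_bound_of_eventually {F : ℝ → ℝ} (hF : Continuous F) {C1 C2 : ℝ}
    (h1 : ∀ᶠ z in atTop, |F z| ≤ C1) (h2 : ∀ᶠ z in atBot, |F z| ≤ C2) : ∃ K, ∀ z, |F z| ≤ K := by
  obtain ⟨a, ha⟩ := eventually_atTop.1 h1
  obtain ⟨b, hb⟩ := eventually_atBot.1 h2
  obtain ⟨C, hC⟩ := (isCompact_Icc (a := b) (b := a)).exists_bound_of_continuousOn hF.continuousOn
  refine ⟨max C (max C1 C2), fun z => ?_⟩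
  rcases le_total a z with hz | hz
  · exact (ha z hz).trans ((le_max_left _ _).trans (le_max_right _ _))
  rcases le_total z b with hz' | hz'
  · exact (hb z hz').trans ((le_max_right _ _).trans (le_max_right _ _))
  · exact (hC z ⟨hz', hz⟩).trans (le_max_left _ _)

/-- Exponential decay of the front and of its derivative ahead of the front. -/
theorem _root_.PlanarFront.decay_top (hf : Bistable f θ) (hφ : PlanarFront f θ c φ) :
    ∃ A, 0 ≤ A ∧ ∀ z ≥ 0, |deriv φ z| ≤ A * Real.exp (-(c * z)) ∧
      φ z ≤ A * Real.exp (-(c * z)) := by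
  have hc := hφ.cpos
  set B := -deriv φ 0 with hB
  have hB0 : 0 < B := by linarith [hφ.deriv_neg hf 0]
  have hd : ∀ z ≥ 0, -deriv φ z ≤ B * Real.exp (-(c * z)) := by
    intro z hz
    have := hφ.antitoneOn_weighted hf (mem_Ici.2 le_rfl) hz hz
    simp only [mul_zero, Real.exp_zero, one_mul] at this
    rw [Real.exp_neg, ← div_eq_mul_inv, le_div_iff₀ (Real.exp_pos _)]
    linarith
  have hE : ∀ z, HasDerivAt (fun z => φ z - B / c * Real.exp (-(c * z)))
      (deriv φ z + B * Real.exp (-(c * z))) z := by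
    intro z
    have h1 : HasDerivAt (fun z => Real.exp (-(c * z))) (Real.exp (-(c * z)) * -(c * 1)) z :=
      ((hasDerivAt_id z).const_mul c).neg.exp
    exact ((hφ.hasDerivAt z).sub (h1.const_mul (B / c))).congr_deriv (by field_simp; ring)
  have hmono : MonotoneOn (fun z => φ z - B / c * Real.exp (-(c * z))) (Ici 0) := by
    refine monotoneOn_of_deriv_nonneg (convex_Ici 0)
      (fun z _ => (hE z).continuousAt.continuousWithinAt)
      (fun z _ => (hE z).differentiableAt.differentiableWithinAt) fun z hz => ?_
    rw [(hE z).deriv]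
    linarith [hd z (interior_subset hz)]
  have hlim : Tendsto (fun z => φ z - B / c * Real.exp (-(c * z))) atTop (𝓝 (0 - B / c * 0)) := by
    refine hφ.lim_top.sub (Tendsto.const_mul _ ?_)
    exact Real.tendsto_exp_neg_atTop_nhds_zero.comp (tendsto_id.const_mul_atTop hc)
  rw [mul_zero, sub_zero] at hlim
  have hφle : ∀ z ≥ 0, φ z ≤ B / c * Real.exp (-(c * z)) := by
    intro z hz
    have : φ z - B / c * Real.exp (-(c * z)) ≤ 0 := by
      refine ge_of_tendsto hlim ?_
      filter_upwards [eventually_ge_atTop z] with y hy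
      exact hmono hz (mem_Ici.2 (hz.trans hy)) hy
    linarith
  refine ⟨max B (B / c), hB0.le.trans (le_max_left _ _), fun z hz => ⟨?_, ?_⟩⟩
  · rw [abs_of_nonpos (hφ.deriv_nonpos z)]
    exact (hd z hz).trans (mul_le_mul_of_nonneg_right (le_max_left _ _) (Real.exp_pos _).le)
  · exact (hφle z hz).trans (mul_le_mul_of_nonneg_right (le_max_right _ _) (Real.exp_pos _).le)

/-- Exponential decay behind the front. -/
theorem _root_.PlanarFront.decay_bot (hf : Bistable f θ) (hφ : PlanarFront f θ c φ) :
    ∃ a A Z, 0 < a ∧ 0 ≤ A ∧ ∀ z ≤ Z, |deriv φ z| ≤ A * Real.exp (a * z) ∧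
      1 - φ z ≤ A * Real.exp (a * z) := by
  have hc := hφ.cpos
  obtain ⟨κ, δ, hκ, hδ, -, -, hdec⟩ := hf.exists_decay
  obtain ⟨Z, hZ⟩ := eventually_atBot.1
    ((hφ.lim_bot.eventually (lt_mem_nhds (show 1 - 2 * δ < 1 by linarith))).and
      (eventually_le_atBot 0))
  have hZ0 : Z ≤ 0 := (hZ Z le_rfl).2
  obtain ⟨a, ha, hak⟩ : ∃ a : ℝ, 0 < a ∧ a * (c + a) = κ := by
    refine ⟨(-c + Real.sqrt (c ^ 2 + 4 * κ)) / 2, ?_, ?_⟩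
    · have : c < Real.sqrt (c ^ 2 + 4 * κ) := Real.lt_sqrt_of_sq_lt (by linarith)
      linarith
    · have := Real.mul_self_sqrt (show 0 ≤ c ^ 2 + 4 * κ by positivity)
      nlinarith
  set G : ℝ → ℝ := fun z => Real.exp ((c + a) * z) * (-deriv φ z - a * (1 - φ z)) with hG
  have hGd : ∀ z, HasDerivAt G (Real.exp ((c + a) * z) * (f (φ z) - κ * (1 - φ z))) z := by
    intro z
    have h1 : HasDerivAt (fun z => Real.exp ((c + a) * z))
        (Real.exp ((c + a) * z) * ((c + a) * 1)) z := ((hasDerivAt_id z).const_mul (c + a)).exp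
    refine (h1.mul ((hφ.hasDerivAt_deriv z).neg.sub
      (((hφ.hasDerivAt z).const_sub 1).const_mul a))).congr_deriv ?_
    have := hφ.ode z
    rw [show f (φ z) = -(deriv (deriv φ) z + c * deriv φ z) by linarith, ← hak]
    simp only [Pi.sub_apply, Pi.neg_apply]
    ring
  have hGmono : MonotoneOn G (Iic Z) := by
    refine monotoneOn_of_deriv_nonneg (convex_Iic Z)
      (fun z _ => (hGd z).continuousAt.continuousWithinAt)
      (fun z _ => (hGd z).differentiableAt.differentiableWithinAt) fun z hz => ?_
    rw [(hGd z).deriv]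
    have h1 := hdec (φ z) 1 (hφ.mem z).2.le (hZ z (mem_Iic.1 (interior_subset hz))).1.le
    rw [hf.f1] at h1
    exact mul_nonneg (Real.exp_pos _).le (by linarith)
  have hexp : ∀ b > 0, Tendsto (fun z => Real.exp (b * z)) atBot (𝓝 0) := fun b hb =>
    Real.tendsto_exp_atBot.comp (tendsto_id.const_mul_atBot hb)
  have hGlim : Tendsto G atBot (𝓝 0) := by
    have h1 : Tendsto (fun z => Real.exp (a * z) * -deriv φ 0) atBot (𝓝 (0 * -deriv φ 0)) :=
      (hexp a ha).mul_const _
    have h2 : Tendsto (fun z => Real.exp ((c + a) * z) * a) atBot (𝓝 (0 * a)) :=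
      (hexp (c + a) (by linarith)).mul_const _
    rw [zero_mul] at h1 h2
    have h3 : Tendsto (fun z => Real.exp ((c + a) * z) * -deriv φ z) atBot (𝓝 0) := by
      refine tendsto_of_tendsto_of_tendsto_of_le_of_le' tendsto_const_nhds h1 ?_ ?_
      · exact Eventually.of_forall fun z => mul_nonneg (Real.exp_pos _).le
          (by linarith [hφ.deriv_nonpos z])
      · filter_upwards [eventually_le_atBot 0] with z hz
        have := hφ.monotoneOn_weighted hf hz (mem_Iic.2 le_rfl) hz
        simp only [mul_zero, Real.exp_zero, one_mul] at this
        rw [add_mul, Real.exp_add, mul_comm (Real.exp (c * z)), mul_assoc]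
        exact mul_le_mul_of_nonneg_left this (Real.exp_pos _).le
    have h4 : Tendsto (fun z => Real.exp ((c + a) * z) * (a * (1 - φ z))) atBot (𝓝 0) := by
      refine tendsto_of_tendsto_of_tendsto_of_le_of_le tendsto_const_nhds h2 ?_ ?_
      · exact fun z => mul_nonneg (Real.exp_pos _).le
          (mul_nonneg ha.le (by linarith [(hφ.mem z).2]))
      · exact fun z => mul_le_mul_of_nonneg_left (by nlinarith [(hφ.mem z).1]) (Real.exp_pos _).le
    have := h3.sub h4
    rw [sub_zero] at this
    refine this.congr fun z => ?_
    simp only [hG]; ring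
  have hGpos : ∀ z ≤ Z, 0 ≤ G z := by
    intro z hz
    refine le_of_tendsto hGlim ?_
    filter_upwards [eventually_le_atBot z] with y hy
    exact hGmono (mem_Iic.2 (hy.trans hz)) hz hy
  have hEd : ∀ z, HasDerivAt (fun z => Real.exp (-a * z) * (1 - φ z))
      (Real.exp (-a * z) * (-deriv φ z - a * (1 - φ z))) z := by
    intro z
    have h1 : HasDerivAt (fun z => Real.exp (-a * z)) (Real.exp (-a * z) * (-a * 1)) z :=
      ((hasDerivAt_id z).const_mul (-a)).exp
    exact (h1.mul ((hφ.hasDerivAt z).const_sub 1)).congr_deriv (by ring)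
  have hEmono : MonotoneOn (fun z => Real.exp (-a * z) * (1 - φ z)) (Iic Z) := by
    refine monotoneOn_of_deriv_nonneg (convex_Iic Z)
      (fun z _ => (hEd z).continuousAt.continuousWithinAt)
      (fun z _ => (hEd z).differentiableAt.differentiableWithinAt) fun z hz => ?_
    rw [(hEd z).deriv]
    have := (mul_nonneg_iff_of_pos_left (Real.exp_pos _)).1 (hGpos z (mem_Iic.1 (interior_subset hz)))
    exact mul_nonneg (Real.exp_pos _).le this
  set A := Real.exp (-a * Z) * (1 - φ Z) with hA
  have hA0 : 0 ≤ A := mul_nonneg (Real.exp_pos _).le (by linarith [(hφ.mem Z).2])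
  have hψ : ∀ z ≤ Z, 1 - φ z ≤ A * Real.exp (a * z) := by
    intro z hz
    have h1 := hEmono hz (mem_Iic.2 le_rfl) hz
    have h2 := mul_le_mul_of_nonneg_right h1 (Real.exp_pos (a * z)).le
    simp only at h2
    rw [mul_right_comm, ← Real.exp_add, show -a * z + a * z = 0 by ring, Real.exp_zero,
      one_mul] at h2
    exact h2
  set A' := A * Real.exp (a + c) with hA'
  refine ⟨a, A', Z - 1, ha, by positivity, fun z hz => ⟨?_, ?_⟩⟩
  · obtain ⟨y, hy, he⟩ := exists_deriv_eq_slope φ (show z < z + 1 by linarith)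
      hφ.smooth.continuous.continuousOn
      (fun y _ => (hφ.hasDerivAt y).differentiableAt.differentiableWithinAt)
    rw [add_sub_cancel_left, div_one] at he
    have h1 := hφ.monotoneOn_weighted hf (mem_Iic.2 (by linarith : z ≤ 0))
      (mem_Iic.2 (by linarith [hy.2] : y ≤ 0)) hy.1.le
    simp only at h1
    have h2 := hψ (z + 1) (by linarith)
    have h3 : -deriv φ y ≤ A * Real.exp (a * (z + 1)) := by rw [he]; linarith [(hφ.mem z).2]
    have h4 : Real.exp (c * y) ≤ Real.exp (c * (z + 1)) :=
      Real.exp_le_exp.2 (mul_le_mul_of_nonneg_left hy.2.le hc.le)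
    rw [abs_of_nonpos (hφ.deriv_nonpos z)]
    have h5 : Real.exp (c * z) * -deriv φ z ≤
        Real.exp (c * (z + 1)) * (A * Real.exp (a * (z + 1))) :=
      h1.trans (mul_le_mul h4 h3 (by linarith [hφ.deriv_nonpos y]) (Real.exp_pos _).le)
    have h6 : Real.exp (c * (z + 1)) * (A * Real.exp (a * (z + 1))) =
        Real.exp (c * z) * (A' * Real.exp (a * z)) := by
      rw [hA', show c * (z + 1) = c * z + c by ring, show a * (z + 1) = a * z + a by ring,
        Real.exp_add, Real.exp_add, Real.exp_add]; ring
    rw [h6] at h5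
    exact le_of_mul_le_mul_left h5 (Real.exp_pos _)
  · refine (hψ z (by linarith)).trans (mul_le_mul_of_nonneg_right ?_ (Real.exp_pos _).le)
    exact le_mul_of_one_le_right hA0 (Real.one_le_exp (by linarith))

theorem _root_.PlanarFront.exists_quadratic_decay (hf : Bistable f θ)
    (hφ : PlanarFront f θ c φ) :
    ∃ K, 0 < K ∧ ∀ z, (1 + z ^ 2) * |deriv φ z| ≤ K ∧ (1 + z ^ 2) * |deriv (deriv φ) z| ≤ K := by
  have hc := hφ.cpos
  obtain ⟨Lf, hLf0, hLf⟩ := hf.exists_lip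
  obtain ⟨A, hA, htop⟩ := hφ.decay_top hf
  obtain ⟨a, A', Z, ha, hA', hbot⟩ := hφ.decay_bot hf
  have hsnd : ∀ z, |deriv (deriv φ) z| ≤ c * |deriv φ z| + Lf * min (φ z) (1 - φ z) := by
    intro z
    have h1 := hφ.ode z
    have h2 : |f (φ z)| ≤ Lf * min (φ z) (1 - φ z) := by
      rw [mul_min_of_nonneg _ _ hLf0]
      refine le_min ?_ ?_
      · have := hLf (φ z) 0
        rwa [hf.f0, sub_zero, sub_zero, abs_of_pos (hφ.mem z).1] at this
      · have := hLf (φ z) 1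
        rwa [hf.f1, sub_zero, abs_sub_comm,
          abs_of_pos (show 0 < 1 - φ z by linarith [(hφ.mem z).2])] at this
    rw [show deriv (deriv φ) z = -(c * deriv φ z) - f (φ z) by linarith]
    calc |-(c * deriv φ z) - f (φ z)| ≤ |-(c * deriv φ z)| + |f (φ z)| := abs_sub _ _
      _ ≤ _ := by rw [abs_neg, abs_mul, abs_of_pos hc]; linarith
  have hmul : ∀ {g : ℝ → ℝ} {b B : ℝ}, 0 < b → 0 ≤ B → ∀ z, |g z| ≤ B * Real.exp (-(b * |z|)) →
      |(1 + z ^ 2) * g z| ≤ B * (1 + 2 / b ^ 2) := by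
    intro g b B hb hB z hz
    rw [abs_mul, abs_of_pos (show 0 < 1 + z ^ 2 by positivity)]
    calc (1 + z ^ 2) * |g z| ≤ (1 + z ^ 2) * (B * Real.exp (-(b * |z|))) := by gcongr
      _ = B * ((1 + z ^ 2) * Real.exp (-(b * |z|))) := by ring
      _ ≤ _ := mul_le_mul_of_nonneg_left (one_add_sq_mul_exp_le hb) hB
  have et : ∀ z ≥ (0 : ℝ), Real.exp (-(c * |z|)) = Real.exp (-(c * z)) := fun z hz => by
    rw [abs_of_nonneg hz]
  have eb : ∀ z ≤ (0 : ℝ), Real.exp (-(a * |z|)) = Real.exp (a * z) := fun z hz => by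
    rw [abs_of_nonpos hz]; ring_nf
  have hc1 := continuous_deriv_of_contDiff_two hφ.smooth
  have hc2 := continuous_deriv_deriv_of_contDiff_two hφ.smooth
  obtain ⟨K1, hK1⟩ := exists_bound_of_eventually (F := fun z => (1 + z ^ 2) * deriv φ z)
    (by fun_prop) (C1 := A * (1 + 2 / c ^ 2)) (C2 := A' * (1 + 2 / a ^ 2))
    (by filter_upwards [eventually_ge_atTop 0] with z hz
        refine hmul hc hA z ?_
        rw [et z hz]; exact (htop z hz).1)
    (by filter_upwards [eventually_le_atBot 0, eventually_le_atBot Z] with z hz hz'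
        refine hmul ha hA' z ?_
        rw [eb z hz]; exact (hbot z hz').1)
  obtain ⟨K2, hK2⟩ := exists_bound_of_eventually (F := fun z => (1 + z ^ 2) * deriv (deriv φ) z)
    (by fun_prop) (C1 := ((c + Lf) * A) * (1 + 2 / c ^ 2))
    (C2 := ((c + Lf) * A') * (1 + 2 / a ^ 2))
    (by filter_upwards [eventually_ge_atTop 0] with z hz
        refine hmul hc (by positivity) z ?_
        rw [et z hz]
        have h1 := htop z hz
        have h2 := hsnd z
        have h3 := min_le_left (φ z) (1 - φ z)
        nlinarith [mul_le_mul_of_nonneg_left h1.1 hc.le,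
          mul_le_mul_of_nonneg_left (h3.trans h1.2) hLf0])
    (by filter_upwards [eventually_le_atBot 0, eventually_le_atBot Z] with z hz hz'
        refine hmul ha (by positivity) z ?_
        rw [eb z hz]
        have h1 := hbot z hz'
        have h2 := hsnd z
        have h3 := min_le_right (φ z) (1 - φ z)
        nlinarith [mul_le_mul_of_nonneg_left h1.1 hc.le,
          mul_le_mul_of_nonneg_left (h3.trans h1.2) hLf0])
  refine ⟨max 1 (max K1 K2), by positivity, fun z => ?_⟩
  have h0 : (0 : ℝ) < 1 + z ^ 2 := by positivity
  have h1 := hK1 z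
  have h2 := hK2 z
  simp only [abs_mul, abs_of_pos h0] at h1 h2
  exact ⟨h1.trans ((le_max_left _ _).trans (le_max_right _ _)),
    h2.trans ((le_max_right _ _).trans (le_max_right _ _))⟩

theorem _root_.PlanarFront.exists_slope_bound (hf : Bistable f θ) (hφ : PlanarFront f θ c φ)
    {δ : ℝ} (hδ : 0 < δ) : ∃ m, 0 < m ∧ ∀ z, φ z ∈ Icc δ (1 - δ) → deriv φ z ≤ -m := by
  obtain ⟨b, hb⟩ := eventually_atTop.1 (hφ.lim_top.eventually (gt_mem_nhds hδ))
  obtain ⟨a, ha⟩ := eventually_atBot.1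
    (hφ.lim_bot.eventually (lt_mem_nhds (show 1 - δ < 1 by linarith)))
  have hI : ∀ z, φ z ∈ Icc δ (1 - δ) → z ∈ Icc a b := by
    intro z hz
    constructor
    · by_contra! hcon; linarith [ha z hcon.le, hz.2]
    · by_contra! hcon; linarith [hb z hcon.le, hz.1]
  by_cases hne : (Icc a b).Nonempty
  · obtain ⟨y, -, hy⟩ := isCompact_Icc.exists_isMaxOn hne
      (continuous_deriv_of_contDiff_two hφ.smooth).continuousOn
    refine ⟨-deriv φ y, by linarith [hφ.deriv_neg hf y], fun z hz => ?_⟩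
    rw [neg_neg]; exact hy (hI z hz)
  · exact ⟨1, one_pos, fun z hz => absurd ⟨z, hI z hz⟩ hne⟩

/-- Quantitative stability of the front under vertical shifts compensated by a drift. -/
theorem _root_.PlanarFront.exists_shift_constants (hf : Bistable f θ)
    (hφ : PlanarFront f θ c φ) :
    ∃ κ δ C : ℝ, 0 < κ ∧ 0 < δ ∧ δ ≤ 1 / 8 ∧ 0 < C ∧
      ∀ q, 0 ≤ q → q ≤ δ → ∀ β, C * q ≤ β → ∀ z,
        β * deriv φ z + f (φ z) - f (φ z - q) ≤ -κ * q ∧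
        β * deriv φ z + f (φ z + q) - f (φ z) ≤ -κ * q := by
  obtain ⟨κ, δ, hκ, hδ, hδ8, hl, hr⟩ := hf.exists_decay
  obtain ⟨Lf, hLf0, hLf⟩ := hf.exists_lip
  obtain ⟨m, hm, hslope⟩ := hφ.exists_slope_bound hf hδ
  refine ⟨κ, δ, (Lf + κ) / m, hκ, hδ, hδ8, by positivity, fun q hq hqδ β hβ z => ?_⟩
  have hβ0 : 0 ≤ β := le_trans (by positivity) hβ
  have hdn := hφ.deriv_nonpos z
  have hβd : β * deriv φ z ≤ 0 := mul_nonpos_of_nonneg_of_nonpos hβ0 hdn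
  rcases le_total (φ z) δ with h1 | h1
  · have a1 := hl (φ z - q) (φ z) (by linarith) (by linarith)
    have a2 := hl (φ z) (φ z + q) (by linarith) (by linarith)
    constructor <;> nlinarith
  rcases le_total (1 - δ) (φ z) with h2 | h2
  · have a1 := hr (φ z - q) (φ z) (by linarith) (by linarith)
    have a2 := hr (φ z) (φ z + q) (by linarith) (by linarith)
    constructor <;> nlinarith
  · have h3 := hslope z ⟨h1, h2⟩
    have h4 : β * deriv φ z ≤ -(Lf + κ) * q := by
      have e1 : β * deriv φ z ≤ β * -m := mul_le_mul_of_nonneg_left h3 hβ0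
      have e2 : (Lf + κ) / m * q * m ≤ β * m := mul_le_mul_of_nonneg_right hβ hm.le
      have e3 : (Lf + κ) / m * q * m = (Lf + κ) * q := by field_simp
      linarith
    have a1 := (le_abs_self _).trans (hLf (φ z) (φ z - q))
    have a2 := (le_abs_self _).trans (hLf (φ z + q) (φ z))
    rw [sub_sub_cancel, abs_of_nonneg hq] at a1
    rw [add_sub_cancel_left, abs_of_nonneg hq] at a2
    constructor <;> linarith
end

section
variable {d : ℕ} {h : ℝ → ℝ} {R α L : ℝ} {f φ : ℝ → ℝ} {θ c : ℝ}

theorem _root_.IsFunnel.deriv_left (hΩ : IsFunnel d R α L h) {s : ℝ} (hs : s < 0) :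
    deriv h s = 0 := by
  have : h =ᶠ[𝓝 s] fun _ => R := by
    filter_upwards [Iio_mem_nhds hs] with y hy using hΩ.left y (le_of_lt hy)
  rw [this.deriv_eq, deriv_const]

/-- A smallness property at `σ x₁ → +∞` that holds in the past propagates to all times. -/
theorem Sol.small_at_end {F : ℝ → ℝ} {v : ℝ → Euc d → ℝ} (hΩ : IsFunnel d R α L h)
    (hv : Sol d h F v) {Lf : ℝ} (hLf : ∀ a b, |F a - F b| ≤ Lf * |a - b|) {η M σ : ℝ}
    (hη : 0 < η) (hM : 0 ≤ M) (hF0 : ∀ s ∈ Icc (0 : ℝ) η, F s ≤ 0)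
    (hFM : ∀ s ∈ Icc (0 : ℝ) 1, F s ≤ M) (hσ : σ = 1 ∨ σ = -1)
    (hpast : ∀ ε > 0, ∃ T₀, ∀ T ≤ T₀, ∃ A, ∀ x ∈ closure (funnel d h), A ≤ σ * x 0 → v T x ≤ ε)
    (t : ℝ) {ε : ℝ} (hε : 0 < ε) :
    ∃ A, ∀ x ∈ closure (funnel d h), A ≤ σ * x 0 → v t x ≤ ε := by
  set e := min ε η / 2 with he
  have he0 : 0 < e := by rw [he]; positivity
  have heε : 2 * e ≤ ε := by rw [he]; linarith [min_le_left ε η]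
  have heη : 2 * e ≤ η := by rw [he]; linarith [min_le_right ε η]
  obtain ⟨T₀, hT₀⟩ := hpast e he0
  set T := min T₀ t with hT
  obtain ⟨A, hA⟩ := hT₀ T (min_le_left _ _)
  set B := max 1 (Real.exp A) with hB
  have hB1 : 1 ≤ B := le_max_left _ _
  have hBA : Real.exp A ≤ B := le_max_right _ _
  set l := 1 + 2 * M / η with hl
  have hl1 : 1 ≤ l := by rw [hl]; linarith [show 0 ≤ 2 * M / η by positivity]
  have hσ2 : σ * σ = 1 := by rcases hσ with rfl | rfl <;> norm_num
  have key := hv.comparison hΩ hLf (S := closure (funnel d h)) isClosed_closure subset_rfl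
    (a := T) (V := fun s x => e + B * Real.exp (l * (s - T) - σ * x 0)) ?_ ?_ ?_ ?_
  · refine ⟨Real.log (B / e) + l * (t - T), fun x hx hxA => (key t (min_le_right _ _) x hx).trans ?_⟩
    have h1 : Real.exp (l * (t - T) - σ * x 0) ≤ e / B := by
      rw [← Real.exp_log (show 0 < e / B by positivity)]
      refine Real.exp_le_exp.2 ?_
      rw [← inv_div B e, Real.log_inv]; linarith
    have h2 : B * Real.exp (l * (t - T) - σ * x 0) ≤ e := by
      calc _ ≤ B * (e / B) := by gcongr
        _ = e := by field_simp
    simp only; linarith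
  · apply Continuous.continuousOn
    have := continuous_coord (d := d) 0
    fun_prop
  · intro s _ x _; positivity
  · intro x hx
    rcases le_or_gt A (σ * x 0) with hxA | hxA
    · have := hA x hx hxA
      have : 0 ≤ B * Real.exp (l * (T - T) - σ * x 0) := by positivity
      simp only; linarith
    · have h1 := (hv.range01 T x hx).2
      have h2 : 1 ≤ B * Real.exp (l * (T - T) - σ * x 0) := by
        calc (1 : ℝ) = Real.exp A * Real.exp (-A) := by rw [← Real.exp_add]; simp
          _ ≤ B * Real.exp (l * (T - T) - σ * x 0) := by
            gcongr
            linarith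
      simp only; linarith
  · intro s hs x hx hVv
    simp only at hVv ⊢
    have hV1 : e + B * Real.exp (l * (s - T) - σ * x 0) < 1 := hVv.trans_le (hv.range01 s x hx).2
    set E := B * Real.exp (l * (s - T) - σ * x 0) with hE
    have hE0 : 0 < E := by positivity
    have hd1 : ∀ y, HasDerivAt (fun y => e + B * Real.exp (l * (s - T) - σ * y))
        (-σ * (B * Real.exp (l * (s - T) - σ * y))) y := fun y => by
      have h1 : HasDerivAt (fun y => l * (s - T) - σ * y) (-(σ * 1)) y :=
        ((hasDerivAt_id y).const_mul σ).const_sub _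
      exact ((h1.exp.const_mul B).const_add e).congr_deriv (by ring)
    have hd2 : HasDerivAt (fun y => -σ * (B * Real.exp (l * (s - T) - σ * y))) E (x 0) := by
      have h1 : HasDerivAt (fun y => l * (s - T) - σ * y) (-(σ * 1)) (x 0) :=
        ((hasDerivAt_id (x 0)).const_mul σ).const_sub _
      refine ((h1.exp.const_mul B).const_mul (-σ)).congr_deriv ?_
      rw [hE]; linear_combination (B * Real.exp (l * (s - T) - σ * x 0)) * hσ2
    refine ⟨self_mem_nhdsWithin, _, _, l * E,
      jet_coord_comp 0 x (Eventually.of_forall hd1) hd2, ?_, fun _ => ?_, fun _ => ?_⟩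
    · have h1 : HasDerivAt (fun s => l * (s - T) - σ * x 0) (l * 1) s :=
        (((hasDerivAt_id s).sub_const T).const_mul l).sub_const _
      exact ((h1.exp.const_mul B).const_add e).congr_deriv (by rw [hE]; ring)
    · rcases le_or_gt (e + E) η with h1 | h1
      · have := hF0 (e + E) ⟨by positivity, h1⟩
        nlinarith
      · have h2 := hFM (e + E) ⟨by positivity, hV1.le⟩
        have h3 : M ≤ 2 * M / η * E := by
          calc M = 2 * M / η * (η / 2) := by field_simp
            _ ≤ _ := by gcongr; linarith
        rw [hl]; linarith
    · rw [NL_coord_zero]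
      have hn := hΩ.deriv_nonneg (x 0)
      rcases hσ with hσ | hσ
      · rw [hσ]; rw [hσ] at hE; rw [← hE]; nlinarith
      · have hx0 : x 0 < 0 := by
          by_contra hx0
          push Not at hx0
          have : 1 ≤ Real.exp (l * (s - T) - σ * x 0) := by
            apply Real.one_le_exp
            rw [hσ]
            have : 0 ≤ l * (s - T) := mul_nonneg (by linarith) (by linarith)
            linarith
          nlinarith
        rw [hΩ.deriv_left hx0]; simp

theorem _root_.Bistable.exists_le (hf : Bistable f θ) :
    ∃ M, 0 ≤ M ∧ ∀ s ∈ Icc (0 : ℝ) 1, |f s| ≤ M := by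
  obtain ⟨M, hM⟩ := isCompact_Icc.exists_bound_of_continuousOn
    (s := Icc (0 : ℝ) 1) hf.smooth.continuous.continuousOn
  exact ⟨M, (norm_nonneg _).trans (hM 0 ⟨le_rfl, zero_le_one⟩), hM⟩

theorem _root_.IsEntireSolution.small_right {u : ℝ → Euc d → ℝ} (hf : Bistable f θ)
    (hφ : PlanarFront f θ c φ) (hΩ : IsFunnel d R α L h) (hu : IsEntireSolution d h f c φ u)
    (t : ℝ) {ε : ℝ} (hε : 0 < ε) :
    ∃ A, ∀ x ∈ closure (funnel d h), A ≤ x 0 → u t x ≤ ε := by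
  obtain ⟨Lf, -, hLf⟩ := hf.exists_lip
  obtain ⟨M, hM, hMf⟩ := hf.exists_le
  have := hu.sol.small_at_end hΩ hLf (η := θ / 2) (σ := 1) (by linarith [hf.θmem.1]) hM
    (fun s hs => ?_) (fun s hs => (abs_le.1 (hMf s hs)).2) (Or.inl rfl) ?_ t hε
  · simpa using this
  · rcases hs.1.eq_or_lt with h0 | h0
    · rw [← h0, hf.f0]
    · exact (hf.neg s ⟨h0, by linarith [hs.2, hf.θmem.1]⟩).le
  · intro e he
    obtain ⟨T₀, hT₀⟩ := hu.past (e / 2) (by positivity)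
    refine ⟨T₀, fun T hT => ?_⟩
    obtain ⟨Z, hZ⟩ := eventually_atTop.1
      (hφ.lim_top.eventually (gt_mem_nhds (show (0 : ℝ) < e / 2 by positivity)))
    refine ⟨Z + c * T, fun x hx hxA => ?_⟩
    have h1 := (abs_le.1 (hT₀ T hT x hx)).2
    have h2 := hZ (x 0 - c * T) (by linarith)
    linarith

theorem lip_one_sub {Lf : ℝ} (hLf : ∀ a b, |f a - f b| ≤ Lf * |a - b|) (a b : ℝ) :
    |-f (1 - a) - -f (1 - b)| ≤ Lf * |a - b| := by
  have := hLf (1 - b) (1 - a)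
  rw [show -f (1 - a) - -f (1 - b) = f (1 - b) - f (1 - a) by ring]
  rwa [show 1 - b - (1 - a) = a - b by ring] at this

theorem _root_.IsEntireSolution.large_left {u : ℝ → Euc d → ℝ} (hf : Bistable f θ)
    (hφ : PlanarFront f θ c φ) (hΩ : IsFunnel d R α L h) (hu : IsEntireSolution d h f c φ u)
    (t : ℝ) {ε : ℝ} (hε : 0 < ε) :
    ∃ A, ∀ x ∈ closure (funnel d h), x 0 ≤ -A → 1 - ε ≤ u t x := by
  obtain ⟨Lf, -, hLf⟩ := hf.exists_lip
  obtain ⟨M, hM, hMf⟩ := hf.exists_le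
  have := (hu.sol.one_sub hΩ).small_at_end hΩ (lip_one_sub hLf) (η := (1 - θ) / 2) (σ := -1)
    (by linarith [hf.θmem.2]) hM (fun s hs => ?_)
    (fun s hs => by
      have := (abs_le.1 (hMf (1 - s) ⟨by linarith [hs.2], by linarith [hs.1]⟩)).1
      linarith) (Or.inr rfl) ?_ t hε
  · obtain ⟨A, hA⟩ := this
    refine ⟨A, fun x hx hxA => ?_⟩
    linarith [hA x hx (by linarith)]
  · rcases hs.1.eq_or_lt with h0 | h0
    · rw [← h0, sub_zero, hf.f1, neg_zero]
    · linarith [hf.pos (1 - s) ⟨by linarith [hs.2, hf.θmem.2], by linarith⟩]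
  · intro e he
    obtain ⟨T₀, hT₀⟩ := hu.past (e / 2) (by positivity)
    refine ⟨T₀, fun T hT => ?_⟩
    obtain ⟨Z, hZ⟩ := eventually_atBot.1
      (hφ.lim_bot.eventually (lt_mem_nhds (show 1 - e / 2 < (1 : ℝ) by linarith)))
    refine ⟨-Z - c * T, fun x hx hxA => ?_⟩
    have h1 := (abs_le.1 (hT₀ T hT x hx)).1
    have h2 := hZ (x 0 - c * T) (by linarith)
    linarith
end

section
variable {d : ℕ} {h : ℝ → ℝ} {R α L : ℝ} {f φ : ℝ → ℝ} {θ c : ℝ} {u : ℝ → Euc d → ℝ}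

theorem _root_.CompletePropagation.ball (hprop : CompletePropagation d h u) (r : ℝ) {ε : ℝ}
    (hε : 0 < ε) :
    ∃ T, ∀ t ≥ T, ∀ x ∈ closure (funnel d h), ‖x‖ ≤ r → 1 - ε ≤ u t x := by
  have hK : IsCompact (closure (funnel d h) ∩ Metric.closedBall 0 r) :=
    (isCompact_closedBall 0 r).inter_left isClosed_closure
  have h1 := (tendstoLocallyUniformlyOn_iff_tendstoUniformlyOn_of_compact hK).1
    (hprop.mono inter_subset_left)
  obtain ⟨T, hT⟩ := eventually_atTop.1 (Metric.tendstoUniformlyOn_iff.1 h1 ε hε)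
  refine ⟨T, fun t ht x hx hxr => ?_⟩
  have := hT t ht x ⟨hx, by simpa using hxr⟩
  rw [Real.dist_eq] at this
  linarith [(abs_lt.1 this).2]

theorem norm_le_of_coord_zero (hΩ : IsFunnel d R α L h) {x : Euc d}
    (hx : x ∈ closure (funnel d h)) (h0 : x 0 = 0) : ‖x‖ ≤ R := by
  have h1 := primeNorm_le_of_mem_closure hΩ hx
  rw [h0, hΩ.left 0 le_rfl] at h1
  refine le_of_sq_le_sq ?_ hΩ.Rpos.le
  rw [norm_sq_eq, ← primeNorm_sq, h0]
  nlinarith [primeNorm_nonneg x]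

theorem _root_.IsEntireSolution.uniform_left (hf : Bistable f θ)
    (hφ : PlanarFront f θ c φ) (hΩ : IsFunnel d R α L h) (hu : IsEntireSolution d h f c φ u)
    (hprop : CompletePropagation d h u) {ε : ℝ} (hε : 0 < ε) :
    ∃ T, ∀ t ≥ T, ∀ x ∈ closure (funnel d h), x 0 ≤ 0 → 1 - ε ≤ u t x := by
  obtain ⟨Lf, -, hLf⟩ := hf.exists_lip
  obtain ⟨κ, δ, C, hκ, hδ, -, hC, hshift⟩ := hφ.exists_shift_constants hf
  have hc := hφ.cpos
  obtain ⟨e, he0, heδ, hec, heε⟩ : ∃ e : ℝ, 0 < e ∧ e ≤ δ ∧ C * e ≤ c / 2 ∧ 2 * e ≤ ε := by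
    refine ⟨min δ (min (c / (2 * C)) (ε / 2)), by positivity, min_le_left _ _, ?_, ?_⟩
    · calc _ ≤ C * (c / (2 * C)) := by
            gcongr; exact (min_le_right _ _).trans (min_le_left _ _)
        _ = c / 2 := by field_simp
    · linarith [(min_le_right δ (min (c / (2 * C)) (ε / 2))).trans (min_le_right _ _)]
  obtain ⟨T₁, hT₁⟩ := hprop.ball R he0
  obtain ⟨A, hA⟩ := hu.large_left hf hφ hΩ T₁ he0
  obtain ⟨Z, hZ⟩ := eventually_atTop.1 (hφ.lim_top.eventually (gt_mem_nhds he0))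
  obtain ⟨Y, hY⟩ := eventually_atBot.1
    (hφ.lim_bot.eventually (lt_mem_nhds (show 1 - e < (1 : ℝ) by linarith)))
  have hφc := hφ.smooth.continuous
  have hcoord := continuous_coord (d := d) 0
  have key := (hu.sol.one_sub hΩ).comparison hΩ (lip_one_sub hLf)
    (S := closure (funnel d h) ∩ {x | x 0 ≤ 0})
    (isClosed_closure.inter (isClosed_le hcoord continuous_const)) inter_subset_left (a := T₁)
    (V := fun t x => 1 + e - φ (x 0 - c / 2 * (t - T₁) + (A + Z))) ?_ ?_ ?_ ?_
  · refine ⟨max T₁ (T₁ + 2 / c * (A + Z - Y)), fun t ht x hx hx0 => ?_⟩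
    have h1 := key t ((le_max_left _ _).trans ht) x ⟨hx, hx0⟩
    have h2 := (le_max_right _ _).trans ht
    have h3 := hY (x 0 - c / 2 * (t - T₁) + (A + Z)) (by
      have : c / 2 * (2 / c * (A + Z - Y)) ≤ c / 2 * (t - T₁) := by gcongr; linarith
      rw [show c / 2 * (2 / c * (A + Z - Y)) = A + Z - Y by field_simp] at this
      linarith)
    simp only at h1
    linarith
  · apply Continuous.continuousOn
    fun_prop
  · intro t _ x _
    have := (hφ.mem (x 0 - c / 2 * (t - T₁) + (A + Z))).2
    simp only; linarith
  · rintro x ⟨hx, -⟩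
    simp only
    rcases le_or_gt (x 0) (-A) with hxA | hxA
    · linarith [hA x hx hxA, (hφ.mem (x 0 - c / 2 * (T₁ - T₁) + (A + Z))).2]
    · linarith [hZ (x 0 - c / 2 * (T₁ - T₁) + (A + Z)) (by linarith), (hu.range01 T₁ x hx).1]
  · rintro t ht x ⟨hx, hx0⟩ hV
    simp only at hV ⊢
    set z := x 0 - c / 2 * (t - T₁) + (A + Z) with hz
    have hx0' : x 0 < 0 := by
      refine lt_of_le_of_ne hx0 fun h0 => ?_
      linarith [hT₁ t ht.le x hx (norm_le_of_coord_zero hΩ hx h0), (hφ.mem z).2]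
    have hd1 : ∀ y, HasDerivAt (fun y => 1 + e - φ (y - c / 2 * (t - T₁) + (A + Z)))
        (-deriv φ (y - c / 2 * (t - T₁) + (A + Z))) y := fun y =>
      (((hφ.hasDerivAt _).comp y (((hasDerivAt_id y).sub_const _).add_const _)).const_sub
        _).congr_deriv (by simp)
    have hd2 : HasDerivAt (fun y => -deriv φ (y - c / 2 * (t - T₁) + (A + Z)))
        (-deriv (deriv φ) z) (x 0) :=
      (((hφ.hasDerivAt_deriv _).comp (x 0)
        (((hasDerivAt_id (x 0)).sub_const _).add_const _)).neg).congr_deriv (by simp [hz])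
    refine ⟨?_, _, _, c / 2 * deriv φ z,
      jet_coord_comp 0 x (Eventually.of_forall hd1) hd2, ?_, fun _ => ?_, fun _ => ?_⟩
    · refine inter_mem self_mem_nhdsWithin (mem_nhdsWithin_of_mem_nhds ?_)
      filter_upwards [hcoord.continuousAt.eventually (gt_mem_nhds hx0')] with y hy using hy.le
    · refine (((hφ.hasDerivAt z).comp t (((((hasDerivAt_id t).sub_const T₁).const_mul
        (c / 2)).const_sub (x 0)).add_const (A + Z))).const_sub (1 + e)).congr_deriv ?_
      ring
    · have h1 := (hshift e he0.le heδ (c / 2) hec z).1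
      have h2 := hφ.ode z
      rw [show 1 - (1 + e - φ z) = φ z - e by ring]
      nlinarith
    · rw [NL_coord_zero, hΩ.deriv_left hx0']; simp
end

section
variable {d : ℕ} {h : ℝ → ℝ} {R α L : ℝ}

/-- A smooth function of `s = r²` equal to `r` for large `r` and to `0` for small `r`. -/
def radialCut (L s : ℝ) : ℝ := √s * Real.smoothTransition ((s - 4 * L ^ 2) / L ^ 2)

theorem radialCut_eq_zero (hL : 0 < L) {s : ℝ} (hs : s ≤ 4 * L ^ 2) : radialCut L s = 0 := by
  rw [radialCut, Real.smoothTransition.zero_of_nonpos, mul_zero]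
  exact div_nonpos_of_nonpos_of_nonneg (by linarith) (by positivity)

theorem radialCut_eq_sqrt (hL : 0 < L) {s : ℝ} (hs : 5 * L ^ 2 ≤ s) : radialCut L s = √s := by
  rw [radialCut, Real.smoothTransition.one_of_one_le, mul_one]
  rw [le_div_iff₀ (by positivity)]; linarith

theorem radialCut_nonneg (L s : ℝ) : 0 ≤ radialCut L s :=
  mul_nonneg (Real.sqrt_nonneg _) (Real.smoothTransition.nonneg _)

theorem radialCut_le_sqrt (L s : ℝ) : radialCut L s ≤ √s :=
  mul_le_of_le_one_right (Real.sqrt_nonneg _) (Real.smoothTransition.le_one _)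

theorem contDiff_radialCut (hL : 0 < L) : ContDiff ℝ 2 (radialCut L) := by
  rw [contDiff_iff_contDiffAt]
  intro s
  rcases lt_or_ge s (4 * L ^ 2) with hs | hs
  · have : radialCut L =ᶠ[𝓝 s] fun _ => 0 := by
      filter_upwards [Iio_mem_nhds hs] with y hy using radialCut_eq_zero hL (le_of_lt hy)
    exact contDiffAt_const.congr_of_eventuallyEq this
  · have hs0 : s ≠ 0 := by have : 0 < 4 * L ^ 2 := by positivity
                           linarith
    refine (Real.contDiffAt_sqrt hs0).mul ?_
    refine (Real.smoothTransition.contDiffAt (n := 2)).comp s ?_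
    fun_prop

theorem deriv_radialCut (hL : 0 < L) {s : ℝ} (hs : 5 * L ^ 2 < s) :
    deriv (radialCut L) s = 1 / (2 * √s) := by
  have : radialCut L =ᶠ[𝓝 s] fun y => √y := by
    filter_upwards [Ioi_mem_nhds hs] with y hy using radialCut_eq_sqrt hL (le_of_lt hy)
  have hs0 : 0 < s := lt_of_le_of_lt (by positivity) hs
  rw [this.deriv_eq, (Real.hasDerivAt_sqrt hs0.ne').deriv]

theorem deriv_deriv_radialCut (hL : 0 < L) {s : ℝ} (hs : 5 * L ^ 2 < s) :
    deriv (deriv (radialCut L)) s = -1 / (4 * √s * s) := by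
  have : deriv (radialCut L) =ᶠ[𝓝 s] fun y => 1 / (2 * √y) := by
    filter_upwards [Ioi_mem_nhds hs] with y hy using deriv_radialCut hL hy
  have hs0 : 0 < s := lt_of_le_of_lt (by positivity) hs
  have hq : 0 < √s := Real.sqrt_pos.2 hs0
  have h1 := ((Real.hasDerivAt_sqrt hs0.ne').const_mul 2).inv (mul_pos two_pos hq).ne'
  simp only [one_div] at this
  rw [this.deriv_eq]
  refine h1.deriv.trans ?_
  have h2 : s = √s ^ 2 := (Real.sq_sqrt hs0.le).symm
  rw [mul_pow, ← h2]
  field_simp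
  norm_num

/-- A regularization of `x ↦ |x|` in the conical part, vanishing in the cylindrical part, and
compatible with the Neumann condition. -/
structure IsRadial (d : ℕ) (h : ℝ → ℝ) (g : Euc d → ℝ) (K r₁ : ℝ) : Prop where
  continuous : Continuous g
  bound_nonneg : 0 ≤ K
  radius_pos : 0 < r₁
  bounds : ∀ x, 0 ≤ g x ∧ g x ≤ ‖x‖
  left : ∀ x : Euc d, x 0 ≤ 0 → g x = 0
  right : ∀ x ∈ closure (funnel d h), 0 ≤ x 0 → r₁ ≤ ‖x‖ → g x = ‖x‖
  jet : ∀ x ∈ closure (funnel d h), ∃ G l, Jet g x G l ∧ (x ∉ funnel d h → NL h x G = 0) ∧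
    |l| ≤ K ∧ |∑ i, G i ^ 2| ≤ K ∧ (r₁ ≤ g x → l = d / g x ∧ ∑ i, G i ^ 2 = 1)

theorem _root_.IsFunnel.exists_radial (hΩ : IsFunnel d R α L h) :
    ∃ (g : Euc d → ℝ) (K r₁ : ℝ), IsRadial d h g K r₁ := by
  have hL := hΩ.L_pos
  have hb : 0 < L * Real.cos α := mul_pos hL hΩ.cos_pos
  set b := L * Real.cos α with hbdef
  set Γ := radialCut L with hΓ
  have hΓ2 : ContDiff ℝ 2 Γ := contDiff_radialCut hL
  set χ : ℝ → ℝ := fun s => max 0 (min 1 (2 * s / b - 1)) with hχ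
  have hχ0 : ∀ s, 0 ≤ χ s := fun s => le_max_left _ _
  have hχ1 : ∀ s, χ s ≤ 1 := fun s => max_le zero_le_one (min_le_left _ _)
  have hχz : ∀ s ≤ b / 2, χ s = 0 := fun s hs => by
    refine max_eq_left ((min_le_right _ _).trans ?_)
    have : 2 * s / b ≤ 1 := by rw [div_le_one hb]; linarith
    linarith
  have hχo : ∀ s, b ≤ s → χ s = 1 := fun s hs => by
    have : 2 ≤ 2 * s / b := by rw [le_div_iff₀ hb]; linarith
    simp only [hχ]
    rw [min_eq_left (by linarith)]; norm_num
  have hn : Continuous fun x : Euc d => ‖x‖ ^ 2 := by fun_prop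
  have hcoord := continuous_coord (d := d) 0
  have hdΓ := continuous_deriv_of_contDiff_two hΓ2
  have hddΓ := continuous_deriv_deriv_of_contDiff_two hΓ2
  obtain ⟨K₁, hK₁⟩ := isCompact_Icc.exists_bound_of_continuousOn (s := Icc 0 (9 * L ^ 2))
    (f := fun s => deriv Γ s * (2 * (d + 1)) + deriv (deriv Γ) s * (4 * s)) (by fun_prop)
  obtain ⟨K₂, hK₂⟩ := isCompact_Icc.exists_bound_of_continuousOn (s := Icc 0 (9 * L ^ 2))
    (f := fun s => 4 * deriv Γ s ^ 2 * s) (by fun_prop)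
  set K := max 0 (max (max K₁ K₂) (max (d / (3 * L)) 1)) with hK
  have kK₁ : K₁ ≤ K := by simp [hK]
  have kK₂ : K₂ ≤ K := by simp [hK]
  have kK₃ : d / (3 * L) ≤ K := by simp [hK]
  have kK₄ : 1 ≤ K := by simp [hK]
  refine ⟨fun x => Γ (‖x‖ ^ 2) * χ (x 0), K, 3 * L, ?_, le_max_left _ _, by positivity, fun x => ⟨?_, ?_⟩,
    fun x hx => ?_, fun x hx h0 hr => ?_, fun x hx => ?_⟩
  · have := hΓ2.continuous
    fun_prop
  · exact mul_nonneg (radialCut_nonneg _ _) (hχ0 _)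
  · refine (mul_le_of_le_one_right (radialCut_nonneg _ _) (hχ1 _)).trans ?_
    refine (radialCut_le_sqrt _ _).trans ?_
    rw [Real.sqrt_sq (norm_nonneg _)]
  · simp only; rw [hχz _ (by linarith), mul_zero]
  · have hx0 : b ≤ x 0 := by
      by_contra hx0
      push Not at hx0
      linarith [hΩ.norm_le_of_mid hx h0 hx0.le]
    simp only
    rw [hχo _ hx0, mul_one, hΓ, radialCut_eq_sqrt hL (by nlinarith), Real.sqrt_sq (norm_nonneg _)]
  · rcases le_or_gt (x 0) b with hxb | hxb
    · have he : (fun x : Euc d => Γ (‖x‖ ^ 2) * χ (x 0)) =ᶠ[𝓝 x] fun _ => 0 := by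
        rcases lt_or_ge (x 0) (b / 2) with h1 | h1
        · filter_upwards [hcoord.continuousAt.eventually (gt_mem_nhds h1)] with y hy
          rw [hχz _ hy.le, mul_zero]
        · have h2 : ‖x‖ ^ 2 < 4 * L ^ 2 := by
            nlinarith [hΩ.norm_le_of_mid hx (by linarith) hxb, norm_nonneg x]
          filter_upwards [hn.continuousAt.eventually (gt_mem_nhds h2)] with y hy
          rw [hΓ, radialCut_eq_zero hL hy.le, zero_mul]
      refine ⟨_, _, (jet_const 0 x).congr he, fun _ => NL_zero h x, by simp [hK], by simp [hK],
        fun h3 => ?_⟩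
      have h4 := he.self_of_nhds
      simp only at h3 h4
      rw [h4] at h3
      linarith
    · have he : (fun x : Euc d => Γ (‖x‖ ^ 2) * χ (x 0)) =ᶠ[𝓝 x] fun y => Γ (‖y‖ ^ 2) := by
        filter_upwards [hcoord.continuousAt.eventually (lt_mem_nhds hxb)] with y hy
        rw [hχo _ hy.le, mul_one]
      have hj : Jet (fun z : Euc d => ‖z‖ ^ 2) x (fun i => 2 * x i) (2 * (d + 1)) := by
        simpa using jet_dist_sq 0 x
      have hj2 := hj.comp (F := Γ) (F1 := deriv Γ)
        (Eventually.of_forall fun s => hasDerivAt_of_contDiff_two hΓ2 s)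
        (hasDerivAt_deriv_of_contDiff_two hΓ2 _)
      have hs2 : ∑ i, (2 * x i) ^ 2 = 4 * ‖x‖ ^ 2 := by
        rw [EuclideanSpace.real_norm_sq_eq, Finset.mul_sum]
        exact Finset.sum_congr rfl fun i _ => by ring
      have hs1 : ∑ i, (deriv Γ (‖x‖ ^ 2) * (2 * x i)) ^ 2
          = 4 * deriv Γ (‖x‖ ^ 2) ^ 2 * ‖x‖ ^ 2 := by
        calc _ = deriv Γ (‖x‖ ^ 2) ^ 2 * ∑ i, (2 * x i) ^ 2 := by
              rw [Finset.mul_sum]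
              exact Finset.sum_congr rfl fun i _ => by ring
          _ = _ := by rw [hs2]; ring
      rw [hs2] at hj2
      have hfar : 3 * L ≤ ‖x‖ → deriv Γ (‖x‖ ^ 2) * (2 * (d + 1)) +
          deriv (deriv Γ) (‖x‖ ^ 2) * (4 * ‖x‖ ^ 2) = d / ‖x‖ ∧
          4 * deriv Γ (‖x‖ ^ 2) ^ 2 * ‖x‖ ^ 2 = 1 := fun hr => by
        have hr0 : 0 < ‖x‖ := by linarith
        have h5 : 5 * L ^ 2 < ‖x‖ ^ 2 := by nlinarith
        rw [deriv_radialCut hL h5, deriv_deriv_radialCut hL h5, Real.sqrt_sq hr0.le]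
        constructor
        · field_simp; ring
        · field_simp; norm_num
      refine ⟨_, _, hj2.congr he, fun hx' => ?_, ?_, ?_, fun h3 => ?_⟩
      · rw [NL_mul, NL_norm_sq h x (primeNorm_pos_of_notMem hΩ hx hx'),
          primeNorm_eq_of_notMem hΩ hx hx', hΩ.right _ hxb.le, hΩ.deriv_right hxb]
        ring
      · rcases le_or_gt (3 * L) ‖x‖ with hr | hr
        · rw [(hfar hr).1, abs_of_nonneg (by positivity)]
          refine le_trans ?_ kK₃
          gcongr
        · exact (hK₁ _ ⟨by positivity, by nlinarith [norm_nonneg x]⟩).trans kK₁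
      · rw [hs1]
        rcases le_or_gt (3 * L) ‖x‖ with hr | hr
        · rw [(hfar hr).2]; simpa using kK₄
        · exact (hK₂ _ ⟨by positivity, by nlinarith [norm_nonneg x]⟩).trans kK₂
      · have hr : 3 * L ≤ ‖x‖ := by
          refine h3.trans ((mul_le_of_le_one_right (radialCut_nonneg _ _) (hχ1 _)).trans ?_)
          refine (radialCut_le_sqrt _ _).trans ?_
          rw [Real.sqrt_sq (norm_nonneg _)]
        have hg : Γ (‖x‖ ^ 2) * χ (x 0) = ‖x‖ := by
          rw [hχo _ hxb.le, mul_one, hΓ, radialCut_eq_sqrt hL (by nlinarith),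
            Real.sqrt_sq (norm_nonneg _)]
        simp only
        rw [hg, hs1]
        exact hfar hr
end

section
/-- The amplitude correction of the barriers. -/
def amp (κ ε τ s : ℝ) : ℝ := s ^ (-(3 / 2) : ℝ) + ε * Real.exp (-(κ / 2) * (s - τ))

/-- A bounded primitive of `C * amp`. -/
def drift (C κ ε τ s : ℝ) : ℝ :=
  -(2 * C) * s ^ (-(1 / 2) : ℝ) - 2 * C * ε / κ * Real.exp (-(κ / 2) * (s - τ))

section
variable {C κ ε τ s : ℝ}

theorem amp_pos (hε : 0 ≤ ε) (hs : 0 < s) : 0 < amp κ ε τ s := by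
  have := Real.rpow_pos_of_pos hs (-(3 / 2))
  unfold amp; positivity

theorem le_amp_self (hτ : 0 < τ) : ε ≤ amp κ ε τ τ := by
  have := Real.rpow_pos_of_pos hτ (-(3 / 2))
  simp only [amp, sub_self, mul_zero, Real.exp_zero, mul_one]; linarith

theorem exp_decay_le_one (hκ : 0 < κ) (hs : τ ≤ s) : Real.exp (-(κ / 2) * (s - τ)) ≤ 1 := by
  rw [Real.exp_le_one_iff]
  nlinarith

theorem amp_le (hκ : 0 < κ) (hε : 0 ≤ ε) (hτ : 0 < τ) (hs : τ ≤ s) :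
    amp κ ε τ s ≤ τ ^ (-(3 / 2) : ℝ) + ε := by
  have h1 : s ^ (-(3 / 2) : ℝ) ≤ τ ^ (-(3 / 2) : ℝ) :=
    Real.rpow_le_rpow_of_nonpos hτ hs (by norm_num)
  have h2 := mul_le_of_le_one_right hε (exp_decay_le_one hκ hs)
  unfold amp; linarith

theorem hasDerivAt_exp_decay (κ τ s : ℝ) :
    HasDerivAt (fun s => Real.exp (-(κ / 2) * (s - τ)))
      (-(κ / 2) * Real.exp (-(κ / 2) * (s - τ))) s := by
  have h1 : HasDerivAt (fun s => -(κ / 2) * (s - τ)) (-(κ / 2) * 1) s :=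
    ((hasDerivAt_id s).sub_const τ).const_mul _
  exact h1.exp.congr_deriv (by ring)

theorem exists_hasDerivAt_amp (hκ : 0 < κ) (hs : 0 < s) (hs3 : 3 / κ ≤ s) :
    ∃ q', HasDerivAt (amp κ ε τ) q' s ∧ -(κ / 2) * amp κ ε τ s ≤ q' := by
  refine ⟨_, (Real.hasDerivAt_rpow_const (Or.inl hs.ne')).add
    ((hasDerivAt_exp_decay κ τ s).const_mul ε), ?_⟩
  have h1 : s ^ (-(3 / 2) - 1 : ℝ) = s ^ (-(3 / 2) : ℝ) / s := Real.rpow_sub_one hs.ne' _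
  have h2 := Real.rpow_pos_of_pos hs (-(3 / 2))
  rw [h1, amp]
  have h3 : s ^ (-(3 / 2) : ℝ) / s ≤ s ^ (-(3 / 2) : ℝ) * (κ / 3) := by
    rw [div_eq_mul_inv]
    gcongr
    rw [inv_le_comm₀ hs (by positivity), inv_div]
    exact hs3
  nlinarith

theorem hasDerivAt_drift (hκ : 0 < κ) (hs : 0 < s) :
    HasDerivAt (drift C κ ε τ) (C * amp κ ε τ s) s := by
  have h1 := ((Real.hasDerivAt_rpow_const (p := -(1 / 2)) (Or.inl hs.ne')).const_mul
    (-(2 * C))).sub ((hasDerivAt_exp_decay κ τ s).const_mul (2 * C * ε / κ))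
  refine h1.congr_deriv ?_
  rw [amp, show (-(1 / 2) - 1 : ℝ) = -(3 / 2) by norm_num]
  field_simp
  ring

theorem abs_drift_le (hC : 0 ≤ C) (hκ : 0 < κ) (hε : 0 ≤ ε) (hτ : 1 ≤ τ) (hs : τ ≤ s) :
    |drift C κ ε τ s| ≤ 2 * C + 2 * C * ε / κ := by
  have hs1 : 1 ≤ s := hτ.trans hs
  have h1 : s ^ (-(1 / 2) : ℝ) ≤ 1 := Real.rpow_le_one_of_one_le_of_nonpos hs1 (by norm_num)
  have h2 : 0 ≤ s ^ (-(1 / 2) : ℝ) := Real.rpow_nonneg (by linarith) _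
  have h3 := exp_decay_le_one hκ hs
  have h4 := Real.exp_pos (-(κ / 2) * (s - τ))
  have h5 : 0 ≤ 2 * C * ε / κ := by positivity
  have h6 := mul_le_of_le_one_right h5 h3
  have h7 := mul_le_of_le_one_right (show 0 ≤ 2 * C by positivity) h1
  have h8 := mul_nonneg h5 h4.le
  have h9 := mul_nonneg (show 0 ≤ 2 * C by positivity) h2
  rw [abs_le, drift]
  constructor <;> linarith

theorem tendsto_amp (hκ : 0 < κ) : Tendsto (amp κ ε τ) atTop (𝓝 0) := by
  have h1 : Tendsto (fun s : ℝ => s ^ (-(3 / 2) : ℝ)) atTop (𝓝 0) :=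
    tendsto_rpow_neg_atTop (by norm_num)
  have h2 : Tendsto (fun s : ℝ => κ / 2 * (s - τ)) atTop atTop :=
    (tendsto_atTop_add_const_right _ (-τ) tendsto_id).const_mul_atTop (by positivity)
  have h3 := (Real.tendsto_exp_neg_atTop_nhds_zero.comp h2).const_mul ε
  have h4 := h1.add h3
  rw [mul_zero, add_zero] at h4
  refine h4.congr fun s => ?_
  simp [amp]
end

theorem tendsto_log_position {c : ℝ} (hc : 0 < c) (a : ℝ) :
    Tendsto (fun s => c * s - a * Real.log s) atTop atTop := by
  have h1 : (fun s => a * Real.log s) =o[atTop] (fun s : ℝ => s) :=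
    Real.isLittleO_log_id_atTop.const_mul_left a
  have h2 := h1.bound (show 0 < c / 2 by positivity)
  refine tendsto_atTop_mono' _ ?_ (tendsto_id.const_mul_atTop (show 0 < c / 2 by positivity))
  filter_upwards [h2, eventually_ge_atTop 0] with s hs hs0
  rw [Real.norm_eq_abs, Real.norm_eq_abs, abs_of_nonneg hs0] at hs
  have := (abs_le.1 hs).2
  simp only [id]
  linarith

set_option maxHeartbeats 400000 in
/-- The error made by replacing the radial front by a planar one is `O(s⁻² log s)`. -/
theorem exists_error_bound {c κ K K₂ r₁ B : ℝ} (D : ℝ) (hD : 0 ≤ D) (hc : 0 < c) (hκ : 0 < κ)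
    (hK : 0 ≤ K) (hK₂ : 0 ≤ K₂) (hB : 0 ≤ B) :
    ∃ τ₀ ≥ 1, ∀ s ≥ τ₀, ∀ g ξ l Q p₁ p₂ : ℝ, |ξ - (c * s - D / c * Real.log s)| ≤ B →
      |l| ≤ K → |Q| ≤ K → (r₁ ≤ g → l = D / g ∧ Q = 1) →
      (1 + (g - ξ) ^ 2) * |p₁| ≤ K₂ → (1 + (g - ξ) ^ 2) * |p₂| ≤ K₂ →
      |p₁ * (l - D / (c * s)) + p₂ * (Q - 1)| ≤ κ / 2 * s ^ (-(3 / 2) : ℝ) := by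
  set C₁ := (2 * D * K₂ + 16 * K₂ * (2 * K + D / c + 1)) / c ^ 2 with hC₁
  have hC₁0 : 0 ≤ C₁ := by positivity
  have e1 : ∀ᶠ s : ℝ in atTop, D / c * Real.log s + B ≤ c * s / 4 := by
    have := (tendsto_log_position (show 0 < c / 4 by positivity) (D / c)).eventually_ge_atTop B
    filter_upwards [this] with s hs
    linarith
  have e2 : ∀ᶠ s : ℝ in atTop, C₁ * (1 + (D / c * Real.log s + B)) ≤ κ / 2 * s ^ (1 / 2 : ℝ) := by
    have h1 : (fun s => C₁ * (D / c) * Real.log s) =o[atTop] (fun s : ℝ => s ^ (1 / 2 : ℝ)) :=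
      (isLittleO_log_rpow_atTop (by norm_num)).const_mul_left _
    have h2 := h1.bound (show 0 < κ / 4 by positivity)
    have h3 := (tendsto_rpow_atTop (show (0 : ℝ) < 1 / 2 by norm_num)).eventually_ge_atTop
      (C₁ * (1 + B) / (κ / 4))
    filter_upwards [h2, h3, eventually_ge_atTop 0] with s hs hs3 hs0
    rw [div_le_iff₀ (by positivity)] at hs3
    rw [Real.norm_eq_abs, Real.norm_eq_abs, abs_of_nonneg (Real.rpow_nonneg hs0 _)] at hs
    have := (abs_le.1 hs).2
    linarith
  have e3 : ∀ᶠ s : ℝ in atTop, r₁ ≤ c / 2 * s :=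
    (tendsto_id.const_mul_atTop (show 0 < c / 2 by positivity)).eventually_ge_atTop r₁
  obtain ⟨τ₀, hτ₀⟩ := eventually_atTop.1 (e1.and (e2.and (e3.and (eventually_ge_atTop 1))))
  refine ⟨max τ₀ 1, le_max_right _ _, fun s hs g ξ l Q p₁ p₂ hξ hl hQ hfar hp₁ hp₂ => ?_⟩
  obtain ⟨h1, h2, h3, hs1⟩ := hτ₀ s ((le_max_left _ _).trans hs)
  have hs0 : 0 < s := by linarith
  have hlog := Real.log_nonneg hs1
  set m := D / c * Real.log s + B with hm
  have hlog' : 0 ≤ D / c * Real.log s := by positivity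
  have hm0 : 0 ≤ m := by positivity
  have hξ1 := (abs_le.1 hξ).1
  have hξ2 := (abs_le.1 hξ).2
  set z := g - ξ with hz
  have hpow : C₁ * (1 + m) / s ^ 2 ≤ κ / 2 * s ^ (-(3 / 2) : ℝ) := by
    rw [div_le_iff₀ (by positivity), mul_assoc, ← Real.rpow_natCast s 2, ← Real.rpow_add hs0]
    norm_num at h2 ⊢
    exact h2
  refine le_trans ?_ hpow
  rcases le_or_gt (c / 2 * s) g with hg | hg
  · obtain ⟨rfl, rfl⟩ := hfar (h3.trans hg)
    have hg0 : 0 < g := lt_of_lt_of_le (by positivity) hg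
    rw [sub_self, mul_zero, add_zero, abs_mul]
    have h4 : |D / g - D / (c * s)| ≤ D * (|z| + m) * (2 / (c ^ 2 * s ^ 2)) := by
      have h5 : D / g - D / (c * s) = D * (c * s - g) * (1 / (g * (c * s))) := by field_simp
      rw [h5, abs_mul, abs_mul, abs_of_nonneg hD, abs_of_pos (show 0 < 1 / (g * (c * s)) by positivity)]
      have h6 : |c * s - g| ≤ |z| + m := by
        rw [show c * s - g = (c * s - ξ) - z by rw [hz]; ring]
        refine (abs_sub _ _).trans ?_
        have : |c * s - ξ| ≤ m := abs_le.2 ⟨by linarith, by linarith⟩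
        linarith
      have h7 : 1 / (g * (c * s)) ≤ 2 / (c ^ 2 * s ^ 2) := by
        rw [div_le_div_iff₀ (by positivity) (by positivity)]
        nlinarith [mul_le_mul_of_nonneg_right hg (show 0 ≤ c * s by positivity)]
      gcongr
    have h8 : |p₁| * (|z| + m) ≤ K₂ * (1 + m) := by
      have h9 : |z| ≤ 1 + z ^ 2 := by nlinarith [sq_abs z, sq_nonneg (|z| - 1)]
      have h10 : |p₁| * |z| ≤ K₂ := by
        refine le_trans ?_ hp₁
        rw [mul_comm]
        gcongr
      have h11 : |p₁| ≤ K₂ := 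
        (le_mul_of_one_le_left (abs_nonneg _) (by linarith [sq_nonneg z])).trans hp₁
      linarith [mul_le_mul_of_nonneg_right h11 hm0]
    calc |p₁| * |D / g - D / (c * s)| ≤ |p₁| * (D * (|z| + m) * (2 / (c ^ 2 * s ^ 2))) := by gcongr
      _ = (|p₁| * (|z| + m)) * (D * 2 / (c ^ 2 * s ^ 2)) := by ring
      _ ≤ (K₂ * (1 + m)) * (D * 2 / (c ^ 2 * s ^ 2)) := by gcongr
      _ = (2 * D * K₂) / c ^ 2 * (1 + m) / s ^ 2 := by field_simp
      _ ≤ C₁ * (1 + m) / s ^ 2 := by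
        gcongr
        rw [hC₁]
        gcongr
        have : 0 ≤ 16 * K₂ * (2 * K + D / c + 1) := by positivity
        linarith
  · have hz4 : c * s / 4 ≤ -z := by rw [hz]; linarith
    have hz2 : (c * s / 4) ^ 2 ≤ z ^ 2 := by
      rw [← neg_sq z]; gcongr
    have hp : ∀ p, (1 + z ^ 2) * |p| ≤ K₂ → |p| ≤ 16 * K₂ / (c ^ 2 * s ^ 2) := fun p hp => by
      rw [le_div_iff₀ (by positivity)]
      have : (c * s / 4) ^ 2 * |p| ≤ (1 + z ^ 2) * |p| := by gcongr; linarith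
      linarith [show |p| * (c ^ 2 * s ^ 2) = 16 * ((c * s / 4) ^ 2 * |p|) by ring]
    have h5 : |l - D / (c * s)| ≤ K + D / c := by
      refine (abs_sub _ _).trans ?_
      rw [abs_of_nonneg (show 0 ≤ D / (c * s) by positivity)]
      gcongr
      exact le_mul_of_one_le_right hc.le hs1
    have h6 : |Q - 1| ≤ K + 1 := by
      refine (abs_sub _ _).trans ?_
      rw [abs_one]; linarith
    calc |p₁ * (l - D / (c * s)) + p₂ * (Q - 1)|
        ≤ |p₁| * |l - D / (c * s)| + |p₂| * |Q - 1| := by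
          rw [← abs_mul, ← abs_mul]; exact abs_add_le _ _
      _ ≤ 16 * K₂ / (c ^ 2 * s ^ 2) * (K + D / c) + 16 * K₂ / (c ^ 2 * s ^ 2) * (K + 1) := by
          gcongr
          · exact hp _ hp₁
          · exact hp _ hp₂
      _ = (16 * K₂ * (2 * K + D / c + 1)) / c ^ 2 * 1 / s ^ 2 := by field_simp; ring
      _ ≤ C₁ * (1 + m) / s ^ 2 := by
        rw [hC₁]
        gcongr
        · have : 0 ≤ 2 * D * K₂ := by positivity
          linarith
        · linarith
end

section
variable {d : ℕ} {h : ℝ → ℝ} {R α L : ℝ} {f φ : ℝ → ℝ} {θ c : ℝ} {u : ℝ → Euc d → ℝ}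

/-- The corrected position of the front. -/
def position (c D C κ ε τ σ s : ℝ) : ℝ := c * s - D / c * Real.log s + σ * drift C κ ε τ s

theorem hasDerivAt_position {c D C κ ε τ σ s : ℝ} (hκ : 0 < κ) (hs : 0 < s) :
    HasDerivAt (position c D C κ ε τ σ) (c - D / (c * s) + σ * (C * amp κ ε τ s)) s := by
  have h1 := (((hasDerivAt_id s).const_mul c).sub
    ((Real.hasDerivAt_log hs.ne').const_mul (D / c))).add
    ((hasDerivAt_drift (C := C) (ε := ε) (τ := τ) hκ hs).const_mul σ)
  refine h1.congr_deriv ?_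
  rw [mul_one, ← div_eq_mul_inv, div_div]

theorem abs_position_sub_le {c D C κ ε τ σ s B : ℝ} (hσ : |σ| = 1)
    (hB : |drift C κ ε τ s| ≤ B) :
    |position c D C κ ε τ σ s - (c * s - D / c * Real.log s)| ≤ B := by
  rw [position, add_sub_cancel_left, abs_mul, hσ, one_mul]
  exact hB

/-- The differential inequalities behind the two barriers. -/
theorem _root_.PlanarFront.exists_barrier_constants (hf : Bistable f θ) (hφ : PlanarFront f θ c φ)
    {D K r₁ : ℝ} (hD : 0 ≤ D) (hK : 0 ≤ K) :
    ∃ κ ε C B τ₀ : ℝ, 0 < κ ∧ 0 < ε ∧ 1 ≤ τ₀ ∧ ∀ τ ≥ τ₀, ∀ s ≥ τ,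
      |drift C κ ε τ s| ≤ B ∧ ∃ q', HasDerivAt (amp κ ε τ) q' s ∧
      ∀ g ξ l Q, |ξ - (c * s - D / c * Real.log s)| ≤ B → |l| ≤ K → |Q| ≤ K →
      (r₁ ≤ g → l = D / g ∧ Q = 1) →
      deriv φ (g - ξ) * l + deriv (deriv φ) (g - ξ) * Q + f (φ (g - ξ) + amp κ ε τ s) ≤
        -(c - D / (c * s) + 1 * (C * amp κ ε τ s)) * deriv φ (g - ξ) + q' ∧
      -(deriv φ (g - ξ) * l + deriv (deriv φ) (g - ξ) * Q) - f (φ (g - ξ) - amp κ ε τ s) ≤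
        (c - D / (c * s) + -1 * (C * amp κ ε τ s)) * deriv φ (g - ξ) + q' := by
  obtain ⟨κ, δ, C, hκ, hδ, -, hC, hshift⟩ := hφ.exists_shift_constants hf
  obtain ⟨K₂, hK₂, hdecay⟩ := hφ.exists_quadratic_decay hf
  have hc := hφ.cpos
  set B := 2 * C + 2 * C * (δ / 2) / κ with hB
  obtain ⟨τ₁, hτ₁, herr⟩ := exists_error_bound (r₁ := r₁) (B := B) D hD hc hκ hK hK₂.le
    (by positivity)
  have e1 : ∀ᶠ τ : ℝ in atTop, τ ^ (-(3 / 2) : ℝ) < δ / 2 :=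
    (tendsto_rpow_neg_atTop (y := 3 / 2) (by norm_num)).eventually (gt_mem_nhds (by positivity))
  obtain ⟨τ₂, hτ₂⟩ := eventually_atTop.1 e1
  refine ⟨κ, δ / 2, C, B, max τ₁ (max τ₂ (3 / κ)), hκ, by positivity, hτ₁.trans (le_max_left _ _),
    fun τ hτ s hs => ?_⟩
  have hτ1 : τ₁ ≤ τ := (le_max_left _ _).trans hτ
  have hτ2 : τ₂ ≤ τ := ((le_max_left _ _).trans (le_max_right _ _)).trans hτ
  have hτ3 : 3 / κ ≤ τ := ((le_max_right _ _).trans (le_max_right _ _)).trans hτ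
  have hτ0 : 0 < τ := by linarith
  have hs0 : 0 < s := by linarith
  refine ⟨abs_drift_le hC.le hκ (by positivity) (by linarith) hs, ?_⟩
  obtain ⟨q', hq', hq'le⟩ := exists_hasDerivAt_amp (ε := δ / 2) (τ := τ) hκ hs0 (hτ3.trans hs)
  refine ⟨q', hq', fun g ξ l Q hξ hl hQ hfar => ?_⟩
  have hq0 := amp_pos (κ := κ) (τ := τ) (show 0 ≤ δ / 2 by positivity) hs0
  have hqδ : amp κ (δ / 2) τ s ≤ δ := by
    linarith [amp_le hκ (show 0 ≤ δ / 2 by positivity) hτ0 hs, hτ₂ τ hτ2]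
  have hqs : s ^ (-(3 / 2) : ℝ) ≤ amp κ (δ / 2) τ s := by
    rw [amp]; linarith [show 0 ≤ δ / 2 * Real.exp (-(κ / 2) * (s - τ)) by positivity]
  set q := amp κ (δ / 2) τ s with hq
  set z := g - ξ with hz
  have herr' := abs_le.1 (herr s (hτ1.trans hs) g ξ l Q (deriv φ z) (deriv (deriv φ) z) hξ hl hQ hfar
    (hdecay z).1 (hdecay z).2)
  have hbound : κ / 2 * s ^ (-(3 / 2) : ℝ) ≤ κ / 2 * q := by gcongr
  have hode := hφ.ode z
  obtain ⟨hs1, hs2⟩ := hshift q hq0.le hqδ (C * q) le_rfl z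
  constructor
  · linarith [herr'.2]
  · linarith [herr'.1]

theorem continuousOn_barrier {g : Euc d → ℝ} (hφ : PlanarFront f θ c φ) (hg : Continuous g)
    {X q : ℝ → ℝ} {a : ℝ} (hX : ∀ t ≥ a, ContinuousAt X t) (hq : ∀ t ≥ a, ContinuousAt q t) :
    ContinuousOn (fun p : ℝ × Euc d => φ (g p.2 - X p.1)) (Ici a ×ˢ univ) ∧
    ContinuousOn (fun p : ℝ × Euc d => q p.1) (Ici a ×ˢ univ) := by
  constructor
  · intro p hp
    refine ContinuousAt.continuousWithinAt ?_
    have h1 : ContinuousAt (fun p : ℝ × Euc d => X p.1) p :=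
      ContinuousAt.comp (f := fun p : ℝ × Euc d => p.1) (hX p.1 hp.1) continuousAt_fst
    have h2 : ContinuousAt (fun p : ℝ × Euc d => g p.2) p := (hg.comp continuous_snd).continuousAt
    exact ContinuousAt.comp (f := fun p : ℝ × Euc d => g p.2 - X p.1)
      hφ.smooth.continuous.continuousAt (h2.sub h1)
  · intro p hp
    refine ContinuousAt.continuousWithinAt ?_
    exact ContinuousAt.comp (f := fun p : ℝ × Euc d => p.1) (hq p.1 hp.1) continuousAt_fst

theorem _root_.PlanarFront.jet_comp (hφ : PlanarFront f θ c φ) {g : Euc d → ℝ} {x : Euc d}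
    {G : Fin (d + 1) → ℝ} {l : ℝ} (hg : Jet g x G l) (X : ℝ) :
    Jet (fun y => φ (g y - X)) x (fun i => deriv φ (g x - X) * G i)
      (deriv φ (g x - X) * l + deriv (deriv φ) (g x - X) * ∑ i, G i ^ 2) := by
  refine hg.comp (F := fun r => φ (r - X)) (F1 := fun r => deriv φ (r - X))
    (Eventually.of_forall fun r => ?_) ?_
  · exact ((hφ.hasDerivAt _).comp r ((hasDerivAt_id r).sub_const X)).congr_deriv (mul_one _)
  · exact ((hφ.hasDerivAt_deriv _).comp (g x)
      ((hasDerivAt_id (g x)).sub_const X)).congr_deriv (mul_one _)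

theorem norm_le_of_coord_le (hΩ : IsFunnel d R α L h) {x : Euc d}
    (hx : x ∈ closure (funnel d h)) {A : ℝ} (h0 : 0 ≤ x 0) (hA : x 0 ≤ A) :
    ‖x‖ ≤ A + (R + Real.tan α * A) := by
  have h1 := (primeNorm_le_of_mem_closure hΩ hx).trans (hΩ.profile_le (x 0))
  rw [abs_of_nonneg h0] at h1
  have h2 : Real.tan α * x 0 ≤ Real.tan α * A := mul_le_mul_of_nonneg_left hA hΩ.tan_nonneg
  have h3 : ‖x‖ ≤ x 0 + primeNorm x := by
    refine le_of_sq_le_sq ?_ (add_nonneg h0 (primeNorm_nonneg x))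
    rw [norm_sq_eq, ← primeNorm_sq]
    nlinarith [mul_nonneg h0 (primeNorm_nonneg x)]
  linarith

theorem _root_.IsEntireSolution.exists_upper_barrier (hf : Bistable f θ)
    (hφ : PlanarFront f θ c φ) (hΩ : IsFunnel d R α L h) (hu : IsEntireSolution d h f c φ u)
    {g : Euc d → ℝ} {K r₁ : ℝ} (hg : IsRadial d h g K r₁) :
    ∃ (B T : ℝ) (q : ℝ → ℝ), Tendsto q atTop (𝓝 0) ∧ ∀ t ≥ T, ∀ x ∈ closure (funnel d h),
      u t x ≤ φ (g x - (c * t - d / c * Real.log t) - B) + q t := by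
  obtain ⟨Lf, -, hLf⟩ := hf.exists_lip
  have hc := hφ.cpos
  obtain ⟨κ, ε, C, B, τ₀, hκ, hε, hτ₀, hbar⟩ := hφ.exists_barrier_constants hf (D := d) (r₁ := r₁)
    (Nat.cast_nonneg d) hg.bound_nonneg
  obtain ⟨A, hA⟩ := hu.small_right hf hφ hΩ 0 hε
  set A₂ := max 0 (A + (R + Real.tan α * A)) with hA₂
  obtain ⟨Y, hY⟩ := eventually_atBot.1
    (hφ.lim_bot.eventually (lt_mem_nhds (show 1 - ε < (1 : ℝ) by linarith)))
  obtain ⟨τ, hττ₀, hτ⟩ := ((eventually_ge_atTop τ₀).and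
    ((tendsto_log_position hc (d / c)).eventually_ge_atTop (A₂ + B - Y))).exists
  have hτ0 : 0 < τ := by linarith
  set X : ℝ → ℝ := position c d C κ ε τ 1 with hX
  set q := amp κ ε τ with hq
  have hXB : ∀ s ≥ τ, |X s - (c * s - d / c * Real.log s)| ≤ B := fun s hs =>
    abs_position_sub_le abs_one (hbar τ hττ₀ s hs).1
  have hXd : ∀ t ≥ 0, HasDerivAt (fun t => X (t + τ))
      (c - d / (c * (t + τ)) + 1 * (C * q (t + τ))) t := fun t ht =>
    HasDerivAt.comp_add_const t τ (hasDerivAt_position hκ (by linarith))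
  have hqd : ∀ t ≥ 0, ∀ q', HasDerivAt q q' (t + τ) → HasDerivAt (fun t => q (t + τ)) q' t :=
    fun t _ q' hq' => HasDerivAt.comp_add_const t τ hq'
  have hcont := continuousOn_barrier (d := d) (g := g) hφ hg.continuous (a := 0)
    (X := fun t => X (t + τ)) (q := fun t => q (t + τ)) (fun t ht => (hXd t ht).continuousAt)
    (fun t ht => by
      obtain ⟨-, q', hq', -⟩ := hbar τ hττ₀ (t + τ) (by linarith)
      exact (hqd t ht q' hq').continuousAt)
  have key := hu.sol.comparison hΩ hLf (S := closure (funnel d h)) isClosed_closure subset_rfl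
    (a := 0) (V := fun t x => φ (g x - X (t + τ)) + q (t + τ)) (hcont.1.add hcont.2) ?_ ?_ ?_
  · refine ⟨c * τ + B, 1, fun t => q (t + τ), ?_, fun t ht x hx => ?_⟩
    · exact (tendsto_amp hκ).comp (tendsto_atTop_add_const_right _ τ tendsto_id)
    · refine (key t (by linarith) x hx).trans (add_le_add_left (hφ.anti.antitone ?_) _)
      have h1 := (abs_le.1 (hXB (t + τ) (by linarith))).2
      have h2 : Real.log t ≤ Real.log (t + τ) := Real.log_le_log (by linarith) (by linarith)
      have h3 : d / c * Real.log t ≤ d / c * Real.log (t + τ) := by gcongr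
      linarith
  · intro t ht x _
    have h1 := (hφ.mem (g x - X (t + τ))).1
    have h2 : 0 < q (t + τ) := amp_pos hε.le (by linarith)
    linarith
  · intro x hx
    simp only [zero_add]
    have h2 : ε ≤ q τ := le_amp_self hτ0
    have h3 := (hφ.mem (g x - X τ)).1
    rcases le_or_gt A (x 0) with hxA | hxA
    · linarith [hA x hx hxA]
    · have hgA : g x ≤ A₂ := by
        rcases le_or_gt (x 0) 0 with h0 | h0
        · rw [hg.left x h0]; exact le_max_left _ _
        · exact ((hg.bounds x).2.trans (norm_le_of_coord_le hΩ hx h0.le hxA.le)).trans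
            (le_max_right _ _)
      have h4 := (abs_le.1 (hXB τ le_rfl)).1
      have h5 := hY (g x - X τ) (by linarith)
      linarith [(hu.range01 0 x hx).2]
  · intro t ht x hx _
    obtain ⟨G, l, hjet, hNL, hl, hQ, hfar⟩ := hg.jet x hx
    obtain ⟨-, q', hq', hineq⟩ := hbar τ hττ₀ (t + τ) (by linarith)
    have hq2 := hqd t ht.le q' hq'
    refine ⟨self_mem_nhdsWithin, _, _, _,
      (hφ.jet_comp hjet (X (t + τ))).add (jet_const (q (t + τ)) x),
      ((hφ.hasDerivAt _).comp t ((hXd t ht.le).const_sub (g x))).add hq2, fun _ => ?_, fun _ => ?_⟩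
    · have := (hineq (g x) (X (t + τ)) l _ (hXB (t + τ) (by linarith)) hl hQ hfar).1
      linarith
    · have := hNL ‹_›
      rw [NL_add, NL_mul, this, NL_zero]; simp

theorem _root_.IsEntireSolution.exists_lower_barrier (hf : Bistable f θ)
    (hφ : PlanarFront f θ c φ) (hΩ : IsFunnel d R α L h) (hu : IsEntireSolution d h f c φ u)
    (hprop : CompletePropagation d h u) {g : Euc d → ℝ} {K r₁ : ℝ} (hg : IsRadial d h g K r₁) :
    ∃ (B T : ℝ) (q : ℝ → ℝ), Tendsto q atTop (𝓝 0) ∧ ∀ t ≥ T, ∀ x ∈ closure (funnel d h),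
      φ (g x - (c * t - d / c * Real.log t) + B) - q t ≤ u t x := by
  obtain ⟨Lf, -, hLf⟩ := hf.exists_lip
  have hc := hφ.cpos
  obtain ⟨κ, ε, C, B, τ, hκ, hε, hτ₀, hbar⟩ := hφ.exists_barrier_constants hf (D := d) (r₁ := r₁)
    (Nat.cast_nonneg d) hg.bound_nonneg
  replace hbar := hbar τ le_rfl
  have hτ0 : 0 < τ := by linarith
  obtain ⟨Z, hZ⟩ := eventually_atTop.1 (hφ.lim_top.eventually (gt_mem_nhds hε))
  set X : ℝ → ℝ := position c d C κ ε τ (-1) with hX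
  set q := amp κ ε τ with hq
  obtain ⟨T₁, hT₁⟩ := hu.uniform_left hf hφ hΩ hprop hε
  obtain ⟨T₂, hT₂⟩ := hprop.ball (max r₁ (X τ + Z)) hε
  set T := max τ (max T₁ T₂) with hT
  have hTτ : τ ≤ T := le_max_left _ _
  set m := τ - T with hm
  have hXB : ∀ s ≥ τ, |X s - (c * s - d / c * Real.log s)| ≤ B := fun s hs =>
    abs_position_sub_le (by simp) (hbar s hs).1
  have hXd : ∀ t ≥ T, HasDerivAt (fun t => X (t + m))
      (c - d / (c * (t + m)) + -1 * (C * q (t + m))) t := fun t ht =>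
    HasDerivAt.comp_add_const t m (hasDerivAt_position hκ (by linarith))
  have hqd : ∀ t ≥ T, ∀ q', HasDerivAt q q' (t + m) → HasDerivAt (fun t => q (t + m)) q' t :=
    fun t _ q' hq' => HasDerivAt.comp_add_const t m hq'
  have hcont := continuousOn_barrier (d := d) (g := g) hφ hg.continuous (a := T)
    (X := fun t => X (t + m)) (q := fun t => q (t + m)) (fun t ht => (hXd t ht).continuousAt)
    (fun t ht => by
      obtain ⟨-, q', hq', -⟩ := hbar (t + m) (by linarith)
      exact (hqd t ht q' hq').continuousAt)
  have key := (hu.sol.one_sub hΩ).comparison hΩ (lip_one_sub hLf) (S := closure (funnel d h))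
    isClosed_closure subset_rfl (a := T)
    (V := fun t x => (1 + q (t + m)) - φ (g x - X (t + m)))
    ((continuousOn_const.add hcont.2).sub hcont.1) ?_ ?_ ?_
  · refine ⟨-(c * m) + B, T, fun t => q (t + m), ?_, fun t ht x hx => ?_⟩
    · exact (tendsto_amp hκ).comp (tendsto_atTop_add_const_right _ m tendsto_id)
    · have h0 := key t ht x hx
      have h1 := (abs_le.1 (hXB (t + m) (by linarith))).1
      have h2 : Real.log (t + m) ≤ Real.log t := Real.log_le_log (by linarith) (by linarith)
      have h3 : d / c * Real.log (t + m) ≤ d / c * Real.log t := by gcongr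
      have h4 : φ (g x - (c * t - d / c * Real.log t) + (-(c * m) + B)) ≤ φ (g x - X (t + m)) :=
        hφ.anti.antitone (by linarith)
      linarith
  · intro t ht x _
    have h1 := (hφ.mem (g x - X (t + m))).2
    have h2 : 0 < q (t + m) := amp_pos hε.le (by linarith)
    linarith
  · intro x hx
    simp only [show T + m = τ by rw [hm]; ring]
    have h2 : ε ≤ q τ := le_amp_self hτ0
    have h3 := (hφ.mem (g x - X τ)).2
    rcases le_or_gt (x 0) 0 with h0 | h0
    · linarith [hT₁ T ((le_max_left _ _).trans (le_max_right _ _)) x hx h0]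
    · rcases le_or_gt ‖x‖ (max r₁ (X τ + Z)) with h1 | h1
      · linarith [hT₂ T ((le_max_right _ _).trans (le_max_right _ _)) x hx h1]
      · have h4 := hg.right x hx h0.le ((le_max_left _ _).trans h1.le)
        have h5 := (le_max_right r₁ (X τ + Z)).trans h1.le
        have h6 := hZ (g x - X τ) (by linarith)
        linarith [(hu.range01 T x hx).1]
  · intro t ht x hx _
    obtain ⟨G, l, hjet, hNL, hl, hQ, hfar⟩ := hg.jet x hx
    obtain ⟨-, q', hq', hineq⟩ := hbar (t + m) (by linarith)
    have hq2 := hqd t ht.le q' hq'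
    refine ⟨self_mem_nhdsWithin, _, _, _,
      (jet_const (1 + q (t + m)) x).sub (hφ.jet_comp hjet (X (t + m))),
      (hq2.const_add 1).sub ((hφ.hasDerivAt _).comp t ((hXd t ht.le).const_sub (g x))),
      fun _ => ?_, fun hx' => ?_⟩
    · have := (hineq (g x) (X (t + m)) l _ (hXB (t + m) (by linarith)) hl hQ hfar).2
      rw [show 1 - (1 + q (t + m) - φ (g x - X (t + m))) = φ (g x - X (t + m)) - q (t + m) by ring]
      linarith
    · have h1 : NL h x (fun i => 0 - deriv φ (g x - X (t + m)) * G i) = 0 := by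
        have h2 := NL_mul h x (-deriv φ (g x - X (t + m))) G
        rw [hNL hx', mul_zero] at h2
        exact (congrArg (NL h x) (funext fun i => by ring)).trans h2
      exact h1.ge
end

end FunnelFront

/-- part of Theorem 1.7: in case of complete propagation, for every level
`λ ∈ (0,1)` the upper level set of `u(t,·)` is sandwiched, for large times, between the sets
`S_{r(t)-r₀}` and `S_{r(t)+r₀}`, where `r(t) = ct - ((N-1)/c)·ln t`. -/
theorem statement3 (d : ℕ) (f φ h : ℝ → ℝ) (θ c R α L : ℝ)
    (hf : Bistable f θ) (hφ : PlanarFront f θ c φ) (hΩ : IsFunnel d R α L h) (hα : 0 < α)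
    (u : ℝ → Euc d → ℝ) (hu : IsEntireSolution d h f c φ u)
    (hprop : CompletePropagation d h u) :
    ∀ lam ∈ Ioo (0 : ℝ) 1, ∃ r₀ > (0 : ℝ), ∃ T : ℝ, ∀ t : ℝ, T ≤ t →
      (({x ∈ closure (funnel d h) | x 0 ≤ 0} ∪
          {x ∈ closure (funnel d h) | ‖x‖ ≤ c * t - ((d : ℝ) / c) * Real.log t - r₀}) ⊆
        {x ∈ closure (funnel d h) | lam < u t x}) ∧
      ({x ∈ closure (funnel d h) | lam < u t x} ⊆
        ({x ∈ closure (funnel d h) | x 0 ≤ 0} ∪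
          {x ∈ closure (funnel d h) | ‖x‖ ≤ c * t - ((d : ℝ) / c) * Real.log t + r₀})) := by
  rintro lam ⟨hlam0, hlam1⟩
  have hc := hφ.cpos
  obtain ⟨g, K, r₁, hg⟩ := hΩ.exists_radial
  obtain ⟨B₁, T₁, q₁, hq₁, hup⟩ := hu.exists_upper_barrier hf hφ hΩ hg
  obtain ⟨B₂, T₂, q₂, hq₂, hlow⟩ := hu.exists_lower_barrier hf hφ hΩ hprop hg
  have hm : 0 < (1 - lam) / 2 := by linarith
  obtain ⟨T₃, hleft⟩ := hu.uniform_left hf hφ hΩ hprop hm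
  obtain ⟨Z, hZ⟩ := eventually_atTop.1
    (hφ.lim_top.eventually (gt_mem_nhds (show 0 < lam / 2 by linarith)))
  obtain ⟨Y, hY⟩ := eventually_atBot.1
    (hφ.lim_bot.eventually (lt_mem_nhds (show 1 - (1 - lam) / 2 < (1 : ℝ) by linarith)))
  obtain ⟨T₄, hT₄⟩ := eventually_atTop.1
    ((hq₁.eventually (gt_mem_nhds (show 0 < lam / 2 by linarith))).and
    ((hq₂.eventually (gt_mem_nhds hm)).and
    ((FunnelFront.tendsto_log_position hc (d / c)).eventually_ge_atTop r₁)))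
  refine ⟨max 1 (max (Z + B₁) (B₂ - Y)), by positivity, max (max T₁ T₂) (max T₃ T₄),
    fun t ht => ?_⟩
  have ht1 : T₁ ≤ t := ((le_max_left _ _).trans (le_max_left _ _)).trans ht
  have ht2 : T₂ ≤ t := ((le_max_right _ _).trans (le_max_left _ _)).trans ht
  have ht3 : T₃ ≤ t := ((le_max_left _ _).trans (le_max_right _ _)).trans ht
  obtain ⟨e1, e2, e3⟩ := hT₄ t (((le_max_right _ _).trans (le_max_right _ _)).trans ht)
  set r₀ := max 1 (max (Z + B₁) (B₂ - Y)) with hr₀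
  have hr1 : 1 ≤ r₀ := le_max_left _ _
  have hr2 : Z + B₁ ≤ r₀ := (le_max_left _ _).trans (le_max_right _ _)
  have hr3 : B₂ - Y ≤ r₀ := (le_max_right _ _).trans (le_max_right _ _)
  constructor
  · rintro x (⟨hx, hx0⟩ | ⟨hx, hxr⟩)
    · exact ⟨hx, by linarith [hleft t ht3 x hx hx0]⟩
    · have h1 := hlow t ht2 x hx
      have h2 := hY (g x - (c * t - d / c * Real.log t) + B₂) (by linarith [(hg.bounds x).2])
      exact ⟨hx, by linarith⟩
  · rintro x ⟨hx, hxu⟩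
    rcases le_or_gt (x 0) 0 with h0 | h0
    · exact Or.inl ⟨hx, h0⟩
    · refine Or.inr ⟨hx, ?_⟩
      by_contra hxr
      push Not at hxr
      have h1 := hg.right x hx h0.le (by linarith)
      have h2 := hup t ht1 x hx
      have h3 := hZ (g x - (c * t - d / c * Real.log t) - B₁) (by linarith)
      linarith
end
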